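/- Let Ω ⊂ ℝ^d be an open set, let 𝒜 be a k-th order linear constant-coefficient partial differential operator with coefficients A_α ∈ ℝ^{n×m}, and let μ be a finite ℝ^m-valued Radon measure on Ω which is 𝒜-free. Then the polar dμ/d|μ|(x) belongs to the wave cone Λ_𝒜 for |μ^s|-almost every x ∈ Ω, where μ^s is the singular part of μ with respect to Lebesgue measure. -/

import Mathlib

open MeasureTheory Metric

/-- The partial derivative `∂_i φ` of a scalar function on `ℝ^d`. -/
noncomputable def pderiv' {d : ℕ} (i : Fin d) (φ : EuclideanSpace ℝ (Fin d) → ℝ) :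
    EuclideanSpace ℝ (Fin d) → ℝ :=
  fun x => fderiv ℝ φ x (EuclideanSpace.single i 1)

/-- The iterated partial derivative `∂^α φ` for a multi-index `α`. -/
noncomputable def pderivMulti {d : ℕ} (α : Fin d → ℕ) (φ : EuclideanSpace ℝ (Fin d) → ℝ) :
    EuclideanSpace ℝ (Fin d) → ℝ :=
  (List.finRange d).foldr (fun i ψ => (pderiv' i)^[α i] ψ) φ

/-- The finite set of multi-indices `α` with `|α| ≤ k`. -/
def multiIdxLe (d k : ℕ) : Finset (Fin d → ℕ) :=
  (Fintype.piFinset fun _ : Fin d => Finset.range (k + 1)).filter fun α => ∑ i, α i ≤ k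

/-- The finite set of multi-indices `α` with `|α| = k`. -/
def multiIdxEq (d k : ℕ) : Finset (Fin d → ℕ) :=
  (Fintype.piFinset fun _ : Fin d => Finset.range (k + 1)).filter fun α => ∑ i, α i = k

/-- The wave cone `Λ_𝒜` of the `k`-th order operator with coefficients `A`:
all `v` lying in the kernel of the principal symbol `𝔸^k(ξ) = ∑_{|α|=k} ξ^α A_α`
for some `ξ ≠ 0`. -/
def waveCone {d m n : ℕ} (k : ℕ) (A : (Fin d → ℕ) → Matrix (Fin n) (Fin m) ℝ) :
    Set (Fin m → ℝ) :=
  {v | ∃ ξ : Fin d → ℝ, ξ ≠ 0 ∧ ∀ i : Fin n,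
    ∑ α ∈ multiIdxEq d k, (∏ l, ξ l ^ α l) * ∑ j, A α i j * v j = 0}

section Words

variable {d : ℕ}

/-- The iterated partial derivative of `φ` along the letters of the word `w`. -/
noncomputable def wordDeriv (w : List (Fin d)) (φ : EuclideanSpace ℝ (Fin d) → ℝ) :
    EuclideanSpace ℝ (Fin d) → ℝ :=
  w.foldl (fun ψ i => pderiv' i ψ) φ

/-- A word listing each index `i` exactly `α i` times. -/
def multiIdxWord (α : Fin d → ℕ) : List (Fin d) :=
  (List.finRange d).foldr (fun i w => w ++ List.replicate (α i) i) []

theorem wordDeriv_nil (φ : EuclideanSpace ℝ (Fin d) → ℝ) : wordDeriv [] φ = φ := rfl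

theorem wordDeriv_cons (i : Fin d) (w : List (Fin d)) (φ : EuclideanSpace ℝ (Fin d) → ℝ) :
    wordDeriv (i :: w) φ = wordDeriv w (pderiv' i φ) := rfl

theorem wordDeriv_append (u v : List (Fin d)) (φ : EuclideanSpace ℝ (Fin d) → ℝ) :
    wordDeriv (u ++ v) φ = wordDeriv v (wordDeriv u φ) := by
  simp [wordDeriv, List.foldl_append]

theorem wordDeriv_replicate (n : ℕ) (i : Fin d) (φ : EuclideanSpace ℝ (Fin d) → ℝ) :
    wordDeriv (List.replicate n i) φ = (pderiv' i)^[n] φ := by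
  induction n generalizing φ with
  | zero => rfl
  | succ n ih => rw [List.replicate_succ, wordDeriv_cons, ih, Function.iterate_succ_apply]

theorem pderivMulti_eq_wordDeriv (α : Fin d → ℕ) (φ : EuclideanSpace ℝ (Fin d) → ℝ) :
    pderivMulti α φ = wordDeriv (multiIdxWord α) φ := by
  unfold pderivMulti multiIdxWord
  induction List.finRange d with
  | nil => rfl
  | cons i l ih =>
    rw [List.foldr_cons, List.foldr_cons, wordDeriv_append, wordDeriv_replicate, ih]

theorem length_multiIdxWord (α : Fin d → ℕ) : (multiIdxWord α).length = ∑ i, α i := by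
  rw [Fin.sum_univ_def]
  unfold multiIdxWord
  induction List.finRange d with
  | nil => rfl
  | cons i l ih =>
    rw [List.foldr_cons, List.length_append, ih]
    simp [add_comm]

theorem prod_map_multiIdxWord (α : Fin d → ℕ) (ξ : Fin d → ℝ) :
    ((multiIdxWord α).map ξ).prod = ∏ i, ξ i ^ α i := by
  rw [Fin.prod_univ_def]
  unfold multiIdxWord
  induction List.finRange d with
  | nil => rfl
  | cons i l ih =>
    rw [List.foldr_cons, List.map_append, List.prod_append, ih]
    simp [mul_comm]

theorem ContDiff.pderiv' {φ : EuclideanSpace ℝ (Fin d) → ℝ} (hφ : ContDiff ℝ (⊤ : ℕ∞) φ)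
    (i : Fin d) : ContDiff ℝ (⊤ : ℕ∞) (pderiv' i φ) :=
  (hφ.fderiv_right (m := (⊤ : ℕ∞)) (by exact_mod_cast le_top)).clm_apply contDiff_const

theorem ContDiff.wordDeriv {φ : EuclideanSpace ℝ (Fin d) → ℝ} (hφ : ContDiff ℝ (⊤ : ℕ∞) φ)
    (w : List (Fin d)) : ContDiff ℝ (⊤ : ℕ∞) (wordDeriv w φ) := by
  induction w generalizing φ with
  | nil => exact hφ
  | cons i w ih => exact ih (hφ.pderiv' i)

theorem tsupport_pderiv'_subset (i : Fin d) (φ : EuclideanSpace ℝ (Fin d) → ℝ) :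
    tsupport (pderiv' i φ) ⊆ tsupport φ := by
  refine (closure_mono ?_).trans (tsupport_fderiv_subset ℝ (f := φ))
  intro x hx h
  apply hx
  simp [pderiv', h]

theorem tsupport_wordDeriv_subset (w : List (Fin d)) (φ : EuclideanSpace ℝ (Fin d) → ℝ) :
    tsupport (wordDeriv w φ) ⊆ tsupport φ := by
  induction w generalizing φ with
  | nil => exact subset_rfl
  | cons i w ih => exact (ih _).trans (tsupport_pderiv'_subset i φ)

theorem ContDiff.differentiable_top {φ : EuclideanSpace ℝ (Fin d) → ℝ}
    (hφ : ContDiff ℝ (⊤ : ℕ∞) φ) : Differentiable ℝ φ :=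
  hφ.differentiable (by simp)

theorem wordDeriv_add {φ ψ : EuclideanSpace ℝ (Fin d) → ℝ} (hφ : ContDiff ℝ (⊤ : ℕ∞) φ)
    (hψ : ContDiff ℝ (⊤ : ℕ∞) ψ) (w : List (Fin d)) :
    wordDeriv w (fun y => φ y + ψ y) = fun y => wordDeriv w φ y + wordDeriv w ψ y := by
  induction w generalizing φ ψ with
  | nil => rfl
  | cons i w ih =>
    rw [wordDeriv_cons, wordDeriv_cons, wordDeriv_cons, ← ih (hφ.pderiv' i) (hψ.pderiv' i)]
    congr 1
    ext y
    simp only [pderiv']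
    rw [fderiv_fun_add (hφ.differentiable_top y) (hψ.differentiable_top y)]
    simp

theorem wordDeriv_const_mul {φ : EuclideanSpace ℝ (Fin d) → ℝ} (hφ : ContDiff ℝ (⊤ : ℕ∞) φ)
    (c : ℝ) (w : List (Fin d)) :
    wordDeriv w (fun y => c * φ y) = fun y => c * wordDeriv w φ y := by
  induction w generalizing φ with
  | nil => rfl
  | cons i w ih =>
    rw [wordDeriv_cons, wordDeriv_cons, ← ih (hφ.pderiv' i)]
    congr 1
    ext y
    simp only [pderiv']
    rw [fderiv_const_mul (hφ.differentiable_top y)]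
    simp

theorem wordDeriv_zero (w : List (Fin d)) :
    wordDeriv w (fun _ => (0 : ℝ)) = fun _ => 0 := by
  simpa using wordDeriv_const_mul (d := d) (φ := fun _ => 0) contDiff_const 0 w

theorem wordDeriv_sum {ι : Type*} (s : Finset ι) {φ : ι → EuclideanSpace ℝ (Fin d) → ℝ}
    (hφ : ∀ i, ContDiff ℝ (⊤ : ℕ∞) (φ i)) (w : List (Fin d)) :
    wordDeriv w (fun y => ∑ i ∈ s, φ i y) = fun y => ∑ i ∈ s, wordDeriv w (φ i) y := by
  classical
  induction s using Finset.induction_on with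
  | empty => simpa using wordDeriv_zero w
  | insert a s ha ih =>
    simp only [Finset.sum_insert ha]
    rw [wordDeriv_add (hφ a) (ContDiff.sum fun i _ => hφ i), ih]

theorem wordDeriv_comp_affine {φ : EuclideanSpace ℝ (Fin d) → ℝ}
    (hφ : ContDiff ℝ (⊤ : ℕ∞) φ) (a : ℝ) (x : EuclideanSpace ℝ (Fin d)) (w : List (Fin d)) :
    wordDeriv w (fun y => φ (a • (y - x))) =
      fun y => a ^ w.length * wordDeriv w φ (a • (y - x)) := by
  induction w generalizing φ with
  | nil => simp [wordDeriv_nil]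
  | cons i w ih =>
    have h : pderiv' i (fun y => φ (a • (y - x))) = fun y => a * pderiv' i φ (a • (y - x)) := by
      ext y
      simp only [pderiv']
      have h1 : HasFDerivAt (fun y : EuclideanSpace ℝ (Fin d) => a • (y - x))
          (a • ContinuousLinearMap.id ℝ (EuclideanSpace ℝ (Fin d))) y :=
        ((hasFDerivAt_id y).sub_const x).const_smul a
      have h2 := ((hφ.differentiable_top (a • (y - x))).hasFDerivAt.comp y h1).fderiv
      rw [show (fun y => φ (a • (y - x))) = φ ∘ fun y => a • (y - x) from rfl, h2]
      simp
    have hsm : ContDiff ℝ (⊤ : ℕ∞) fun y => pderiv' i φ (a • (y - x)) :=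
      (hφ.pderiv' i).comp (by fun_prop)
    rw [wordDeriv_cons, wordDeriv_cons, h, wordDeriv_const_mul hsm, ih (hφ.pderiv' i)]
    ext y
    simp only [List.length_cons]
    ring

/-- The finite set of words of length less than `n`. -/
noncomputable def wordsLT (d n : ℕ) : Finset (List (Fin d)) :=
  (List.finite_length_lt (Fin d) n).toFinset

/-- The finite set of words of length equal to `n`. -/
noncomputable def wordsEq (d n : ℕ) : Finset (List (Fin d)) :=
  (List.finite_length_eq (Fin d) n).toFinset

theorem mem_wordsLT {n : ℕ} {w : List (Fin d)} : w ∈ wordsLT d n ↔ w.length < n := by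
  simp [wordsLT]

theorem mem_wordsEq {n : ℕ} {w : List (Fin d)} : w ∈ wordsEq d n ↔ w.length = n := by
  simp [wordsEq]

theorem pderiv'_mul {χ Ψ : EuclideanSpace ℝ (Fin d) → ℝ} (hχ : ContDiff ℝ (⊤ : ℕ∞) χ)
    (hΨ : ContDiff ℝ (⊤ : ℕ∞) Ψ) (i : Fin d) :
    pderiv' i (fun y => χ y * Ψ y) = fun y => χ y * pderiv' i Ψ y + pderiv' i χ y * Ψ y := by
  ext y
  simp only [pderiv']
  rw [fderiv_fun_mul (hχ.differentiable_top y) (hΨ.differentiable_top y)]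
  simp [mul_comm]

/-- A quantitative Leibniz rule: up to lower order terms, `χ` commutes with derivatives. -/
theorem exists_leibniz_bound (w : List (Fin d)) {χ : EuclideanSpace ℝ (Fin d) → ℝ}
    (hχ : ContDiff ℝ (⊤ : ℕ∞) χ) (hc : HasCompactSupport χ) :
    ∃ C : ℝ, 0 ≤ C ∧ ∀ Ψ : EuclideanSpace ℝ (Fin d) → ℝ, ContDiff ℝ (⊤ : ℕ∞) Ψ → ∀ z,
      |wordDeriv w (fun y => χ y * Ψ y) z - χ z * wordDeriv w Ψ z| ≤
        C * ∑ u ∈ wordsLT d w.length, |wordDeriv u Ψ z| := by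
  induction w generalizing χ with
  | nil => exact ⟨0, le_rfl, fun Ψ _ z => by simp [wordDeriv_nil]⟩
  | cons i w ih =>
    obtain ⟨C₁, hC₁, h₁⟩ := ih hχ hc
    have hχ' := hχ.pderiv' i
    have hc' : HasCompactSupport (pderiv' i χ) :=
      hc.of_isClosed_subset (isClosed_tsupport _) (tsupport_pderiv'_subset i χ)
    obtain ⟨C₂, hC₂, h₂⟩ := ih hχ' hc'
    obtain ⟨B, hB⟩ := hχ'.continuous.bounded_above_of_compact_support hc'
    refine ⟨C₁ + C₂ + |B|, by positivity, fun Ψ hΨ z => ?_⟩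
    have e : wordDeriv (i :: w) (fun y => χ y * Ψ y) z =
        wordDeriv w (fun y => χ y * pderiv' i Ψ y) z +
          wordDeriv w (fun y => pderiv' i χ y * Ψ y) z := by
      rw [wordDeriv_cons, pderiv'_mul hχ hΨ,
        wordDeriv_add (hχ.mul (hΨ.pderiv' i)) (hχ'.mul hΨ)]
    set S := ∑ u ∈ wordsLT d (i :: w).length, |wordDeriv u Ψ z| with hS
    have hS0 : 0 ≤ S := Finset.sum_nonneg fun _ _ => abs_nonneg _
    have s1 : ∑ u ∈ wordsLT d w.length, |wordDeriv u (pderiv' i Ψ) z| ≤ S := by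
      have : ∑ u ∈ wordsLT d w.length, |wordDeriv u (pderiv' i Ψ) z| =
          ∑ u ∈ (wordsLT d w.length).map ⟨List.cons i, List.cons_injective⟩,
            |wordDeriv u Ψ z| := by
        rw [Finset.sum_map]; rfl
      rw [this]
      refine Finset.sum_le_sum_of_subset_of_nonneg ?_ fun _ _ _ => abs_nonneg _
      intro u hu
      simp only [Finset.mem_map, mem_wordsLT, Function.Embedding.coeFn_mk] at hu ⊢
      obtain ⟨v, hv, rfl⟩ := hu
      simpa using hv
    have s2 : ∑ u ∈ wordsLT d w.length, |wordDeriv u Ψ z| ≤ S := by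
      refine Finset.sum_le_sum_of_subset_of_nonneg ?_ fun _ _ _ => abs_nonneg _
      intro u hu
      simp only [mem_wordsLT, List.length_cons] at hu ⊢
      omega
    have s3 : |wordDeriv w Ψ z| ≤ S :=
      Finset.single_le_sum (f := fun u => |wordDeriv u Ψ z|) (fun _ _ => abs_nonneg _)
        (by simp [mem_wordsLT])
    have b1 := (h₁ _ (hΨ.pderiv' i) z).trans (mul_le_mul_of_nonneg_left s1 hC₁)
    have b2 := (h₂ _ hΨ z).trans (mul_le_mul_of_nonneg_left s2 hC₂)
    have b3 : |pderiv' i χ z * wordDeriv w Ψ z| ≤ |B| * S := by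
      rw [abs_mul]
      exact mul_le_mul ((hB z).trans (le_abs_self B)) s3 (abs_nonneg _) (abs_nonneg _)
    rw [e, wordDeriv_cons]
    rw [abs_le] at b1 b2 b3 ⊢
    constructor <;> nlinarith

end Words

section Fourier

open FourierTransform SchwartzMap LineDeriv

variable {d : ℕ}

/-- Multiplication of a Schwartz function by the Fourier symbol of the word derivative `w`. -/
noncomputable def wordSymbolMul (w : List (Fin d)) (f : 𝓢(EuclideanSpace ℝ (Fin d), ℂ)) :
    𝓢(EuclideanSpace ℝ (Fin d), ℂ) :=
  w.foldl (fun g i => (2 * (Real.pi : ℂ) * Complex.I) •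
    smulLeftCLM ℂ (inner ℝ · (EuclideanSpace.single i (1 : ℝ))) g) f

theorem wordSymbolMul_apply (w : List (Fin d)) (f : 𝓢(EuclideanSpace ℝ (Fin d), ℂ))
    (ξ : EuclideanSpace ℝ (Fin d)) :
    wordSymbolMul w f ξ = (2 * (Real.pi : ℂ) * Complex.I) ^ w.length *
      ((w.map ξ).prod : ℝ) * f ξ := by
  induction w generalizing f with
  | nil => simp [wordSymbolMul]
  | cons i w ih =>
    have h := ih ((2 * (Real.pi : ℂ) * Complex.I) •
      smulLeftCLM ℂ (inner ℝ · (EuclideanSpace.single i (1 : ℝ))) f)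
    have e : wordSymbolMul (i :: w) f = wordSymbolMul w ((2 * (Real.pi : ℂ) * Complex.I) •
      smulLeftCLM ℂ (inner ℝ · (EuclideanSpace.single i (1 : ℝ))) f) := rfl
    rw [e, h, _root_.smul_apply, smulLeftCLM_apply_apply (by fun_prop)]
    simp only [EuclideanSpace.inner_single_right, List.length_cons, List.map_cons, List.prod_cons,
      smul_eq_mul, Complex.real_smul]
    push_cast
    simp
    ring

theorem pderiv'_re (i : Fin d) (f : 𝓢(EuclideanSpace ℝ (Fin d), ℂ)) :
    pderiv' i (fun z => (f z).re) = fun z => ((∂_{EuclideanSpace.single i (1 : ℝ)} f) z).re := by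
  ext z
  rw [SchwartzMap.lineDerivOp_apply_eq_fderiv]
  simp only [pderiv']
  have h := (Complex.reCLM.hasFDerivAt.comp z (f.differentiable z).hasFDerivAt).fderiv
  rw [show (fun z => (f z).re) = Complex.reCLM ∘ f from rfl, h]
  rfl

theorem wordDeriv_re_fourierInv (w : List (Fin d)) (f : 𝓢(EuclideanSpace ℝ (Fin d), ℂ)) :
    wordDeriv w (fun z => ((𝓕⁻ f) z).re) = fun z => ((𝓕⁻ (wordSymbolMul w f)) z).re := by
  induction w generalizing f with
  | nil => rfl
  | cons i w ih =>
    rw [wordDeriv_cons, pderiv'_re, lineDerivOp_fourierInv_eq, ih]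
    rfl

theorem contDiff_re (f : 𝓢(EuclideanSpace ℝ (Fin d), ℂ)) :
    ContDiff ℝ (⊤ : ℕ∞) fun z => (f z).re :=
  Complex.reCLM.contDiff.comp (f.smooth _)

/-- The dilation `z ↦ f (c z)` of a Schwartz function. -/
noncomputable def schwartzDilate (c : ℝ) (hc : c ≠ 0) (f : 𝓢(EuclideanSpace ℝ (Fin d), ℂ)) :
    𝓢(EuclideanSpace ℝ (Fin d), ℂ) :=
  compCLMOfContinuousLinearEquiv ℂ
    (ContinuousLinearEquiv.smulLeft (R₁ := ℝ) (M₁ := EuclideanSpace ℝ (Fin d)) (Units.mk0 c hc)) f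

theorem schwartzDilate_apply (c : ℝ) (hc : c ≠ 0) (f : 𝓢(EuclideanSpace ℝ (Fin d), ℂ))
    (z : EuclideanSpace ℝ (Fin d)) : schwartzDilate c hc f z = f (c • z) := rfl

theorem fourierInv_schwartzDilate {c : ℝ} (hc : 0 < c) (f : 𝓢(EuclideanSpace ℝ (Fin d), ℂ))
    (z : EuclideanSpace ℝ (Fin d)) :
    (𝓕⁻ (schwartzDilate c⁻¹ (inv_ne_zero hc.ne') f)) z = (c : ℂ) ^ d * (𝓕⁻ f) (c • z) := by
  rw [fourierInv_coe, fourierInv_coe, Real.fourierInv_eq, Real.fourierInv_eq]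
  have h := Measure.integral_comp_inv_smul (volume : Measure (EuclideanSpace ℝ (Fin d)))
    (fun v => Real.fourierChar (inner ℝ v (c • z)) • f v) c
  simp only [finrank_euclideanSpace, Fintype.card_fin] at h
  rw [abs_of_nonneg (by positivity)] at h
  rw [show (c : ℂ) ^ d = ((c ^ d : ℝ) : ℂ) by push_cast; rfl, ← Complex.real_smul, ← h]
  congr 1
  ext v
  rw [schwartzDilate_apply, real_inner_smul_left, real_inner_smul_right,
    inv_mul_cancel_left₀ hc.ne']

end Fourier

section Parametrix

open FourierTransform SchwartzMap LineDeriv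

variable {d : ℕ}

theorem contDiff_map_prod (w : List (Fin d)) :
    ContDiff ℝ (⊤ : ℕ∞) fun ξ : EuclideanSpace ℝ (Fin d) => (w.map ξ).prod := by
  induction w with
  | nil => exact contDiff_const
  | cons i w ih =>
    simp only [List.map_cons, List.prod_cons]
    exact ContDiff.mul (by fun_prop) ih

/-- A Schwartz function with frequencies in an annulus that, after application of the elliptic
scalar operator `∑ c s ∂^{w s}`, is the difference of two consecutive dyadic mollifiers. -/
theorem exists_parametrix {ι : Type*} [Fintype ι] (K : ℕ) (c : ι → ℝ) (w : ι → List (Fin d))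
    (hw : ∀ s, (w s).length = K)
    (hell : ∀ ξ : EuclideanSpace ℝ (Fin d), ξ ≠ 0 → ∑ s, c s * ((w s).map ξ).prod ≠ 0) :
    ∃ a ζ : 𝓢(EuclideanSpace ℝ (Fin d), ℂ),
      (∀ ξ, a ξ ≠ 0 → 1 ≤ ‖ξ‖ ∧ ‖ξ‖ ≤ 4) ∧
      (∀ z, ∑ s, c s * wordDeriv (w s) (fun z => ((𝓕⁻ a) z).re) z =
        2 ^ d * ((𝓕⁻ ζ) ((2 : ℝ) • z)).re - ((𝓕⁻ ζ) z).re) ∧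
      ∫ z, ((𝓕⁻ ζ) z).re = 1 := by
  classical
  let ζ : ContDiffBump (0 : EuclideanSpace ℝ (Fin d)) := ⟨1, 2, one_pos, one_lt_two⟩
  have hζ1 : ∀ ξ : EuclideanSpace ℝ (Fin d), ‖ξ‖ ≤ 1 → ζ ξ = 1 := fun ξ h =>
    ζ.one_of_mem_closedBall (by simpa using h)
  have hζ0 : ∀ ξ : EuclideanSpace ℝ (Fin d), 2 ≤ ‖ξ‖ → ζ ξ = 0 := fun ξ h =>
    ζ.zero_of_le_dist (by simpa using h)
  let L : EuclideanSpace ℝ (Fin d) → ℝ := fun ξ => ∑ s, c s * ((w s).map ξ).prod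
  have hL : ContDiff ℝ (⊤ : ℕ∞) L :=
    ContDiff.sum fun s _ => contDiff_const.mul (contDiff_map_prod (w s))
  let q : EuclideanSpace ℝ (Fin d) → ℝ := fun ξ => (ζ ((2⁻¹ : ℝ) • ξ) - ζ ξ) / L ξ
  have hnorm : ∀ ξ : EuclideanSpace ℝ (Fin d), ‖(2⁻¹ : ℝ) • ξ‖ = ‖ξ‖ / 2 := fun ξ => by
    rw [norm_smul]; norm_num; ring
  have hnum : ContDiff ℝ (⊤ : ℕ∞) fun ξ : EuclideanSpace ℝ (Fin d) =>
      ζ ((2⁻¹ : ℝ) • ξ) - ζ ξ :=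
    (ζ.contDiff.comp (by fun_prop)).sub ζ.contDiff
  have hq0 : ∀ ξ, q ξ ≠ 0 → 1 ≤ ‖ξ‖ ∧ ‖ξ‖ ≤ 4 := by
    intro ξ h
    by_contra hcon
    apply h
    simp only [q]
    rw [not_and_or, not_le, not_le] at hcon
    rcases hcon with hcon | hcon
    · rw [hζ1 _ hcon.le, hζ1 _ (by rw [hnorm]; linarith [norm_nonneg ξ])]; simp
    · rw [hζ0 ξ (by linarith), hζ0 _ (by rw [hnorm]; linarith)]; simp
  have hqs : ContDiff ℝ (⊤ : ℕ∞) q := by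
    rw [contDiff_iff_contDiffAt]
    intro ξ
    by_cases h : ξ = 0
    · have : q =ᶠ[nhds ξ] fun _ => 0 := by
        filter_upwards [isOpen_ball.mem_nhds (show ξ ∈ ball (0 : EuclideanSpace ℝ (Fin d)) 1 by
          simp [h])] with y hy
        by_contra hy'
        exact absurd (hq0 y hy').1 (by simpa using hy)
      exact contDiffAt_const.congr_of_eventuallyEq this
    · exact hnum.contDiffAt.div hL.contDiffAt (hell ξ h)
  have hqc : HasCompactSupport q := by
    refine HasCompactSupport.intro (isCompact_closedBall (0 : EuclideanSpace ℝ (Fin d)) 4) ?_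
    intro ξ hξ
    by_contra h
    exact hξ (by simpa using (hq0 ξ h).2)
  have hqc' : HasCompactSupport fun ξ => (q ξ : ℂ) :=
    hqc.comp_left (g := fun r : ℝ => (r : ℂ)) (by simp)
  have hqs' : ContDiff ℝ (⊤ : ℕ∞) fun ξ => (q ξ : ℂ) := Complex.ofRealCLM.contDiff.comp hqs
  have hζc' : HasCompactSupport fun ξ => (ζ ξ : ℂ) :=
    ζ.hasCompactSupport.comp_left (g := fun r : ℝ => (r : ℂ)) (by simp)
  have hζs' : ContDiff ℝ (⊤ : ℕ∞) fun ξ => (ζ ξ : ℂ) := Complex.ofRealCLM.contDiff.comp ζ.contDiff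
  let κ : ℂ := (2 * (Real.pi : ℂ) * Complex.I) ^ K
  have hκ : κ ≠ 0 := pow_ne_zero _ (by simp [Real.pi_ne_zero])
  let Q : 𝓢(EuclideanSpace ℝ (Fin d), ℂ) := hqc'.toSchwartzMap hqs'
  have hQ : ∀ ξ, Q ξ = (q ξ : ℂ) := fun _ => rfl
  let Z : 𝓢(EuclideanSpace ℝ (Fin d), ℂ) := hζc'.toSchwartzMap hζs'
  have hZ : ∀ ξ, Z ξ = (ζ ξ : ℂ) := fun _ => rfl
  refine ⟨κ⁻¹ • Q, Z, ?_, ?_, ?_⟩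
  · intro ξ h
    refine hq0 ξ fun h0 => h ?_
    rw [_root_.smul_apply, hQ, h0]; simp
  · have key : ∑ s, (c s : ℂ) • wordSymbolMul (w s) (κ⁻¹ • Q) =
        schwartzDilate (2 : ℝ)⁻¹ (inv_ne_zero two_ne_zero) Z - Z := by
      ext ξ
      rw [_root_.sum_apply, _root_.sub_apply, schwartzDilate_apply, hZ, hZ]
      simp only [_root_.smul_apply, wordSymbolMul_apply, hw, smul_eq_mul, hQ]
      have e1 : ∀ s, (c s : ℂ) * ((2 * (Real.pi : ℂ) * Complex.I) ^ K * (((w s).map ξ).prod : ℝ) *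
          (κ⁻¹ * (q ξ : ℂ))) = ((c s * ((w s).map ξ).prod : ℝ) : ℂ) * (q ξ : ℂ) := by
        intro s
        rw [show (2 * (Real.pi : ℂ) * Complex.I) ^ K = κ from rfl]
        push_cast
        field_simp
      rw [Finset.sum_congr rfl fun s _ => e1 s, ← Finset.sum_mul, ← Complex.ofReal_sum]
      rw [← Complex.ofReal_mul, ← Complex.ofReal_sub]
      congr 1
      change L ξ * q ξ = _
      by_cases h : ξ = 0
      · have h1 : ζ ((2⁻¹ : ℝ) • ξ) - ζ ξ = 0 := by simp [h]
        rw [h1]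
        simp only [q, h1]
        simp
      · exact mul_div_cancel₀ _ (hell ξ h)
    intro z
    have h1 : (𝓕⁻ (∑ s, (c s : ℂ) • wordSymbolMul (w s) (κ⁻¹ • Q))) z =
        ∑ s, (c s : ℂ) * (𝓕⁻ (wordSymbolMul (w s) (κ⁻¹ • Q))) z := by
      have h2 : (𝓕⁻ (∑ s, (c s : ℂ) • wordSymbolMul (w s) (κ⁻¹ • Q))) =
          ∑ s, (c s : ℂ) • 𝓕⁻ (wordSymbolMul (w s) (κ⁻¹ • Q)) := by
        have h5 := map_sum (FourierTransform.fourierInvCLM ℂ 𝓢(EuclideanSpace ℝ (Fin d), ℂ))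
          (fun s => (c s : ℂ) • wordSymbolMul (w s) (κ⁻¹ • Q)) Finset.univ
        simp only [map_smul] at h5
        exact h5
      rw [h2, _root_.sum_apply]
      simp
    have h3 : (𝓕⁻ (schwartzDilate (2 : ℝ)⁻¹ (inv_ne_zero two_ne_zero) Z - Z)) z =
        2 ^ d * (𝓕⁻ Z) ((2 : ℝ) • z) - (𝓕⁻ Z) z := by
      have h2 : 𝓕⁻ (schwartzDilate (2 : ℝ)⁻¹ (inv_ne_zero two_ne_zero) Z - Z) =
          𝓕⁻ (schwartzDilate (2 : ℝ)⁻¹ (inv_ne_zero two_ne_zero) Z) - 𝓕⁻ Z := by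
        exact map_sub (FourierTransform.fourierInvCLM ℂ 𝓢(EuclideanSpace ℝ (Fin d), ℂ)) _ _
      rw [h2, _root_.sub_apply, fourierInv_schwartzDilate two_pos]
      norm_num
    have h4 := congrArg Complex.re (h1.symm.trans ((congrArg (fun f => (𝓕⁻ f) z) key).trans h3))
    rw [Complex.re_sum, Complex.sub_re] at h4
    simp only [wordDeriv_re_fourierInv]
    simp only [Complex.re_ofReal_mul] at h4
    rw [h4, show (2 : ℂ) ^ d = ((2 ^ d : ℝ) : ℂ) by push_cast; rfl, Complex.re_ofReal_mul]
  · have h1 : 𝓕 (𝓕⁻ Z) 0 = Z 0 := by rw [FourierTransform.fourier_fourierInv_eq]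
    rw [SchwartzMap.fourier_coe, Real.fourier_eq] at h1
    simp only [inner_zero_right, neg_zero, AddChar.map_zero_eq_one, one_smul] at h1
    rw [hZ, hζ1 0 (by simp)] at h1
    have h2 := integral_re (𝕜 := ℂ) (𝓕⁻ Z).integrable (μ := volume)
    rw [h1] at h2
    simpa using h2

end Parametrix

section SquareBound

open FourierTransform SchwartzMap LineDeriv

variable {d : ℕ}

theorem integral_fourierInv_sub_mul (B g : 𝓢(EuclideanSpace ℝ (Fin d), ℂ))
    (x : EuclideanSpace ℝ (Fin d)) :
    ∫ y, (𝓕⁻ B) (y - x) * g y = (𝓕 (smulLeftCLM ℂ B (𝓕⁻ g))) x := by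
  have hBx : Integrable (fun ξ => Real.fourierChar (-inner ℝ ξ x) • B ξ) := by
    refine (integrable_norm_iff ?_).1 ?_
    · refine Continuous.aestronglyMeasurable ?_
      simp only [Circle.smul_def]
      exact (Continuous.subtype_val (Real.continuous_fourierChar.comp (by fun_prop))).smul
        B.continuous
    · simpa using B.integrable.norm
  have h := VectorFourier.integral_fourierIntegral_smul_eq_flip (μ := volume) (ν := volume)
    (L := -innerₗ (EuclideanSpace ℝ (Fin d))) (e := Real.fourierChar) (f :=
      fun ξ => Real.fourierChar (-inner ℝ ξ x) • B ξ) (g := g) Real.continuous_fourierChar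
      (by simp only [LinearMap.neg_apply, innerₗ_apply_apply]; fun_prop) hBx g.integrable
  have h1 : ∀ y, VectorFourier.fourierIntegral Real.fourierChar volume
      (-innerₗ (EuclideanSpace ℝ (Fin d))) (fun ξ => Real.fourierChar (-inner ℝ ξ x) • B ξ) y =
      (𝓕⁻ B) (y - x) := by
    intro y
    rw [fourierInv_coe, Real.fourierInv_eq]
    simp only [VectorFourier.fourierIntegral, LinearMap.neg_apply, innerₗ_apply_apply, neg_neg]
    congr 1
    ext v
    rw [smul_smul, ← AddChar.map_add_eq_mul, inner_sub_right, sub_eq_add_neg]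
  simp only [h1, smul_eq_mul] at h
  rw [h, SchwartzMap.fourier_coe, Real.fourier_eq]
  congr 1
  ext v
  rw [smulLeftCLM_apply_apply B.hasTemperateGrowth, fourierInv_coe, Real.fourierInv_eq]
  simp only [VectorFourier.fourierIntegral, LinearMap.neg_apply, LinearMap.flip_apply,
    innerₗ_apply_apply, neg_neg, smul_eq_mul, smul_mul_assoc, real_inner_comm]

theorem eLpNorm_fourier_eq (h : 𝓢(EuclideanSpace ℝ (Fin d), ℂ)) :
    eLpNorm (fun ξ => (𝓕 h) ξ) 2 volume = eLpNorm h 2 volume := by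
  have e := integral_norm_sq_fourier h
  have h1 := (h.memLp 2 volume).eLpNorm_eq_integral_rpow_norm two_ne_zero ENNReal.ofNat_ne_top
  have h2 := ((𝓕 h).memLp 2 volume).eLpNorm_eq_integral_rpow_norm two_ne_zero
    ENNReal.ofNat_ne_top
  simp only [ENNReal.toReal_ofNat, Real.rpow_ofNat] at h1 h2
  rw [h1, ← e]
  exact h2

theorem eLpNorm_corr_schwartz_le (B g : 𝓢(EuclideanSpace ℝ (Fin d), ℂ)) {C : ℝ}
    (hC : ∀ ξ, ‖B ξ‖ ≤ C) :
    eLpNorm (fun x => ∫ y, (𝓕⁻ B) (y - x) * g y) 2 volume ≤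
      ENNReal.ofReal C * eLpNorm g 2 volume := by
  simp only [integral_fourierInv_sub_mul]
  have h0 : eLpNorm (fun x => (𝓕 (smulLeftCLM ℂ B (𝓕⁻ g))) x) 2 volume =
    eLpNorm (smulLeftCLM ℂ B (𝓕⁻ g)) 2 volume := eLpNorm_fourier_eq _
  have h1 : eLpNorm g 2 volume = eLpNorm (fun ξ => (𝓕⁻ g) ξ) 2 volume := by
    have := eLpNorm_fourier_eq (𝓕⁻ g)
    rwa [fourier_fourierInv_eq] at this
  rw [h0, h1]
  refine eLpNorm_le_mul_eLpNorm_of_ae_le_mul (Filter.Eventually.of_forall fun ξ => ?_) 2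
  rw [smulLeftCLM_apply_apply B.hasTemperateGrowth, norm_smul]
  exact mul_le_mul_of_nonneg_right (hC ξ) (norm_nonneg _)

theorem integrable_comp_sub_mul {K g : EuclideanSpace ℝ (Fin d) → ℂ} (hK : MemLp K 2 volume)
    (hg : MemLp g 2 volume) (x : EuclideanSpace ℝ (Fin d)) :
    Integrable (fun y => K (y - x) * g y) volume :=
  (hK.comp_measurePreserving (measurePreserving_sub_right volume x)).integrable_mul hg

theorem eLpNorm_corr_le (B : 𝓢(EuclideanSpace ℝ (Fin d), ℂ)) {C : ℝ}
    (hC : ∀ ξ, ‖B ξ‖ ≤ C) {g : EuclideanSpace ℝ (Fin d) → ℂ} (hg : MemLp g 2 volume) :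
    eLpNorm (fun x => ∫ y, (𝓕⁻ B) (y - x) * g y) 2 volume ≤
      ENNReal.ofReal C * eLpNorm g 2 volume := by
  set K : EuclideanSpace ℝ (Fin d) → ℂ := fun z => (𝓕⁻ B) z with hKdef
  have hK : MemLp K 2 volume := (𝓕⁻ B).memLp 2 volume
  have happ : ∀ n : ℕ, ∃ f : 𝓢(EuclideanSpace ℝ (Fin d), ℂ),
      eLpNorm (g - ⇑f) 2 volume ≤ ENNReal.ofReal (1 / ((n : ℝ) + 1)) := by
    intro n
    obtain ⟨f, hf1, hf2, hf3⟩ := MemLp.exist_eLpNorm_sub_le (by norm_num) (by norm_num) hg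
      (show (0 : ℝ) < 1 / ((n : ℝ) + 1) by positivity)
    exact ⟨hf1.toSchwartzMap hf2, hf3⟩
  choose f hf using happ
  have hlim0 : Filter.Tendsto (fun n : ℕ => ENNReal.ofReal (1 / ((n : ℝ) + 1))) Filter.atTop
      (nhds 0) := by
    simpa using ENNReal.tendsto_ofReal (tendsto_one_div_add_atTop_nhds_zero_nat (𝕜 := ℝ))
  have hcont : ∀ n, Continuous fun x => ∫ y, K (y - x) * f n y := by
    intro n
    have : (fun x => ∫ y, K (y - x) * f n y) = 𝓕 (smulLeftCLM ℂ B (𝓕⁻ (f n))) := by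
      ext x; exact integral_fourierInv_sub_mul B (f n) x
    rw [this]
    exact SchwartzMap.continuous _
  have hptw : ∀ x, Filter.Tendsto (fun n => ∫ y, K (y - x) * f n y) Filter.atTop
      (nhds (∫ y, K (y - x) * g y)) := by
    intro x
    rw [tendsto_iff_edist_tendsto_0]
    have hKx := hK.comp_measurePreserving (measurePreserving_sub_right volume x)
    have hb : ∀ n, edist (∫ y, K (y - x) * f n y) (∫ y, K (y - x) * g y) ≤
        eLpNorm K 2 volume * ENNReal.ofReal (1 / ((n : ℝ) + 1)) := by
      intro n
      rw [edist_comm, edist_eq_enorm_sub, ← integral_sub (integrable_comp_sub_mul hK hg x)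
        (integrable_comp_sub_mul hK ((f n).memLp 2) x)]
      refine (enorm_integral_le_lintegral_enorm _).trans ?_
      rw [← eLpNorm_one_eq_lintegral_enorm]
      have h1 := eLpNorm_smul_le_mul_eLpNorm (p := 2) (q := 2) (r := 1) (μ := volume)
        (f := g - ⇑(f n)) (φ := K ∘ fun y => y - x)
        (hg.sub ((f n).memLp 2)).1 hKx.1
      rw [eLpNorm_comp_measurePreserving hK.1 (measurePreserving_sub_right volume x)] at h1
      refine le_trans (le_of_eq ?_) (h1.trans (mul_le_mul_right (hf n) _))
      congr 1
      ext y
      simp [mul_sub]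
    refine tendsto_of_tendsto_of_tendsto_of_le_of_le tendsto_const_nhds ?_ (fun _ => zero_le) hb
    simpa using ENNReal.Tendsto.const_mul hlim0 (Or.inr hK.2.ne)
  refine (Lp.eLpNorm_lim_le_liminf_eLpNorm (fun n => (hcont n).aestronglyMeasurable) _
    (Filter.Eventually.of_forall hptw)).trans ?_
  have hb : ∀ n, eLpNorm (fun x => ∫ y, K (y - x) * f n y) 2 volume ≤
      ENNReal.ofReal C * (eLpNorm g 2 volume + ENNReal.ofReal (1 / ((n : ℝ) + 1))) := by
    intro n
    refine (eLpNorm_corr_schwartz_le B (f n) hC).trans (mul_le_mul_right ?_ _)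
    have : (f n : EuclideanSpace ℝ (Fin d) → ℂ) = g - (g - ⇑(f n)) := by simp
    rw [this]
    exact (eLpNorm_sub_le hg.1 (hg.sub ((f n).memLp 2)).1 (by norm_num)).trans
      (add_le_add_right (hf n) _)
  refine (Filter.liminf_le_liminf (Filter.Eventually.of_forall hb)).trans (le_of_eq ?_)
  refine Filter.Tendsto.liminf_eq ?_
  have := ENNReal.Tendsto.const_mul (a := ENNReal.ofReal C)
    ((tendsto_const_nhds (x := eLpNorm g 2 volume)).add hlim0) (Or.inr ENNReal.ofReal_ne_top)
  simpa using this

theorem eLpNorm_corr_re_le (B : 𝓢(EuclideanSpace ℝ (Fin d), ℂ)) {C : ℝ}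
    (hC : ∀ ξ, ‖B ξ‖ ≤ C) {g : EuclideanSpace ℝ (Fin d) → ℝ} (hg : MemLp g 2 volume) :
    eLpNorm (fun x => ∫ y, ((𝓕⁻ B) (y - x)).re * g y) 2 volume ≤
      ENNReal.ofReal C * eLpNorm g 2 volume := by
  have hg' : MemLp (fun y => (g y : ℂ)) 2 volume := hg.ofReal
  have h := eLpNorm_corr_le B hC hg'
  have e : eLpNorm (fun y => (g y : ℂ)) 2 volume = eLpNorm g 2 volume :=
    eLpNorm_congr_norm_ae (Filter.Eventually.of_forall fun y => by simp)
  rw [e] at h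
  refine le_trans (eLpNorm_mono fun x => ?_) h
  have hi := integrable_comp_sub_mul ((𝓕⁻ B).memLp 2) hg' x
  have h1 := integral_re (𝕜 := ℂ) hi
  have h2 : ∫ y, ((𝓕⁻ B) (y - x)).re * g y = (∫ y, (𝓕⁻ B) (y - x) * (g y : ℂ)).re := by
    refine Eq.trans ?_ h1
    congr 1
    ext y
    simp
  rw [h2, Real.norm_eq_abs]
  exact Complex.abs_re_le_norm _

end SquareBound

section Dyadic

variable {d : ℕ}

theorem lintegral_scaled_comp_smul {c : ℝ} (hc : 0 < c) (F : EuclideanSpace ℝ (Fin d) → ENNReal) :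
    ∫⁻ z, ENNReal.ofReal (c ^ d) * F (c • z) = ∫⁻ z, F z := by
  have h := Measure.map_addHaar_smul (volume : Measure (EuclideanSpace ℝ (Fin d))) hc.ne'
  have hm : MeasurableEmbedding (fun z : EuclideanSpace ℝ (Fin d) => c • z) :=
    (Homeomorph.smulOfNeZero c hc.ne').measurableEmbedding
  rw [lintegral_const_mul' _ _ ENNReal.ofReal_ne_top, ← hm.lintegral_map, h,
    lintegral_smul_measure, finrank_euclideanSpace, Fintype.card_fin, smul_eq_mul, ← mul_assoc,
    ← ENNReal.ofReal_mul (by positivity), abs_of_pos (by positivity),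
    mul_inv_cancel₀ (by positivity)]
  simp

/-- The `L¹`-normalized dilation of `φ` by the factor `c`. -/
noncomputable def dilation (c : ℝ) (φ : EuclideanSpace ℝ (Fin d) → ℝ) :
    EuclideanSpace ℝ (Fin d) → ℝ := fun z => c ^ d * φ (c • z)

theorem enorm_dilation {c : ℝ} (hc : 0 < c) (φ : EuclideanSpace ℝ (Fin d) → ℝ)
    (z : EuclideanSpace ℝ (Fin d)) :
    ‖dilation c φ z‖ₑ = ENNReal.ofReal (c ^ d) * ‖φ (c • z)‖ₑ := by
  rw [dilation, enorm_mul, Real.enorm_of_nonneg (by positivity)]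

theorem lintegral_enorm_dilation {c : ℝ} (hc : 0 < c) (φ : EuclideanSpace ℝ (Fin d) → ℝ) :
    ∫⁻ z, ‖dilation c φ z‖ₑ = ∫⁻ z, ‖φ z‖ₑ := by
  simp only [enorm_dilation hc]
  exact lintegral_scaled_comp_smul hc fun z => ‖φ z‖ₑ

theorem continuous_dilation {φ : EuclideanSpace ℝ (Fin d) → ℝ} (hφ : Continuous φ) (c : ℝ) :
    Continuous (dilation c φ) := by
  unfold dilation; fun_prop

theorem lintegral_dilation_sub_le {c : ℝ} (hc : 0 < c) {φ : EuclideanSpace ℝ (Fin d) → ℝ} {C₁ : ℝ}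
    (h₁ : ∀ v, ∫⁻ z, ‖φ z - φ (z + v)‖ₑ ≤ ENNReal.ofReal (C₁ * ‖v‖))
    (v : EuclideanSpace ℝ (Fin d)) :
    ∫⁻ z, ‖dilation c φ z - dilation c φ (z + v)‖ₑ ≤ ENNReal.ofReal (C₁ * (c * ‖v‖)) := by
  have e : ∀ z, ‖dilation c φ z - dilation c φ (z + v)‖ₑ =
      ENNReal.ofReal (c ^ d) * ‖φ (c • z) - φ (c • z + c • v)‖ₑ := by
    intro z
    rw [dilation, dilation, ← mul_sub, enorm_mul, Real.enorm_of_nonneg (by positivity), smul_add]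
  simp only [e]
  rw [lintegral_scaled_comp_smul hc fun z => ‖φ z - φ (z + c • v)‖ₑ]
  refine (h₁ (c • v)).trans (le_of_eq ?_)
  rw [norm_smul, Real.norm_of_nonneg hc.le]

theorem setLIntegral_dilation_le {c : ℝ} (hc : 0 < c) {φ : EuclideanSpace ℝ (Fin d) → ℝ} {C₂ : ℝ}
    (h₂ : ∫⁻ z, ENNReal.ofReal ‖z‖ * ‖φ z‖ₑ ≤ ENNReal.ofReal C₂) {r : ℝ} (hr : 0 < r) :
    ∫⁻ z in {z | r ≤ ‖z‖}, ‖dilation c φ z‖ₑ ≤ ENNReal.ofReal (C₂ / (c * r)) := by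
  have hm : MeasurableSet {z : EuclideanSpace ℝ (Fin d) | r ≤ ‖z‖} :=
    measurableSet_le measurable_const measurable_norm
  calc ∫⁻ z in {z | r ≤ ‖z‖}, ‖dilation c φ z‖ₑ
      ≤ ∫⁻ z in {z | r ≤ ‖z‖}, ENNReal.ofReal (1 / (c * r)) *
          (ENNReal.ofReal (c ^ d) * (ENNReal.ofReal ‖c • z‖ * ‖φ (c • z)‖ₑ)) := by
        refine setLIntegral_mono' hm fun z hz => ?_
        rw [enorm_dilation hc, norm_smul, Real.norm_of_nonneg hc.le]
        have : 1 ≤ ENNReal.ofReal (1 / (c * r)) * ENNReal.ofReal (c * ‖z‖) := by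
          rw [← ENNReal.ofReal_mul (by positivity), ENNReal.one_le_ofReal, div_mul_eq_mul_div,
            one_mul, one_le_div (by positivity)]
          exact mul_le_mul_of_nonneg_left hz hc.le
        calc ENNReal.ofReal (c ^ d) * ‖φ (c • z)‖ₑ
            ≤ (ENNReal.ofReal (1 / (c * r)) * ENNReal.ofReal (c * ‖z‖)) *
              (ENNReal.ofReal (c ^ d) * ‖φ (c • z)‖ₑ) := le_mul_of_one_le_left' this
          _ = _ := by ring
    _ ≤ ∫⁻ z, ENNReal.ofReal (1 / (c * r)) *
          (ENNReal.ofReal (c ^ d) * (ENNReal.ofReal ‖c • z‖ * ‖φ (c • z)‖ₑ)) :=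
        setLIntegral_le_lintegral _ _
    _ ≤ ENNReal.ofReal (1 / (c * r)) * ENNReal.ofReal C₂ := by
        rw [lintegral_const_mul' _ _ ENNReal.ofReal_ne_top,
          lintegral_scaled_comp_smul hc fun z => ENNReal.ofReal ‖z‖ * ‖φ z‖ₑ]
        gcongr
    _ = _ := by
        rw [← ENNReal.ofReal_mul (by positivity)]
        congr 1
        ring

theorem setLIntegral_dilation_sub_le {c : ℝ} (hc : 0 < c) {φ : EuclideanSpace ℝ (Fin d) → ℝ}
    (hφ : Continuous φ) {C₂ : ℝ} (hC₂ : 0 ≤ C₂)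
    (h₂ : ∫⁻ z, ENNReal.ofReal ‖z‖ * ‖φ z‖ₑ ≤ ENNReal.ofReal C₂) {R : ℝ} (hR : 0 < R)
    {v : EuclideanSpace ℝ (Fin d)} (hv : ‖v‖ ≤ R) :
    ∫⁻ z in {z | 2 * R ≤ ‖z‖}, ‖dilation c φ z - dilation c φ (z + v)‖ₑ ≤
      ENNReal.ofReal (2 * C₂ / (c * R)) := by
  have hm : ∀ s : ℝ, MeasurableSet {z : EuclideanSpace ℝ (Fin d) | s ≤ ‖z‖} := fun s =>
    measurableSet_le measurable_const measurable_norm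
  have hd := continuous_dilation hφ c
  calc ∫⁻ z in {z | 2 * R ≤ ‖z‖}, ‖dilation c φ z - dilation c φ (z + v)‖ₑ
      ≤ ∫⁻ z in {z | 2 * R ≤ ‖z‖}, (‖dilation c φ z‖ₑ + ‖dilation c φ (z + v)‖ₑ) :=
        lintegral_mono fun z => enorm_sub_le
    _ = (∫⁻ z in {z | 2 * R ≤ ‖z‖}, ‖dilation c φ z‖ₑ) +
          ∫⁻ z in {z | 2 * R ≤ ‖z‖}, ‖dilation c φ (z + v)‖ₑ :=
        lintegral_add_left hd.measurable.enorm _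
    _ ≤ (∫⁻ z in {z | R ≤ ‖z‖}, ‖dilation c φ z‖ₑ) +
          ∫⁻ z in {z | R ≤ ‖z‖}, ‖dilation c φ z‖ₑ := by
        refine add_le_add (lintegral_mono_set fun z hz => ?_) ?_
        · have : 2 * R ≤ ‖z‖ := hz
          show R ≤ ‖z‖
          linarith
        · rw [← lintegral_indicator (hm _), ← lintegral_indicator (hm _)]
          rw [← lintegral_add_right_eq_self
            ({z : EuclideanSpace ℝ (Fin d) | R ≤ ‖z‖}.indicator fun z => ‖dilation c φ z‖ₑ) v]
          refine lintegral_mono fun z => ?_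
          by_cases hz : 2 * R ≤ ‖z‖
          · have hz' : R ≤ ‖z + v‖ := by
              have := norm_sub_norm_le z (-v)
              rw [norm_neg, sub_neg_eq_add] at this
              linarith
            rw [Set.indicator_of_mem (show z ∈ {z | 2 * R ≤ ‖z‖} from hz),
              Set.indicator_of_mem (show z + v ∈ {z | R ≤ ‖z‖} from hz')]
          · rw [Set.indicator_of_notMem (show z ∉ {z | 2 * R ≤ ‖z‖} from hz)]
            exact zero_le
    _ ≤ ENNReal.ofReal (C₂ / (c * R)) + ENNReal.ofReal (C₂ / (c * R)) :=
        add_le_add (setLIntegral_dilation_le hc h₂ hR) (setLIntegral_dilation_le hc h₂ hR)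
    _ = _ := by
        rw [← ENNReal.ofReal_add (by positivity) (by positivity)]
        congr 1
        ring

/-- The dyadic sum of the dilations of `φ` over scales `2 ^ i`, `a ≤ i < N`. -/
noncomputable def dyadicKernel (φ : EuclideanSpace ℝ (Fin d) → ℝ) (a N : ℕ) :
    EuclideanSpace ℝ (Fin d) → ℝ :=
  fun z => ∑ i ∈ Finset.Ico a N, dilation (2 ^ i) φ z

theorem continuous_dyadicKernel {φ : EuclideanSpace ℝ (Fin d) → ℝ} (hφ : Continuous φ)
    (a N : ℕ) : Continuous (dyadicKernel φ a N) :=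
  continuous_finsetSum _ fun _ _ => continuous_dilation hφ _

theorem enorm_dyadicKernel_le (φ : EuclideanSpace ℝ (Fin d) → ℝ) (a N : ℕ)
    (z : EuclideanSpace ℝ (Fin d)) :
    ‖dyadicKernel φ a N z‖ₑ ≤ ∑ i ∈ Finset.Ico a N, ‖dilation (2 ^ i) φ z‖ₑ :=
  enorm_sum_le _ _

theorem enorm_dyadicKernel_sub_le (φ : EuclideanSpace ℝ (Fin d) → ℝ) (a N : ℕ)
    (z v : EuclideanSpace ℝ (Fin d)) :
    ‖dyadicKernel φ a N z - dyadicKernel φ a N (z + v)‖ₑ ≤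
      ∑ i ∈ Finset.Ico a N, ‖dilation (2 ^ i) φ z - dilation (2 ^ i) φ (z + v)‖ₑ := by
  rw [dyadicKernel, dyadicKernel, ← Finset.sum_sub_distrib]
  exact enorm_sum_le _ _

/-- The increment `F (2 * x) - F x` of the function `F x = x / (1 + x)`. -/
noncomputable def dyadicIncrement (x : ℝ) : ℝ := 2 * x / (1 + 2 * x) - x / (1 + x)

theorem dyadicIncrement_nonneg {x : ℝ} (hx : 0 ≤ x) : 0 ≤ dyadicIncrement x := by
  rw [dyadicIncrement, div_sub_div _ _ (by positivity) (by positivity)]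
  apply div_nonneg _ (by positivity)
  nlinarith

theorem min_le_dyadicIncrement {x : ℝ} (hx : 0 < x) : min x x⁻¹ ≤ 6 * dyadicIncrement x := by
  have e : dyadicIncrement x = x / ((1 + 2 * x) * (1 + x)) := by
    rw [dyadicIncrement, div_sub_div _ _ (by positivity) (by positivity)]
    congr 1
    ring
  rw [e, mul_div_assoc']
  rcases le_total x 1 with h | h
  · refine (min_le_left _ _).trans ?_
    rw [le_div_iff₀ (by positivity)]
    nlinarith [mul_nonneg hx.le hx.le, mul_nonneg hx.le (sub_nonneg.2 h)]
  · refine (min_le_right _ _).trans ?_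
    rw [le_div_iff₀ (by positivity), inv_mul_le_iff₀ hx]
    nlinarith

theorem sum_dyadicIncrement_le {x : ℝ} (hx : 0 ≤ x) (a N : ℕ) :
    ∑ i ∈ Finset.Ico a N, dyadicIncrement (2 ^ i * x) ≤ 1 := by
  rcases le_total a N with h | h
  · have e : ∀ i : ℕ, dyadicIncrement (2 ^ i * x) =
        2 ^ (i + 1) * x / (1 + 2 ^ (i + 1) * x) - 2 ^ i * x / (1 + 2 ^ i * x) := by
      intro i
      rw [dyadicIncrement, pow_succ]
      ring_nf
    rw [Finset.sum_congr rfl fun i _ => e i,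
      Finset.sum_Ico_sub (fun i => 2 ^ i * x / (1 + 2 ^ i * x)) h]
    have h1 : 2 ^ N * x / (1 + 2 ^ N * x) ≤ 1 := by
      rw [div_le_one (by positivity)]; linarith
    have h2 : 0 ≤ 2 ^ a * x / (1 + 2 ^ a * x) := by positivity
    linarith
  · simp [Finset.Ico_eq_empty_of_le h]

theorem sum_dyadicIncrement_inv_le {x : ℝ} (hx : 0 ≤ x) (a N : ℕ) :
    ∑ i ∈ Finset.Ico a N, dyadicIncrement ((2 ^ i)⁻¹ * x) ≤ 1 := by
  have hle : ∑ i ∈ Finset.Ico a N, dyadicIncrement ((2 ^ i)⁻¹ * x) ≤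
      ∑ i ∈ Finset.range N, dyadicIncrement ((2 ^ i)⁻¹ * x) :=
    Finset.sum_le_sum_of_subset_of_nonneg
      (fun i hi => Finset.mem_range.2 (Finset.mem_Ico.1 hi).2)
      fun i _ _ => dyadicIncrement_nonneg (by positivity)
  refine hle.trans ?_
  have e : ∀ i : ℕ, dyadicIncrement ((2 ^ i)⁻¹ * x) =
      2 * (2 ^ i)⁻¹ * x / (1 + 2 * (2 ^ i)⁻¹ * x) -
        2 * (2 ^ (i + 1))⁻¹ * x / (1 + 2 * (2 ^ (i + 1))⁻¹ * x) := by
    intro i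
    have : 2 * ((2 : ℝ) ^ (i + 1))⁻¹ = (2 ^ i)⁻¹ := by
      rw [pow_succ]; field_simp
    rw [this, dyadicIncrement]
    ring_nf
  rw [Finset.sum_congr rfl fun i _ => e i,
    Finset.sum_range_sub' (fun i => 2 * ((2 : ℝ) ^ i)⁻¹ * x / (1 + 2 * (2 ^ i)⁻¹ * x))]
  have h1 : 2 * ((2 : ℝ) ^ 0)⁻¹ * x / (1 + 2 * (2 ^ 0)⁻¹ * x) ≤ 1 := by
    rw [div_le_one (by positivity)]; linarith
  have h2 : 0 ≤ 2 * ((2 : ℝ) ^ N)⁻¹ * x / (1 + 2 * (2 ^ N)⁻¹ * x) := by positivity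
  linarith

/-- The Hörmander smoothness condition for dyadic kernels, uniformly in the range of scales. -/
theorem dyadicKernel_hormander {φ : EuclideanSpace ℝ (Fin d) → ℝ} (hφ : Continuous φ) {C₁ C₂ : ℝ}
    (hC₂ : 0 ≤ C₂)
    (h₁ : ∀ v, ∫⁻ z, ‖φ z - φ (z + v)‖ₑ ≤ ENNReal.ofReal (C₁ * ‖v‖))
    (h₂ : ∫⁻ z, ENNReal.ofReal ‖z‖ * ‖φ z‖ₑ ≤ ENNReal.ofReal C₂) (a N : ℕ) {R : ℝ} (hR : 0 < R)
    {v : EuclideanSpace ℝ (Fin d)} (hv : ‖v‖ ≤ R) (hC₁ : 0 ≤ C₁) :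
    ∫⁻ z in {z | 2 * R ≤ ‖z‖}, ‖dyadicKernel φ a N z - dyadicKernel φ a N (z + v)‖ₑ ≤
      ENNReal.ofReal (6 * (C₁ + 2 * C₂)) := by
  have hpiece : ∀ i : ℕ, ∫⁻ z in {z | 2 * R ≤ ‖z‖},
      ‖dilation (2 ^ i) φ z - dilation (2 ^ i) φ (z + v)‖ₑ ≤
        ENNReal.ofReal (6 * (C₁ + 2 * C₂) * dyadicIncrement (2 ^ i * R)) := by
    intro i
    have hc : (0 : ℝ) < 2 ^ i := by positivity
    have b1 := (setLIntegral_le_lintegral {z | 2 * R ≤ ‖z‖} _).trans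
      (lintegral_dilation_sub_le hc h₁ v)
    have b2 := setLIntegral_dilation_sub_le hc hφ hC₂ h₂ hR hv
    have hx : (0 : ℝ) < 2 ^ i * R := by positivity
    have hm := min_le_dyadicIncrement hx
    rcases le_total (2 ^ i * R) (2 ^ i * R)⁻¹ with h | h
    · refine b1.trans (ENNReal.ofReal_le_ofReal ?_)
      rw [min_eq_left h] at hm
      have h3 : C₁ * (2 ^ i * ‖v‖) ≤ C₁ * (2 ^ i * R) := by gcongr
      nlinarith [dyadicIncrement_nonneg hx.le]
    · refine b2.trans (ENNReal.ofReal_le_ofReal ?_)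
      rw [min_eq_right h] at hm
      rw [div_eq_mul_inv]
      nlinarith [dyadicIncrement_nonneg hx.le]
  calc _ ≤ ∫⁻ z in {z | 2 * R ≤ ‖z‖}, ∑ i ∈ Finset.Ico a N,
        ‖dilation (2 ^ i) φ z - dilation (2 ^ i) φ (z + v)‖ₑ :=
        lintegral_mono fun z => enorm_dyadicKernel_sub_le φ a N z v
    _ = ∑ i ∈ Finset.Ico a N, ∫⁻ z in {z | 2 * R ≤ ‖z‖},
        ‖dilation (2 ^ i) φ z - dilation (2 ^ i) φ (z + v)‖ₑ := by
        refine lintegral_finsetSum _ fun i _ => ?_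
        have := continuous_dilation hφ (2 ^ i)
        exact (by fun_prop : Continuous fun z =>
          dilation (2 ^ i) φ z - dilation (2 ^ i) φ (z + v)).measurable.enorm
    _ ≤ ∑ i ∈ Finset.Ico a N, ENNReal.ofReal (6 * (C₁ + 2 * C₂) * dyadicIncrement (2 ^ i * R)) :=
        Finset.sum_le_sum fun i _ => hpiece i
    _ = ENNReal.ofReal (6 * (C₁ + 2 * C₂) * ∑ i ∈ Finset.Ico a N, dyadicIncrement (2 ^ i * R)) := by
        rw [Finset.mul_sum, ENNReal.ofReal_sum_of_nonneg]
        exact fun i _ => mul_nonneg (by positivity) (dyadicIncrement_nonneg (by positivity))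
    _ ≤ _ := by
        refine ENNReal.ofReal_le_ofReal ?_
        have := sum_dyadicIncrement_le hR.le a N
        nlinarith

theorem dyadicKernel_translation {φ : EuclideanSpace ℝ (Fin d) → ℝ} (hφ : Continuous φ) {C₁ : ℝ}
    (h₁ : ∀ v, ∫⁻ z, ‖φ z - φ (z + v)‖ₑ ≤ ENNReal.ofReal (C₁ * ‖v‖)) (hC₁ : 0 ≤ C₁) (a N : ℕ)
    (v : EuclideanSpace ℝ (Fin d)) :
    ∫⁻ z, ‖dyadicKernel φ a N z - dyadicKernel φ a N (z + v)‖ₑ ≤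
      ENNReal.ofReal ((∑ i ∈ Finset.Ico a N, C₁ * 2 ^ i) * ‖v‖) := by
  calc _ ≤ ∫⁻ z, ∑ i ∈ Finset.Ico a N,
        ‖dilation (2 ^ i) φ z - dilation (2 ^ i) φ (z + v)‖ₑ :=
        lintegral_mono fun z => enorm_dyadicKernel_sub_le φ a N z v
    _ = ∑ i ∈ Finset.Ico a N, ∫⁻ z,
        ‖dilation (2 ^ i) φ z - dilation (2 ^ i) φ (z + v)‖ₑ := by
        refine lintegral_finsetSum _ fun i _ => ?_
        have := continuous_dilation hφ (2 ^ i)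
        exact (by fun_prop : Continuous fun z =>
          dilation (2 ^ i) φ z - dilation (2 ^ i) φ (z + v)).measurable.enorm
    _ ≤ ∑ i ∈ Finset.Ico a N, ENNReal.ofReal (C₁ * (2 ^ i * ‖v‖)) :=
        Finset.sum_le_sum fun i _ => lintegral_dilation_sub_le (by positivity) h₁ v
    _ = _ := by
        rw [Finset.sum_mul, ENNReal.ofReal_sum_of_nonneg fun i _ => by positivity]
        exact Finset.sum_congr rfl fun i _ => by rw [mul_assoc]

end Dyadic

section SingularKernel

open FourierTransform SchwartzMap

variable {d : ℕ}

/-- Singular convolution kernels, with constant `C` in the `L²` bound and in the Hörmander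
condition, and qualitative regularity otherwise. -/
structure IsSingularKernel (C : ℝ) (K : EuclideanSpace ℝ (Fin d) → ℝ) : Prop where
  continuous : Continuous K
  integrable : Integrable K
  bounded : ∃ M, ∀ z, |K z| ≤ M
  eLpNorm_le : ∀ g : EuclideanSpace ℝ (Fin d) → ℝ, MemLp g 2 volume →
    eLpNorm (fun x => ∫ y, K (y - x) * g y) 2 volume ≤ ENNReal.ofReal C * eLpNorm g 2 volume
  hormander : ∀ R : ℝ, 0 < R → ∀ v : EuclideanSpace ℝ (Fin d), ‖v‖ ≤ R →
    ∫⁻ z in {z | 2 * R ≤ ‖z‖}, ‖K z - K (z + v)‖ₑ ≤ ENNReal.ofReal C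
  translation : ∃ L : ℝ, 0 ≤ L ∧ ∀ v, ∫⁻ z, ‖K z - K (z + v)‖ₑ ≤ ENNReal.ofReal (L * ‖v‖)

theorem enorm_re_le (z : ℂ) : ‖z.re‖ₑ ≤ ‖z‖ₑ := by
  rw [← ofReal_norm, ← ofReal_norm]
  exact ENNReal.ofReal_le_ofReal (Complex.abs_re_le_norm z)

theorem SchwartzMap.enorm_sub_translate_le (F : 𝓢(EuclideanSpace ℝ (Fin d), ℂ))
    (z v : EuclideanSpace ℝ (Fin d)) :
    ‖F z - F (z + v)‖ₑ ≤ ∫⁻ t in Set.Ioc (0 : ℝ) 1, ‖fderiv ℝ F (z + t • v)‖ₑ * ‖v‖ₑ := by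
  have hd : ∀ t : ℝ, HasDerivAt (fun t : ℝ => F (z + t • v)) (fderiv ℝ F (z + t • v) v) t := by
    intro t
    have h2 : HasDerivAt (fun t : ℝ => z + t • v) v t := by
      simpa using ((hasDerivAt_id t).smul_const v).const_add z
    exact (F.differentiableAt.hasFDerivAt (x := z + t • v)).comp_hasDerivAt t h2
  have hc : Continuous fun t : ℝ => fderiv ℝ F (z + t • v) v := by
    have : Continuous (fderiv ℝ F) := (F.smooth 1).continuous_fderiv (by norm_num)
    fun_prop
  have h := intervalIntegral.integral_eq_sub_of_hasDerivAt (fun t _ => hd t)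
    (hc.intervalIntegrable 0 1)
  rw [one_smul, zero_smul, add_zero] at h
  rw [← enorm_neg, neg_sub, ← h, intervalIntegral.integral_of_le zero_le_one]
  refine (enorm_integral_le_lintegral_enorm _).trans (lintegral_mono fun t => ?_)
  exact ContinuousLinearMap.le_opENorm _ _

theorem SchwartzMap.exists_lintegral_sub_translate_le (F : 𝓢(EuclideanSpace ℝ (Fin d), ℂ)) :
    ∃ C : ℝ, 0 ≤ C ∧ ∀ v, ∫⁻ z, ‖F z - F (z + v)‖ₑ ≤ ENNReal.ofReal (C * ‖v‖) := by
  have hI : Integrable (fderiv ℝ F) := (SchwartzMap.fderivCLM ℝ _ ℂ F).integrable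
  refine ⟨∫ z, ‖fderiv ℝ F z‖, by positivity, fun v => ?_⟩
  have hc : Continuous (fderiv ℝ F) := (F.smooth 1).continuous_fderiv (by norm_num)
  calc ∫⁻ z, ‖F z - F (z + v)‖ₑ
      ≤ ∫⁻ z, ∫⁻ t in Set.Ioc (0 : ℝ) 1, ‖fderiv ℝ F (z + t • v)‖ₑ * ‖v‖ₑ :=
        lintegral_mono fun z => F.enorm_sub_translate_le z v
    _ = ∫⁻ t in Set.Ioc (0 : ℝ) 1, ∫⁻ z, ‖fderiv ℝ F (z + t • v)‖ₑ * ‖v‖ₑ := by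
        refine lintegral_lintegral_swap (Continuous.aemeasurable ?_)
        simp only [Function.uncurry_def]
        refine Continuous.comp (g := fun x => x * ‖v‖ₑ)
          (ENNReal.continuous_mul_const (by simp)) (Continuous.enorm ?_)
        fun_prop
    _ = ∫⁻ t in Set.Ioc (0 : ℝ) 1, (∫⁻ z, ‖fderiv ℝ F z‖ₑ) * ‖v‖ₑ := by
        refine lintegral_congr fun t => ?_
        rw [lintegral_mul_const' _ _ (by simp),
          lintegral_add_right_eq_self (fun z => ‖fderiv ℝ F z‖ₑ)]
    _ = _ := by
        rw [setLIntegral_const, Real.volume_Ioc, sub_zero, ENNReal.ofReal_one, mul_one,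
          ENNReal.ofReal_mul (by positivity), ofReal_norm,
          ofReal_integral_norm_eq_lintegral_enorm hI]

theorem SchwartzMap.exists_lintegral_norm_mul_le (F : 𝓢(EuclideanSpace ℝ (Fin d), ℂ)) :
    ∃ C : ℝ, 0 ≤ C ∧ ∫⁻ z, ENNReal.ofReal ‖z‖ * ‖F z‖ₑ ≤ ENNReal.ofReal C := by
  have hI := F.integrable_pow_mul volume 1
  refine ⟨∫ z, ‖z‖ ^ 1 * ‖F z‖, by positivity, ?_⟩
  rw [ofReal_integral_eq_lintegral_ofReal hI (ae_of_all _ fun z => by positivity)]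
  refine lintegral_mono fun z => le_of_eq ?_
  rw [pow_one, ENNReal.ofReal_mul (by positivity), ← ofReal_norm (F z)]

theorem dyadicKernel_re_fourierInv (b : 𝓢(EuclideanSpace ℝ (Fin d), ℂ)) (a N : ℕ) :
    dyadicKernel (fun z => ((𝓕⁻ b) z).re) a N = fun z =>
      ((𝓕⁻ (∑ i ∈ Finset.Ico a N,
        schwartzDilate ((2 : ℝ) ^ i)⁻¹ (inv_ne_zero (pow_pos two_pos i).ne') b)) z).re := by
  funext z
  have : 𝓕⁻ (∑ i ∈ Finset.Ico a N,
        schwartzDilate ((2 : ℝ) ^ i)⁻¹ (inv_ne_zero (pow_pos two_pos i).ne') b) =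
      ∑ i ∈ Finset.Ico a N,
        𝓕⁻ (schwartzDilate ((2 : ℝ) ^ i)⁻¹ (inv_ne_zero (pow_pos two_pos i).ne') b) :=
    map_sum (FourierTransform.fourierInvCLM ℂ 𝓢(EuclideanSpace ℝ (Fin d), ℂ)) _ _
  rw [this, _root_.sum_apply, Complex.re_sum, dyadicKernel]
  refine Finset.sum_congr rfl fun i _ => ?_
  rw [fourierInv_schwartzDilate (pow_pos two_pos i), dilation]
  have : (((2 : ℝ) ^ i : ℝ) : ℂ) ^ d = (((2 : ℝ) ^ i) ^ d : ℝ) := by push_cast; rfl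
  rw [this, Complex.re_ofReal_mul]

/-- The Fourier multipliers of dyadic kernels are bounded uniformly in the range of scales. -/
theorem norm_sum_schwartzDilate_le {b : 𝓢(EuclideanSpace ℝ (Fin d), ℂ)} {B : ℝ}
    (hB : ∀ ξ, ‖b ξ‖ ≤ B) (hsupp : ∀ ξ, b ξ ≠ 0 → 1 ≤ ‖ξ‖ ∧ ‖ξ‖ ≤ 4) (a N : ℕ)
    (ξ : EuclideanSpace ℝ (Fin d)) :
    ‖(∑ i ∈ Finset.Ico a N,
      schwartzDilate ((2 : ℝ) ^ i)⁻¹ (inv_ne_zero (pow_pos two_pos i).ne') b) ξ‖ ≤ 24 * B := by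
  have hB0 : 0 ≤ B := (norm_nonneg _).trans (hB 0)
  have hone : ∀ η, ‖b η‖ ≤ 24 * B * dyadicIncrement ‖η‖ := by
    intro η
    by_cases h : b η = 0
    · rw [h, norm_zero]
      exact mul_nonneg (by positivity) (dyadicIncrement_nonneg (norm_nonneg _))
    · obtain ⟨h1, h4⟩ := hsupp η h
      have hm := min_le_dyadicIncrement (x := ‖η‖) (by linarith)
      have : 1 / 4 ≤ min ‖η‖ ‖η‖⁻¹ := by
        refine le_min (by linarith) ?_
        rw [one_div]
        exact inv_anti₀ (by linarith) h4
      nlinarith [hB η]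
  rw [_root_.sum_apply]
  calc _ ≤ ∑ i ∈ Finset.Ico a N, 24 * B * dyadicIncrement (((2 : ℝ) ^ i)⁻¹ * ‖ξ‖) := by
        refine norm_sum_le_of_le _ fun i _ => ?_
        have := hone (((2 : ℝ) ^ i)⁻¹ • ξ)
        rwa [norm_smul, Real.norm_of_nonneg (by positivity)] at this
    _ ≤ 24 * B := by
        rw [← Finset.mul_sum]
        have := sum_dyadicIncrement_inv_le (norm_nonneg ξ) a N
        nlinarith

/-- Dyadic sums of a band-limited kernel are singular kernels, uniformly in the range of scales. -/
theorem exists_isSingularKernel_dyadicKernel (b : 𝓢(EuclideanSpace ℝ (Fin d), ℂ))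
    (hsupp : ∀ ξ, b ξ ≠ 0 → 1 ≤ ‖ξ‖ ∧ ‖ξ‖ ≤ 4) :
    ∃ C : ℝ, 0 ≤ C ∧
      ∀ a N, IsSingularKernel C (dyadicKernel (fun z => ((𝓕⁻ b) z).re) a N) := by
  obtain ⟨C₁, hC₁, h₁⟩ := SchwartzMap.exists_lintegral_sub_translate_le (𝓕⁻ b)
  obtain ⟨C₂, hC₂, h₂⟩ := SchwartzMap.exists_lintegral_norm_mul_le (𝓕⁻ b)
  obtain ⟨B, hBpos, hB⟩ := b.decay 0 0
  have hB : ∀ ξ, ‖b ξ‖ ≤ B := fun ξ => by simpa using hB ξ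
  have h₁' : ∀ v, ∫⁻ z, ‖((𝓕⁻ b) z).re - ((𝓕⁻ b) (z + v)).re‖ₑ ≤ ENNReal.ofReal (C₁ * ‖v‖) := by
    refine fun v => (lintegral_mono fun z => ?_).trans (h₁ v)
    rw [← Complex.sub_re]
    exact enorm_re_le _
  have h₂' : ∫⁻ z, ENNReal.ofReal ‖z‖ * ‖((𝓕⁻ b) z).re‖ₑ ≤ ENNReal.ofReal C₂ :=
    (lintegral_mono fun z => mul_le_mul_right (enorm_re_le _) _).trans h₂
  have hφ : Continuous fun z => ((𝓕⁻ b) z).re := Complex.continuous_re.comp (𝓕⁻ b).continuous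
  refine ⟨24 * B + 6 * (C₁ + 2 * C₂), by positivity, fun a N => ⟨?_, ?_, ?_, ?_, ?_, ?_⟩⟩
  · exact continuous_dyadicKernel hφ a N
  · rw [dyadicKernel_re_fourierInv]
    exact (𝓕⁻ (∑ i ∈ Finset.Ico a N, schwartzDilate ((2 : ℝ) ^ i)⁻¹
      (inv_ne_zero (pow_pos two_pos i).ne') b)).integrable.re
  · rw [dyadicKernel_re_fourierInv]
    obtain ⟨M, -, hM⟩ := (𝓕⁻ (∑ i ∈ Finset.Ico a N, schwartzDilate ((2 : ℝ) ^ i)⁻¹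
      (inv_ne_zero (pow_pos two_pos i).ne') b)).decay 0 0
    exact ⟨M, fun z => (Complex.abs_re_le_norm _).trans (by simpa using hM z)⟩
  · intro g hg
    rw [dyadicKernel_re_fourierInv]
    refine (eLpNorm_corr_re_le _ (norm_sum_schwartzDilate_le hB hsupp a N) hg).trans ?_
    gcongr
    linarith [show 0 ≤ 6 * (C₁ + 2 * C₂) by positivity]
  · intro R hR v hv
    refine (dyadicKernel_hormander hφ hC₂ h₁' h₂' a N hR hv hC₁).trans ?_
    gcongr
    linarith
  · exact ⟨_, Finset.sum_nonneg fun i _ => by positivity,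
      dyadicKernel_translation hφ h₁' hC₁ a N⟩

end SingularKernel

section MaximalSet

variable {d : ℕ}

/-- The volume of the unit ball. -/
noncomputable def unitBallVolume (d : ℕ) : ℝ :=
  (volume : Measure (EuclideanSpace ℝ (Fin d))).real (ball 0 1)

theorem unitBallVolume_pos : 0 < unitBallVolume d :=
  ENNReal.toReal_pos (measure_ball_pos _ _ one_pos).ne' measure_ball_lt_top.ne

theorem volume_ball_eq (hd : d ≠ 0) (x : EuclideanSpace ℝ (Fin d)) {t : ℝ} (ht : 0 ≤ t) :
    volume (ball x t) = ENNReal.ofReal (unitBallVolume d * t ^ d) := by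
  have : Nonempty (Fin d) := ⟨⟨0, Nat.pos_of_ne_zero hd⟩⟩
  rw [Measure.addHaar_ball _ _ ht, finrank_euclideanSpace, Fintype.card_fin,
    ENNReal.ofReal_mul unitBallVolume_pos.le, unitBallVolume, Measure.real,
    ENNReal.ofReal_toReal measure_ball_lt_top.ne, mul_comm]

theorem volume_closedBall_eq (hd : d ≠ 0) (x : EuclideanSpace ℝ (Fin d)) {t : ℝ} (ht : 0 ≤ t) :
    volume (closedBall x t) = ENNReal.ofReal (unitBallVolume d * t ^ d) := by
  have : Nonempty (Fin d) := ⟨⟨0, Nat.pos_of_ne_zero hd⟩⟩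
  rw [Measure.addHaar_closedBall_eq_addHaar_ball, volume_ball_eq hd x ht]

/-- The set of centres of balls on which `θ` has mean density larger than `lam`. -/
def maximalSet (θ : Measure (EuclideanSpace ℝ (Fin d))) (lam : ℝ) :
    Set (EuclideanSpace ℝ (Fin d)) :=
  {x | ∃ t : ℝ, 0 < t ∧ ENNReal.ofReal (lam * t ^ d) < θ (ball x t)}

theorem isOpen_maximalSet (θ : Measure (EuclideanSpace ℝ (Fin d))) (lam : ℝ) :
    IsOpen (maximalSet θ lam) := by
  rw [isOpen_iff]
  rintro x ⟨t, ht, hx⟩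
  have hc : Filter.Tendsto (fun t : ℝ => ENNReal.ofReal (lam * t ^ d)) (nhdsWithin t (Set.Ioi t))
      (nhds (ENNReal.ofReal (lam * t ^ d))) :=
    ((ENNReal.continuous_ofReal.comp (by fun_prop)).tendsto t).mono_left nhdsWithin_le_nhds
  obtain ⟨t', h1, h2⟩ := ((hc.eventually_lt_const hx).and self_mem_nhdsWithin).exists
  have h2 : t < t' := h2
  refine ⟨t' - t, by linarith, fun y hy => ⟨t', by linarith, h1.trans_le (measure_mono ?_)⟩⟩
  refine ball_subset_ball' ?_
  rw [mem_ball, dist_comm] at hy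
  linarith

theorem measure_ball_le_of_notMem_maximalSet {θ : Measure (EuclideanSpace ℝ (Fin d))} {lam : ℝ}
    {x : EuclideanSpace ℝ (Fin d)} (hx : x ∉ maximalSet θ lam) {t : ℝ} (ht : 0 < t) :
    θ (ball x t) ≤ ENNReal.ofReal (lam * t ^ d) := by
  by_contra h
  exact hx ⟨t, ht, not_le.1 h⟩

/-- The weak-type `(1, 1)` inequality for the maximal function. -/
theorem volume_maximalSet_le (hd : d ≠ 0) (θ : Measure (EuclideanSpace ℝ (Fin d)))
    [IsFiniteMeasure θ] {lam : ℝ} (hlam : 0 < lam) :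
    volume (maximalSet θ lam) ≤ ENNReal.ofReal (unitBallVolume d * 5 ^ d / lam) * θ Set.univ := by
  choose! r hr using fun (x : EuclideanSpace ℝ (Fin d)) (hx : x ∈ maximalSet θ lam) => hx
  have hbound : ∀ x ∈ maximalSet θ lam, r x ≤ max 1 (θ.real Set.univ / lam) := by
    intro x hx
    obtain ⟨h0, h⟩ := hr x hx
    rcases le_total (r x) 1 with h1 | h1
    · exact h1.trans (le_max_left _ _)
    · refine le_max_of_le_right ?_
      rw [le_div_iff₀ hlam, mul_comm]
      have h2 : lam * r x ^ d ≤ θ.real Set.univ := by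
        rw [Measure.real, ← ENNReal.ofReal_le_iff_le_toReal (measure_ne_top _ _)]
        exact h.le.trans (measure_mono (Set.subset_univ _))
      have h3 : r x ≤ r x ^ d := le_self_pow₀ h1 hd
      nlinarith
  obtain ⟨u, hut, hdisj, hcov⟩ := Vitali.exists_disjoint_subfamily_covering_enlargement_closedBall
    (maximalSet θ lam) id r _ hbound 5 (by norm_num)
  simp only [id] at hdisj hcov
  have hcount : u.Countable := by
    refine hdisj.countable_of_nonempty_interior fun x hx => ?_
    exact ⟨x, ball_subset_interior_closedBall (mem_ball_self (hr x (hut hx)).1)⟩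
  have hsub : maximalSet θ lam ⊆ ⋃ b ∈ u, closedBall b (5 * r b) := by
    intro x hx
    obtain ⟨b, hb, h⟩ := hcov x hx
    exact Set.mem_biUnion hb (h (mem_closedBall_self (hr x hx).1.le))
  calc volume (maximalSet θ lam)
      ≤ ∑' b : u, volume (closedBall (b : EuclideanSpace ℝ (Fin d)) (5 * r b)) :=
        (measure_mono hsub).trans (measure_biUnion_le _ hcount _)
    _ ≤ ∑' b : (u : Set (EuclideanSpace ℝ (Fin d))),
          ENNReal.ofReal (unitBallVolume d * 5 ^ d / lam) *
            θ (closedBall (b : EuclideanSpace ℝ (Fin d)) (r b)) := by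
        refine ENNReal.tsum_le_tsum fun b => ?_
        obtain ⟨h0, h⟩ := hr b (hut b.2)
        rw [volume_closedBall_eq hd _ (by positivity)]
        calc ENNReal.ofReal (unitBallVolume d * (5 * r b) ^ d)
            = ENNReal.ofReal (unitBallVolume d * 5 ^ d / lam) * ENNReal.ofReal (lam * r b ^ d) := by
              rw [← ENNReal.ofReal_mul (by have := unitBallVolume_pos (d := d); positivity)]
              congr 1
              field_simp
              ring
          _ ≤ _ := by
              gcongr
              exact h.le.trans (measure_mono ball_subset_closedBall)
    _ = ENNReal.ofReal (unitBallVolume d * 5 ^ d / lam) *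
        ∑' b : u, θ (closedBall (b : EuclideanSpace ℝ (Fin d)) (r b)) :=
        ENNReal.tsum_mul_left
    _ = ENNReal.ofReal (unitBallVolume d * 5 ^ d / lam) * θ (⋃ b ∈ u, closedBall b (r b)) := by
        rw [measure_biUnion hcount hdisj fun _ _ => measurableSet_closedBall]
    _ ≤ _ := by gcongr; exact Set.subset_univ _

theorem nonempty_compl_maximalSet (hd : d ≠ 0) (θ : Measure (EuclideanSpace ℝ (Fin d)))
    [IsFiniteMeasure θ] {lam : ℝ} (hlam : 0 < lam) : (maximalSet θ lam)ᶜ.Nonempty := by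
  have : Nonempty (Fin d) := ⟨⟨0, Nat.pos_of_ne_zero hd⟩⟩
  rw [Set.nonempty_compl]
  intro h
  have h1 := volume_maximalSet_le hd θ hlam
  rw [h, measure_univ_of_isAddLeftInvariant, top_le_iff] at h1
  exact ENNReal.mul_ne_top ENNReal.ofReal_ne_top (measure_ne_top _ _) h1

end MaximalSet

section Mollification

variable {d : ℕ}

/-- A variable-radius mollifier: normalized indicator of the ball of radius `κ y` around `y`. -/
noncomputable def ballMollifier (κ : EuclideanSpace ℝ (Fin d) → ℝ)
    (z y : EuclideanSpace ℝ (Fin d)) : ℝ :=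
  {p : EuclideanSpace ℝ (Fin d) × EuclideanSpace ℝ (Fin d) | dist p.1 p.2 < κ p.2}.indicator
    (fun p => (unitBallVolume d * κ p.2 ^ d)⁻¹) (z, y)

theorem measurable_ballMollifier {κ : EuclideanSpace ℝ (Fin d) → ℝ} (hκ : Continuous κ) :
    Measurable fun p : EuclideanSpace ℝ (Fin d) × EuclideanSpace ℝ (Fin d) =>
      ballMollifier κ p.1 p.2 := by
  have hS : MeasurableSet {p : EuclideanSpace ℝ (Fin d) × EuclideanSpace ℝ (Fin d) |
      dist p.1 p.2 < κ p.2} :=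
    measurableSet_lt (by fun_prop) (by fun_prop)
  exact (Measurable.inv (by fun_prop)).indicator hS

theorem ballMollifier_of_lt {κ : EuclideanSpace ℝ (Fin d) → ℝ} {z y : EuclideanSpace ℝ (Fin d)}
    (h : dist z y < κ y) : ballMollifier κ z y = (unitBallVolume d * κ y ^ d)⁻¹ := by
  rw [ballMollifier, Set.indicator_of_mem]
  exact h

theorem ballMollifier_of_not_lt {κ : EuclideanSpace ℝ (Fin d) → ℝ}
    {z y : EuclideanSpace ℝ (Fin d)} (h : ¬ dist z y < κ y) : ballMollifier κ z y = 0 := by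
  rw [ballMollifier, Set.indicator_of_notMem]
  exact h

theorem ballMollifier_nonneg {κ : EuclideanSpace ℝ (Fin d) → ℝ} (hκ : ∀ y, 0 < κ y)
    (z y : EuclideanSpace ℝ (Fin d)) : 0 ≤ ballMollifier κ z y := by
  have := hκ y
  have := unitBallVolume_pos (d := d)
  by_cases h : dist z y < κ y
  · rw [ballMollifier_of_lt h]; positivity
  · rw [ballMollifier_of_not_lt h]

theorem lintegral_ballMollifier (hd : d ≠ 0) {κ : EuclideanSpace ℝ (Fin d) → ℝ}
    (hκ : ∀ y, 0 < κ y) (y : EuclideanSpace ℝ (Fin d)) :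
    ∫⁻ z, ‖ballMollifier κ z y‖ₑ = 1 := by
  have hu := unitBallVolume_pos (d := d)
  have hy := hκ y
  have e : ∀ z, ‖ballMollifier κ z y‖ₑ =
      (ball y (κ y)).indicator (fun _ => ENNReal.ofReal (unitBallVolume d * κ y ^ d)⁻¹) z := by
    intro z
    by_cases h : dist z y < κ y
    · rw [ballMollifier_of_lt h, Set.indicator_of_mem (mem_ball.2 h),
        Real.enorm_of_nonneg (by positivity)]
    · rw [ballMollifier_of_not_lt h, Set.indicator_of_notMem (by rwa [mem_ball]), enorm_zero]
  simp only [e]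
  rw [lintegral_indicator measurableSet_ball, setLIntegral_const, volume_ball_eq hd y hy.le,
    ← ENNReal.ofReal_mul (by positivity), inv_mul_cancel₀ (by positivity), ENNReal.ofReal_one]

variable {θ : Measure (EuclideanSpace ℝ (Fin d))} {lam : ℝ}

/-- The radius used for mollification: a fraction of the distance to the complement of the
maximal set, plus a fixed positive amount. -/
noncomputable def whitneyRadius (θ : Measure (EuclideanSpace ℝ (Fin d))) (lam s : ℝ)
    (y : EuclideanSpace ℝ (Fin d)) : ℝ :=
  infDist y (maximalSet θ lam)ᶜ / 4 + s

theorem continuous_whitneyRadius (s : ℝ) : Continuous (whitneyRadius θ lam s) :=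
  ((continuous_infDist_pt _).div_const _).add_const _

theorem whitneyRadius_pos {s : ℝ} (hs : 0 < s) (y : EuclideanSpace ℝ (Fin d)) :
    0 < whitneyRadius θ lam s y := by
  have := infDist_nonneg (x := y) (s := (maximalSet θ lam)ᶜ)
  unfold whitneyRadius
  positivity

theorem whitneyRadius_le (s : ℝ) (x y : EuclideanSpace ℝ (Fin d)) :
    whitneyRadius θ lam s x ≤ whitneyRadius θ lam s y + dist x y / 4 := by
  have := infDist_le_infDist_add_dist (s := (maximalSet θ lam)ᶜ) (x := x) (y := y)
  unfold whitneyRadius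
  linarith

/-- The mollification of `θ` has density bounded by a multiple of the threshold. -/
theorem lintegral_ballMollifier_whitneyRadius_le [IsFiniteMeasure θ] (hd : d ≠ 0)
    (hlam : 0 < lam) {s : ℝ} (hs : 0 < s)
    (x : EuclideanSpace ℝ (Fin d)) :
    ∫⁻ y, ‖ballMollifier (whitneyRadius θ lam s) x y‖ₑ ∂θ ≤
      ENNReal.ofReal (8 ^ d / unitBallVolume d * lam) := by
  have hu := unitBallVolume_pos (d := d)
  set κ := whitneyRadius θ lam s with hκ
  have hx : 0 < κ x := whitneyRadius_pos hs x
  obtain ⟨p, hp, hxp⟩ := (isOpen_maximalSet θ lam).isClosed_compl.exists_infDist_eq_dist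
    (nonempty_compl_maximalSet hd θ hlam) x
  have hpx : dist x p ≤ 4 * κ x := by
    rw [← hxp, hκ, whitneyRadius]; linarith
  have hle : ∀ y, ‖ballMollifier κ x y‖ₑ ≤ (ball p (16 / 3 * κ x)).indicator
      (fun _ => ENNReal.ofReal (unitBallVolume d * (4 / 5 * κ x) ^ d)⁻¹) y := by
    intro y
    by_cases h : dist x y < κ y
    · have h1 : κ x ≤ κ y + dist x y / 4 := whitneyRadius_le s x y
      have h2 : κ y ≤ κ x + dist x y / 4 := by
        have := whitneyRadius_le (θ := θ) (lam := lam) s y x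
        rwa [dist_comm y x] at this
      have hy : 0 < κ y := whitneyRadius_pos hs y
      have hmem : y ∈ ball p (16 / 3 * κ x) := by
        rw [mem_ball]
        have := dist_triangle y x p
        rw [dist_comm y x] at this
        linarith
      rw [ballMollifier_of_lt h, Set.indicator_of_mem hmem, Real.enorm_of_nonneg (by positivity)]
      refine ENNReal.ofReal_le_ofReal (inv_anti₀ (by positivity) ?_)
      gcongr
      linarith
    · rw [ballMollifier_of_not_lt h, enorm_zero]
      exact zero_le
  calc ∫⁻ y, ‖ballMollifier κ x y‖ₑ ∂θ ≤ _ := lintegral_mono hle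
    _ = ENNReal.ofReal (unitBallVolume d * (4 / 5 * κ x) ^ d)⁻¹ * θ (ball p (16 / 3 * κ x)) := by
        rw [lintegral_indicator measurableSet_ball, setLIntegral_const]
    _ ≤ ENNReal.ofReal (unitBallVolume d * (4 / 5 * κ x) ^ d)⁻¹ *
          ENNReal.ofReal (lam * (16 / 3 * κ x) ^ d) := by
        gcongr
        exact measure_ball_le_of_notMem_maximalSet hp (by positivity)
    _ ≤ _ := by
        rw [← ENNReal.ofReal_mul (by positivity)]
        refine ENNReal.ofReal_le_ofReal ?_
        have : (unitBallVolume d * (4 / 5 * κ x) ^ d)⁻¹ * (lam * (16 / 3 * κ x) ^ d) =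
            (20 / 3) ^ d / unitBallVolume d * lam := by
          rw [show (16 / 3 * κ x) = (20 / 3) * (4 / 5 * κ x) by ring, mul_pow (20 / 3)]
          field_simp
        rw [this]
        gcongr
        norm_num

/-- The error of mollifying inside a singular integral is controlled away from the maximal set. -/
theorem setLIntegral_kernel_sub_le {C : ℝ} {K : EuclideanSpace ℝ (Fin d) → ℝ}
    (hK : IsSingularKernel C K) (hC : 0 ≤ C) : ∃ s : ℝ, 0 < s ∧
    ∀ y z, dist z y < whitneyRadius θ lam s y →
      ∫⁻ x in (maximalSet θ lam)ᶜ, ‖K (y - x) - K (z - x)‖ₑ ≤ ENNReal.ofReal (C + 1) := by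
  obtain ⟨L, hL, hLip⟩ := hK.translation
  refine ⟨1 / (2 * (L + 1)), by positivity, fun y z hyz => ?_⟩
  set s := 1 / (2 * (L + 1)) with hs
  have hs0 : 0 < s := by positivity
  set D := infDist y (maximalSet θ lam)ᶜ with hD
  have hyz : dist z y < D / 4 + s := hyz
  have hF : MeasurableSet (maximalSet θ lam)ᶜ := (isOpen_maximalSet θ lam).measurableSet.compl
  have key : ∫⁻ x in (maximalSet θ lam)ᶜ, ‖K (y - x) - K (z - x)‖ₑ ≤
      ∫⁻ u in {u | D ≤ ‖u‖}, ‖K u - K (u + (z - y))‖ₑ := by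
    rw [← lintegral_indicator hF,
      ← lintegral_indicator (measurableSet_le measurable_const measurable_norm),
      ← lintegral_sub_left_eq_self ({u : EuclideanSpace ℝ (Fin d) | D ≤ ‖u‖}.indicator _) y]
    refine lintegral_mono fun x => ?_
    by_cases hx : x ∈ (maximalSet θ lam)ᶜ
    · have : D ≤ ‖y - x‖ := by
        rw [← dist_eq_norm]
        exact infDist_le_dist_of_mem hx
      rw [Set.indicator_of_mem hx, Set.indicator_of_mem (show y - x ∈ {u | D ≤ ‖u‖} from this)]
      rw [show y - x + (z - y) = z - x by abel]
    · rw [Set.indicator_of_notMem hx]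
      exact zero_le
  refine key.trans ?_
  rcases le_total s (D / 4) with h | h
  · have hR : 0 < D / 2 := by linarith
    have hv : ‖z - y‖ ≤ D / 2 := by
      rw [← dist_eq_norm]; linarith
    have := hK.hormander (D / 2) hR (z - y) hv
    rw [show 2 * (D / 2) = D by ring] at this
    exact this.trans (ENNReal.ofReal_le_ofReal (by linarith))
  · refine (setLIntegral_le_lintegral _ _).trans ((hLip (z - y)).trans
      (ENNReal.ofReal_le_ofReal ?_))
    have hv : ‖z - y‖ ≤ 2 * s := by
      rw [← dist_eq_norm]; linarith
    have : L * (2 * s) ≤ 1 := by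
      rw [hs]
      field_simp
      linarith
    nlinarith [mul_le_mul_of_nonneg_left hv hL]

end Mollification

section WeakEstimate

variable {d : ℕ}

set_option maxHeartbeats 400000 in
/-- A Calderón–Zygmund estimate: away from the maximal set of `θ`, singular integrals of `h • θ`
are integrable on sets of finite volume, with a quantitative bound. -/
theorem IsSingularKernel.setLIntegral_le (hd : d ≠ 0) {C : ℝ} (hC : 0 ≤ C)
    {K : EuclideanSpace ℝ (Fin d) → ℝ} (hK : IsSingularKernel C K)
    (θ : Measure (EuclideanSpace ℝ (Fin d))) [IsFiniteMeasure θ] {lam : ℝ} (hlam : 0 < lam)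
    {h : EuclideanSpace ℝ (Fin d) → ℝ} (hh : Measurable h) (hh1 : ∀ y, |h y| ≤ 1)
    (B : Set (EuclideanSpace ℝ (Fin d))) :
    ∫⁻ x in B ∩ (maximalSet θ lam)ᶜ, ‖∫ y, K (y - x) * h y ∂θ‖ₑ ≤
      ENNReal.ofReal C *
          (ENNReal.ofReal (8 ^ d / unitBallVolume d * lam) * θ Set.univ) ^ (1 / 2 : ℝ) *
          volume B ^ (1 / 2 : ℝ) +
        ENNReal.ofReal (C + 1) * θ Set.univ := by
  obtain ⟨s, hs, hs'⟩ := setLIntegral_kernel_sub_le (θ := θ) (lam := lam) hK hC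
  obtain ⟨κ, hκdef⟩ : ∃ κ, κ = whitneyRadius θ lam s := ⟨_, rfl⟩
  rw [← hκdef] at hs'
  have hκc : Continuous κ := hκdef ▸ continuous_whitneyRadius s
  have hκ : ∀ y, 0 < κ y := hκdef ▸ whitneyRadius_pos hs
  obtain ⟨β, hβdef⟩ : ∃ β, β = ballMollifier κ := ⟨_, rfl⟩
  have hβm : Measurable fun p : EuclideanSpace ℝ (Fin d) × EuclideanSpace ℝ (Fin d) =>
    β p.1 p.2 := hβdef ▸ measurable_ballMollifier hκc
  have hβ1 : ∀ y, ∫⁻ z, ‖β z y‖ₑ = 1 := hβdef ▸ lintegral_ballMollifier hd hκ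
  have hβ0 : ∀ z y, 0 ≤ β z y := hβdef ▸ ballMollifier_nonneg hκ
  have hh1e : ∀ y, ‖h y‖ₑ ≤ 1 := fun y => by
    rw [← ofReal_norm, ENNReal.ofReal_le_one]; exact hh1 y
  set g : EuclideanSpace ℝ (Fin d) → ℝ := fun z => ∫ y, β z y * h y ∂θ with hg
  have hgm : StronglyMeasurable g := by
    refine StronglyMeasurable.integral_prod_right'
      (f := fun p : EuclideanSpace ℝ (Fin d) × EuclideanSpace ℝ (Fin d) => β p.1 p.2 * h p.2) ?_
    exact (hβm.mul (hh.comp measurable_snd)).stronglyMeasurable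
  have hgle : ∀ z, ‖g z‖ₑ ≤ ∫⁻ y, ‖β z y‖ₑ ∂θ := fun z => by
    refine (enorm_integral_le_lintegral_enorm _).trans (lintegral_mono fun y => ?_)
    rw [enorm_mul]
    exact mul_le_of_le_one_right' (hh1e y)
  set Γ := ENNReal.ofReal (8 ^ d / unitBallVolume d * lam) with hΓ
  have hβtot : ∫⁻ z, ∫⁻ y, ‖β z y‖ₑ ∂θ = θ Set.univ := by
    rw [lintegral_lintegral_swap hβm.enorm.aemeasurable]
    simp [hβ1]
  have hgL1 : ∫⁻ z, ‖g z‖ₑ ≤ θ Set.univ := (lintegral_mono hgle).trans hβtot.le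
  have hgL2 : ∫⁻ z, ‖g z‖ₑ ^ (2 : ℝ) ≤ Γ * θ Set.univ := by
    calc ∫⁻ z, ‖g z‖ₑ ^ (2 : ℝ) ≤ ∫⁻ z, Γ * ‖g z‖ₑ := by
          refine lintegral_mono fun z => ?_
          rw [ENNReal.rpow_two, sq]
          gcongr
          refine (hgle z).trans ?_
          rw [hβdef, hκdef]
          exact (lintegral_ballMollifier_whitneyRadius_le hd hlam hs z)
      _ = Γ * ∫⁻ z, ‖g z‖ₑ := lintegral_const_mul' _ _ ENNReal.ofReal_ne_top
      _ ≤ _ := by gcongr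
  have hgN : eLpNorm g 2 volume ≤ (Γ * θ Set.univ) ^ (1 / 2 : ℝ) := by
    rw [eLpNorm_eq_lintegral_rpow_enorm_toReal two_ne_zero ENNReal.ofNat_ne_top]
    simp only [ENNReal.toReal_ofNat]
    gcongr
  have hgMem : MemLp g 2 volume := ⟨hgm.aestronglyMeasurable, hgN.trans_lt
    (ENNReal.rpow_lt_top_of_nonneg (by norm_num)
      (ENNReal.mul_ne_top ENNReal.ofReal_ne_top (measure_ne_top _ _)))⟩
  obtain ⟨M, hM⟩ := hK.bounded
  have hMe : ∀ z, ‖K z‖ₑ ≤ ENNReal.ofReal M := fun z => by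
    rw [← ofReal_norm]; exact ENNReal.ofReal_le_ofReal (hM z)
  -- the mollified singular integral
  have hswap : ∀ x, ∫ z, K (z - x) * g z = ∫ y, (∫ z, K (z - x) * β z y) * h y ∂θ := by
    intro x
    have hint : Integrable (Function.uncurry fun z y => K (z - x) * (β z y * h y))
        (volume.prod θ) := by
      refine ⟨?_, ?_⟩
      · refine Measurable.aestronglyMeasurable ?_
        have := hK.continuous
        refine Measurable.mul (Continuous.measurable ?_) (hβm.mul (hh.comp measurable_snd))
        exact this.comp (by fun_prop)
      · rw [HasFiniteIntegral, lintegral_prod]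
        · refine (lintegral_mono fun z => lintegral_mono fun y =>
            (show _ ≤ ENNReal.ofReal M * ‖β z y‖ₑ from ?_)).trans_lt ?_
          · simp only [Function.uncurry, enorm_mul]
            exact mul_le_mul' (hMe _) (mul_le_of_le_one_right' (hh1e y))
          · simp only [lintegral_const_mul' _ _ ENNReal.ofReal_ne_top]
            rw [hβtot]
            exact ENNReal.mul_lt_top ENNReal.ofReal_lt_top (measure_lt_top _ _)
        · refine Measurable.aemeasurable (Measurable.enorm ?_)
          refine Measurable.mul (Continuous.measurable ?_) (hβm.mul (hh.comp measurable_snd))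
          exact hK.continuous.comp (by fun_prop)
    calc ∫ z, K (z - x) * g z = ∫ z, ∫ y, K (z - x) * (β z y * h y) ∂θ := by
          simp only [hg, integral_const_mul]
      _ = ∫ y, (∫ z, K (z - x) * (β z y * h y)) ∂θ := integral_integral_swap hint
      _ = _ := by
          refine integral_congr_ae (ae_of_all _ fun y => ?_)
          simp only [← integral_mul_const, mul_assoc]
  have hβint : ∀ y, Integrable fun z => β z y := fun y =>
    ⟨(hβm.comp (by fun_prop : Measurable fun z => (z, y))).aestronglyMeasurable, by
      rw [HasFiniteIntegral, hβ1]; exact ENNReal.one_lt_top⟩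
  have hβ1' : ∀ y, ∫ z, β z y = 1 := by
    intro y
    rw [integral_eq_lintegral_of_nonneg_ae (ae_of_all _ fun z => hβ0 z y)
      (hβint y).aestronglyMeasurable]
    have := hβ1 y
    rw [lintegral_congr fun z => Real.enorm_of_nonneg (hβ0 z y)] at this
    rw [this, ENNReal.toReal_one]
  have hKβ : ∀ x y, Integrable fun z => K (z - x) * β z y := fun x y =>
    (hβint y).bdd_mul (c := M) (hK.continuous.comp (by fun_prop)).aestronglyMeasurable
      (ae_of_all _ fun z => hM _)
  have hinner : Measurable fun p : EuclideanSpace ℝ (Fin d) × EuclideanSpace ℝ (Fin d) =>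
      ∫ z, K (z - p.1) * β z p.2 := by
    refine (StronglyMeasurable.integral_prod_right' (f := fun q : (EuclideanSpace ℝ (Fin d) ×
      EuclideanSpace ℝ (Fin d)) × EuclideanSpace ℝ (Fin d) => K (q.2 - q.1.1) * β q.2 q.1.2)
      (Measurable.stronglyMeasurable ?_)).measurable
    refine Measurable.mul (Continuous.measurable (hK.continuous.comp (by fun_prop))) ?_
    exact hβm.comp (by fun_prop : Measurable fun q : (EuclideanSpace ℝ (Fin d) ×
      EuclideanSpace ℝ (Fin d)) × EuclideanSpace ℝ (Fin d) => (q.2, q.1.2))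
  have hdiff : ∀ x, ‖∫ y, K (y - x) * h y ∂θ‖ₑ ≤ ‖∫ z, K (z - x) * g z‖ₑ +
      ∫⁻ y, (∫⁻ z, ‖β z y‖ₑ * ‖K (y - x) - K (z - x)‖ₑ) ∂θ := by
    intro x
    have hI1 : Integrable (fun y => K (y - x) * h y) θ := by
      refine Integrable.of_bound (C := M) ?_ (ae_of_all _ fun y => ?_)
      · exact ((hK.continuous.comp (by fun_prop)).measurable.mul hh).aestronglyMeasurable
      · rw [norm_mul]
        exact (mul_le_of_le_one_right (norm_nonneg _) (hh1 y)).trans (hM _)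
    have hI2 : Integrable (fun y => (∫ z, K (z - x) * β z y) * h y) θ := by
      refine Integrable.of_bound (C := M) ?_ (ae_of_all _ fun y => ?_)
      · exact ((hinner.comp (by fun_prop : Measurable fun y => (x, y))).mul hh).aestronglyMeasurable
      · rw [norm_mul]
        refine (mul_le_of_le_one_right (norm_nonneg _) (hh1 y)).trans ?_
        calc ‖∫ z, K (z - x) * β z y‖ ≤ ∫ z, M * β z y := by
              refine norm_integral_le_of_norm_le ((hβint y).const_mul M) (ae_of_all _ fun z => ?_)
              rw [norm_mul, Real.norm_of_nonneg (hβ0 z y)]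
              exact mul_le_mul_of_nonneg_right (hM _) (hβ0 z y)
          _ = M := by rw [integral_const_mul, hβ1' y, mul_one]
    have heq : (∫ y, K (y - x) * h y ∂θ) = (∫ z, K (z - x) * g z) +
        ∫ y, (∫ z, β z y * (K (y - x) - K (z - x))) * h y ∂θ := by
      rw [hswap x, ← sub_eq_iff_eq_add', ← integral_sub hI1 hI2]
      refine integral_congr_ae (ae_of_all _ fun y => ?_)
      simp only
      rw [← sub_mul]
      congr 1
      simp only [mul_sub]
      rw [integral_sub ((hβint y).mul_const _)
        ((hKβ x y).congr (ae_of_all _ fun z => mul_comm _ _)), integral_mul_const, hβ1' y, one_mul]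
      simp only [mul_comm]
    rw [heq]
    refine (enorm_add_le _ _).trans (add_le_add le_rfl ?_)
    refine (enorm_integral_le_lintegral_enorm _).trans (lintegral_mono fun y => ?_)
    rw [enorm_mul]
    refine (mul_le_of_le_one_right' (hh1e y)).trans ?_
    refine (enorm_integral_le_lintegral_enorm _).trans (lintegral_mono fun z => ?_)
    rw [enorm_mul]
  have hF : MeasurableSet (maximalSet θ lam)ᶜ := (isOpen_maximalSet θ lam).measurableSet.compl
  have herr : ∫⁻ x in (maximalSet θ lam)ᶜ,
      ∫⁻ y, (∫⁻ z, ‖β z y‖ₑ * ‖K (y - x) - K (z - x)‖ₑ) ∂θ ≤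
        ENNReal.ofReal (C + 1) * θ Set.univ := by
    have hm3 : Measurable fun q : (EuclideanSpace ℝ (Fin d) × EuclideanSpace ℝ (Fin d)) ×
        EuclideanSpace ℝ (Fin d) =>
        ‖β q.2 q.1.2‖ₑ * ‖K (q.1.2 - q.1.1) - K (q.2 - q.1.1)‖ₑ := by
      refine Measurable.mul (Measurable.enorm (hβm.comp (by fun_prop :
        Measurable fun q : (EuclideanSpace ℝ (Fin d) × EuclideanSpace ℝ (Fin d)) ×
          EuclideanSpace ℝ (Fin d) => (q.2, q.1.2)))) (Continuous.measurable ?_)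
      have := hK.continuous
      fun_prop
    rw [lintegral_lintegral_swap (Measurable.aemeasurable (hm3.lintegral_prod_right'))]
    calc _ = ∫⁻ y, (∫⁻ z, ‖β z y‖ₑ *
          ∫⁻ x in (maximalSet θ lam)ᶜ, ‖K (y - x) - K (z - x)‖ₑ) ∂θ := by
          refine lintegral_congr fun y => ?_
          rw [lintegral_lintegral_swap]
          · refine lintegral_congr fun z => lintegral_const_mul' _ _ enorm_ne_top
          · exact Measurable.aemeasurable (hm3.comp (by fun_prop : Measurable
              fun p : EuclideanSpace ℝ (Fin d) × EuclideanSpace ℝ (Fin d) => ((p.1, y), p.2)))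
      _ ≤ ∫⁻ y, (∫⁻ z, ‖β z y‖ₑ * ENNReal.ofReal (C + 1)) ∂θ := by
          refine lintegral_mono fun y => lintegral_mono fun z => ?_
          by_cases hzy : dist z y < κ y
          · exact mul_le_mul_right (hs' y z hzy) _
          · rw [hβdef, ballMollifier_of_not_lt hzy]
            simp
      _ = _ := by
          simp only [lintegral_mul_const' _ _ ENNReal.ofReal_ne_top, hβ1, one_mul, lintegral_const]
  have hmain : ∫⁻ x in B, ‖∫ z, K (z - x) * g z‖ₑ ≤ ENNReal.ofReal C *
      (Γ * θ Set.univ) ^ (1 / 2 : ℝ) * volume B ^ (1 / 2 : ℝ) := by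
    have hTm : AEStronglyMeasurable (fun x => ∫ z, K (z - x) * g z) volume := by
      refine (StronglyMeasurable.integral_prod_right' (f := fun p : EuclideanSpace ℝ (Fin d) ×
        EuclideanSpace ℝ (Fin d) => K (p.2 - p.1) * g p.2)
        (Measurable.stronglyMeasurable ?_)).aestronglyMeasurable
      exact Measurable.mul (hK.continuous.comp (by fun_prop)).measurable
        (hgm.measurable.comp measurable_snd)
    have h1 := eLpNorm_le_eLpNorm_mul_rpow_measure_univ (μ := volume.restrict B)
      (p := 1) (q := 2) (by norm_num) hTm.restrict
    rw [eLpNorm_one_eq_lintegral_enorm, Measure.restrict_apply_univ] at h1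
    refine h1.trans ?_
    have e : 1 / (1 : ENNReal).toReal - 1 / (2 : ENNReal).toReal = (1 / 2 : ℝ) := by norm_num
    rw [e]
    gcongr
    calc _ ≤ eLpNorm (fun x => ∫ z, K (z - x) * g z) 2 volume :=
          eLpNorm_mono_measure _ Measure.restrict_le_self
      _ ≤ ENNReal.ofReal C * eLpNorm g 2 volume := hK.eLpNorm_le g hgMem
      _ ≤ _ := by gcongr
  have hm3' : Measurable fun x => ‖∫ z, K (z - x) * g z‖ₑ := by
    refine Measurable.enorm (StronglyMeasurable.integral_prod_right' (f := fun p :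
      EuclideanSpace ℝ (Fin d) × EuclideanSpace ℝ (Fin d) => K (p.2 - p.1) * g p.2)
      (Measurable.stronglyMeasurable ?_)).measurable
    exact Measurable.mul (hK.continuous.comp (by fun_prop)).measurable
      (hgm.measurable.comp measurable_snd)
  calc _ ≤ ∫⁻ x in B ∩ (maximalSet θ lam)ᶜ, (‖∫ z, K (z - x) * g z‖ₑ +
        ∫⁻ y, (∫⁻ z, ‖β z y‖ₑ * ‖K (y - x) - K (z - x)‖ₑ) ∂θ) := lintegral_mono hdiff
    _ = (∫⁻ x in B ∩ (maximalSet θ lam)ᶜ, ‖∫ z, K (z - x) * g z‖ₑ) +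
        ∫⁻ x in B ∩ (maximalSet θ lam)ᶜ, ∫⁻ y, (∫⁻ z, ‖β z y‖ₑ * ‖K (y - x) - K (z - x)‖ₑ) ∂θ :=
        lintegral_add_left hm3' _
    _ ≤ (∫⁻ x in B, ‖∫ z, K (z - x) * g z‖ₑ) +
        ∫⁻ x in (maximalSet θ lam)ᶜ, ∫⁻ y, (∫⁻ z, ‖β z y‖ₑ * ‖K (y - x) - K (z - x)‖ₑ) ∂θ :=
        add_le_add (lintegral_mono_set Set.inter_subset_left)
          (lintegral_mono_set Set.inter_subset_right)
    _ ≤ _ := add_le_add hmain herr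

end WeakEstimate

section Potential

open FourierTransform SchwartzMap

variable {d : ℕ}

theorem IsSingularKernel.mono {C C' : ℝ} (h : C ≤ C') {K : EuclideanSpace ℝ (Fin d) → ℝ}
    (hK : IsSingularKernel C K) : IsSingularKernel C' K where
  continuous := hK.continuous
  integrable := hK.integrable
  bounded := hK.bounded
  eLpNorm_le g hg := (hK.eLpNorm_le g hg).trans
    (mul_le_mul' (ENNReal.ofReal_le_ofReal h) le_rfl)
  hormander R hR v hv := (hK.hormander R hR v hv).trans (ENNReal.ofReal_le_ofReal h)
  translation := hK.translation

theorem contDiff_dilation {φ : EuclideanSpace ℝ (Fin d) → ℝ} (hφ : ContDiff ℝ (⊤ : ℕ∞) φ)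
    (c : ℝ) : ContDiff ℝ (⊤ : ℕ∞) (dilation c φ) := by
  unfold dilation
  exact contDiff_const.mul (hφ.comp (contDiff_const_smul c))

theorem wordDeriv_dilation {φ : EuclideanSpace ℝ (Fin d) → ℝ} (hφ : ContDiff ℝ (⊤ : ℕ∞) φ)
    (c : ℝ) (w : List (Fin d)) :
    wordDeriv w (dilation c φ) = fun z => c ^ w.length * dilation c (wordDeriv w φ) z := by
  have h := wordDeriv_comp_affine hφ c 0 w
  simp only [sub_zero] at h
  unfold dilation
  have hs : ContDiff ℝ (⊤ : ℕ∞) (fun y => φ (c • y)) := hφ.comp (contDiff_const_smul c)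
  rw [wordDeriv_const_mul hs, h]
  funext z
  ring

/-- A sum of dilations of `ψ` whose derivatives of order `K` are dyadic kernels. -/
noncomputable def dyadicPotential (K : ℕ) (ψ : EuclideanSpace ℝ (Fin d) → ℝ) (a N : ℕ) :
    EuclideanSpace ℝ (Fin d) → ℝ :=
  fun z => ∑ i ∈ Finset.Ico a N, (((2 : ℝ) ^ i) ^ K)⁻¹ * dilation (2 ^ i) ψ z

theorem contDiff_dyadicPotential {ψ : EuclideanSpace ℝ (Fin d) → ℝ}
    (hψ : ContDiff ℝ (⊤ : ℕ∞) ψ) (K a N : ℕ) :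
    ContDiff ℝ (⊤ : ℕ∞) (dyadicPotential K ψ a N) :=
  ContDiff.sum fun _ _ => contDiff_const.mul (contDiff_dilation hψ _)

theorem wordDeriv_dyadicPotential {ψ : EuclideanSpace ℝ (Fin d) → ℝ}
    (hψ : ContDiff ℝ (⊤ : ℕ∞) ψ) (K a N : ℕ) (w : List (Fin d))
    (z : EuclideanSpace ℝ (Fin d)) :
    wordDeriv w (dyadicPotential K ψ a N) z = ∑ i ∈ Finset.Ico a N,
      (((2 : ℝ) ^ i) ^ K)⁻¹ * ((2 ^ i) ^ w.length * dilation (2 ^ i) (wordDeriv w ψ) z) := by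
  unfold dyadicPotential
  rw [wordDeriv_sum _ fun i => contDiff_const.mul (contDiff_dilation hψ _)]
  refine Finset.sum_congr rfl fun i _ => ?_
  rw [wordDeriv_const_mul (contDiff_dilation hψ _), wordDeriv_dilation hψ]

theorem wordDeriv_dyadicPotential_eq {ψ : EuclideanSpace ℝ (Fin d) → ℝ}
    (hψ : ContDiff ℝ (⊤ : ℕ∞) ψ) {K : ℕ} (a N : ℕ) {w : List (Fin d)} (hw : w.length = K) :
    wordDeriv w (dyadicPotential K ψ a N) = dyadicKernel (wordDeriv w ψ) a N := by
  funext z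
  rw [wordDeriv_dyadicPotential hψ, dyadicKernel]
  refine Finset.sum_congr rfl fun i _ => ?_
  rw [hw, ← mul_assoc, inv_mul_cancel₀ (by positivity), one_mul]

theorem sum_Ico_inv_two_pow_le (a N : ℕ) :
    ∑ i ∈ Finset.Ico a N, ((2 : ℝ) ^ i)⁻¹ ≤ 2 * (2 ^ a)⁻¹ := by
  rcases le_total a N with h | h
  · have e : ∀ i : ℕ, ((2 : ℝ) ^ i)⁻¹ = -(2 * (2 ^ (i + 1))⁻¹) - -(2 * (2 ^ i)⁻¹) := by
      intro i
      rw [pow_succ]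
      field_simp
      ring
    rw [Finset.sum_congr rfl fun i _ => e i, Finset.sum_Ico_sub (fun i => -(2 * ((2 : ℝ) ^ i)⁻¹)) h]
    have : (0 : ℝ) ≤ 2 * (2 ^ N)⁻¹ := by positivity
    linarith
  · simp [Finset.Ico_eq_empty_of_le h]

theorem lintegral_wordDeriv_dyadicPotential_le {ψ : EuclideanSpace ℝ (Fin d) → ℝ}
    (hψ : ContDiff ℝ (⊤ : ℕ∞) ψ) {K : ℕ} (a N : ℕ) {w : List (Fin d)} (hw : w.length < K)
    {C : ℝ} (hC : 0 ≤ C) (h : ∫⁻ z, ‖wordDeriv w ψ z‖ₑ ≤ ENNReal.ofReal C) :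
    ∫⁻ z, ‖wordDeriv w (dyadicPotential K ψ a N) z‖ₑ ≤ ENNReal.ofReal (2 * C * (2 ^ a)⁻¹) := by
  calc ∫⁻ z, ‖wordDeriv w (dyadicPotential K ψ a N) z‖ₑ
      ≤ ∫⁻ z, ∑ i ∈ Finset.Ico a N,
          ENNReal.ofReal ((2 ^ i)⁻¹) * ‖dilation (2 ^ i) (wordDeriv w ψ) z‖ₑ := by
        refine lintegral_mono fun z => ?_
        rw [wordDeriv_dyadicPotential hψ]
        refine (enorm_sum_le _ _).trans (Finset.sum_le_sum fun i _ => ?_)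
        rw [← mul_assoc, enorm_mul, Real.enorm_of_nonneg (by positivity)]
        gcongr
        rw [inv_mul_le_iff₀ (by positivity), ← div_eq_mul_inv, le_div_iff₀ (by positivity),
          ← pow_succ]
        exact pow_le_pow_right₀ (one_le_pow₀ one_le_two) hw
    _ = ∑ i ∈ Finset.Ico a N, ENNReal.ofReal ((2 ^ i)⁻¹) * ∫⁻ z, ‖wordDeriv w ψ z‖ₑ := by
        rw [lintegral_finsetSum]
        · refine Finset.sum_congr rfl fun i _ => ?_
          rw [lintegral_const_mul' _ _ ENNReal.ofReal_ne_top,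
            lintegral_enorm_dilation (by positivity)]
        · intro i _
          exact (continuous_dilation (hψ.wordDeriv w).continuous _).measurable.enorm.const_mul _
    _ ≤ ∑ i ∈ Finset.Ico a N, ENNReal.ofReal ((2 ^ i)⁻¹ * C) := by
        refine Finset.sum_le_sum fun i _ => ?_
        rw [ENNReal.ofReal_mul (by positivity)]
        gcongr
    _ ≤ _ := by
        rw [← ENNReal.ofReal_sum_of_nonneg fun i _ => by positivity, ← Finset.sum_mul]
        refine ENNReal.ofReal_le_ofReal ?_
        nlinarith [sum_Ico_inv_two_pow_le a N]

theorem setLIntegral_dyadicKernel_le {φ : EuclideanSpace ℝ (Fin d) → ℝ} (hφ : Continuous φ)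
    {C : ℝ} (hC : 0 ≤ C) (h : ∫⁻ z, ENNReal.ofReal ‖z‖ * ‖φ z‖ₑ ≤ ENNReal.ofReal C) (a N : ℕ) :
    ∫⁻ z in {z | 1 / 2 ≤ ‖z‖}, ‖dyadicKernel φ a N z‖ₑ ≤ ENNReal.ofReal (4 * C * (2 ^ a)⁻¹) := by
  calc _ ≤ ∫⁻ z in {z | 1 / 2 ≤ ‖z‖}, ∑ i ∈ Finset.Ico a N, ‖dilation (2 ^ i) φ z‖ₑ :=
        lintegral_mono fun z => enorm_dyadicKernel_le φ a N z
    _ = ∑ i ∈ Finset.Ico a N, ∫⁻ z in {z | 1 / 2 ≤ ‖z‖}, ‖dilation (2 ^ i) φ z‖ₑ :=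
        lintegral_finsetSum _ fun i _ => (continuous_dilation hφ _).measurable.enorm
    _ ≤ ∑ i ∈ Finset.Ico a N, ENNReal.ofReal (C / (2 ^ i * (1 / 2))) :=
        Finset.sum_le_sum fun i _ =>
          setLIntegral_dilation_le (by positivity) h one_half_pos
    _ ≤ _ := by
        rw [← ENNReal.ofReal_sum_of_nonneg fun i _ => by positivity]
        refine ENNReal.ofReal_le_ofReal ?_
        have e : ∀ i : ℕ, C / (2 ^ i * (1 / 2)) = (2 * C) * ((2 : ℝ) ^ i)⁻¹ := fun i => by
          field_simp
        rw [Finset.sum_congr rfl fun i _ => e i, ← Finset.mul_sum]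
        nlinarith [sum_Ico_inv_two_pow_le a N]

theorem exists_abs_dyadicPotential_wordDeriv_le {ψ : EuclideanSpace ℝ (Fin d) → ℝ}
    (hψ : ContDiff ℝ (⊤ : ℕ∞) ψ) (K a N : ℕ) (w : List (Fin d)) {C : ℝ}
    (hC : ∀ z, |wordDeriv w ψ z| ≤ C) :
    ∃ B, ∀ z, |wordDeriv w (dyadicPotential K ψ a N) z| ≤ B := by
  refine ⟨∑ i ∈ Finset.Ico a N,
      (((2 : ℝ) ^ i) ^ K)⁻¹ * ((2 ^ i) ^ w.length * ((2 ^ i) ^ d * C)), fun z => ?_⟩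
  rw [wordDeriv_dyadicPotential hψ]
  refine (Finset.abs_sum_le_sum_abs _ _).trans (Finset.sum_le_sum fun i _ => ?_)
  rw [dilation, abs_mul, abs_mul, abs_mul, abs_of_nonneg (by positivity : (0 : ℝ) ≤ (2 ^ i) ^ d),
    abs_of_nonneg (by positivity : (0 : ℝ) ≤ (2 ^ i) ^ w.length),
    abs_of_nonneg (by positivity : (0 : ℝ) ≤ ((2 ^ i) ^ K)⁻¹)]
  gcongr
  exact hC _

/-- Truncated fundamental solutions of an elliptic operator `∑ s, c s * ∂^{w s}` of order `K`,
between scales `2⁻ᴺ` and `2⁻ᵃ`, with estimates uniform in the scales. -/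
theorem exists_truncated_parametrix {ι : Type*} [Fintype ι] (K : ℕ) (c : ι → ℝ)
    (w : ι → List (Fin d)) (hw : ∀ s, (w s).length = K)
    (hell : ∀ ξ : EuclideanSpace ℝ (Fin d), ξ ≠ 0 → ∑ s, c s * ((w s).map ξ).prod ≠ 0) :
    ∃ (η : EuclideanSpace ℝ (Fin d) → ℝ) (C : ℝ), 0 ≤ C ∧ Continuous η ∧ Integrable η ∧
      ∫ z, η z = 1 ∧ (∀ z, |η z| ≤ C) ∧ (∀ z, ‖z‖ ^ (d + 1) * |η z| ≤ C) ∧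
      ∫⁻ z, ENNReal.ofReal ‖z‖ * ‖η z‖ₑ ≤ ENNReal.ofReal C ∧
      ∀ a N : ℕ, a ≤ N → ∃ (Θ M : EuclideanSpace ℝ (Fin d) → ℝ)
        (κ : List (Fin d) → EuclideanSpace ℝ (Fin d) → ℝ),
        ContDiff ℝ (⊤ : ℕ∞) Θ ∧ tsupport Θ ⊆ closedBall 0 1 ∧ Measurable M ∧
        (∃ B, ∀ z, |M z| ≤ B) ∧ ∫⁻ z, ‖M z‖ₑ ≤ ENNReal.ofReal (C * (2 ^ a)⁻¹) ∧
        (∀ v, v.length = K → IsSingularKernel C (κ v)) ∧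
        (∀ v, v.length = K → ∀ z, |wordDeriv v Θ z - κ v z| ≤ M z) ∧
        (∀ v, v.length < K → ∀ z, |wordDeriv v Θ z| ≤ M z) ∧
        ∀ z, ∑ s, c s * κ (w s) z = dilation (2 ^ N) η z - dilation (2 ^ a) η z := by
  obtain ⟨F, ζ, hF, hpar, hζ⟩ := exists_parametrix K c w hw hell
  set ψ : EuclideanSpace ℝ (Fin d) → ℝ := fun z => ((𝓕⁻ F) z).re with hψdef
  set η : EuclideanSpace ℝ (Fin d) → ℝ := fun z => ((𝓕⁻ ζ) z).re with hηdef
  have hψ : ContDiff ℝ (⊤ : ℕ∞) ψ := contDiff_re _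
  have hψw : ∀ v, wordDeriv v ψ = fun z => ((𝓕⁻ (wordSymbolMul v F)) z).re := fun v =>
    wordDeriv_re_fourierInv v F
  have habs : ∀ (f : 𝓢(EuclideanSpace ℝ (Fin d), ℂ)) (k : ℕ),
      ∃ B : ℝ, 0 ≤ B ∧ ∀ z, ‖z‖ ^ k * |(f z).re| ≤ B := by
    intro f k
    obtain ⟨B, hB0, hB⟩ := f.decay k 0
    refine ⟨B, hB0.le, fun z => ?_⟩
    have := hB z
    rw [norm_iteratedFDeriv_zero] at this
    exact (mul_le_mul_of_nonneg_left (Complex.abs_re_le_norm _) (by positivity)).trans this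
  have hL1 : ∀ v, ∃ B : ℝ, 0 ≤ B ∧ ∫⁻ z, ‖wordDeriv v ψ z‖ₑ ≤ ENNReal.ofReal B := by
    intro v
    refine ⟨∫ z, ‖(𝓕⁻ (wordSymbolMul v F)) z‖, by positivity, ?_⟩
    rw [ofReal_integral_norm_eq_lintegral_enorm (SchwartzMap.integrable _), hψw]
    exact lintegral_mono fun z => enorm_re_le _
  have hL2 : ∀ v, ∃ B : ℝ, 0 ≤ B ∧
      ∫⁻ z, ENNReal.ofReal ‖z‖ * ‖wordDeriv v ψ z‖ₑ ≤ ENNReal.ofReal B := by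
    intro v
    obtain ⟨B, hB0, hB⟩ := SchwartzMap.exists_lintegral_norm_mul_le (𝓕⁻ (wordSymbolMul v F))
    refine ⟨B, hB0, (lintegral_mono fun z => ?_).trans hB⟩
    rw [hψw]
    exact mul_le_mul_right (enorm_re_le _) _
  have hker : ∀ v, ∃ B : ℝ, 0 ≤ B ∧
      ∀ a N, IsSingularKernel B (dyadicKernel (wordDeriv v ψ) a N) := by
    intro v
    rw [hψw]
    refine exists_isSingularKernel_dyadicKernel _ fun ξ hξ => hF ξ fun h0 => hξ ?_
    rw [wordSymbolMul_apply, h0, mul_zero]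
  let χ : ContDiffBump (0 : EuclideanSpace ℝ (Fin d)) :=
    ⟨1 / 2, 1, one_half_pos, one_half_lt_one⟩
  have hχ : ContDiff ℝ (⊤ : ℕ∞) χ := χ.contDiff
  have hleib := fun v : List (Fin d) => exists_leibniz_bound v hχ χ.hasCompactSupport
  choose B₁ hB₁0 hB₁ using hL1
  choose B₂ hB₂0 hB₂ using hL2
  choose B₃ hB₃0 hB₃ using hker
  choose B₄ hB₄0 hB₄ using hleib
  obtain ⟨C₁, hC₁0, hC₁⟩ := habs (𝓕⁻ ζ) 0
  obtain ⟨C₂, hC₂0, hC₂⟩ := habs (𝓕⁻ ζ) (d + 1)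
  obtain ⟨C₃, hC₃0, hC₃⟩ := SchwartzMap.exists_lintegral_norm_mul_le (𝓕⁻ ζ)
  set D : ℝ := 1 + ∑ v ∈ wordsLT d (K + 1), B₄ v with hD
  have hD0 : 1 ≤ D := le_add_of_nonneg_right (Finset.sum_nonneg fun v _ => hB₄0 v)
  have hBD : ∀ v : List (Fin d), v.length ≤ K → 1 + B₄ v ≤ D := fun v hv =>
    add_le_add le_rfl (Finset.single_le_sum (f := B₄) (fun v _ => hB₄0 v)
      (mem_wordsLT.2 (Nat.lt_succ_of_le hv)))
  set C₄ : ℝ := D * (∑ v ∈ wordsLT d K, 2 * B₁ v + ∑ v ∈ wordsEq d K, 4 * B₂ v) with hC₄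
  have hS1 : 0 ≤ ∑ v ∈ wordsLT d K, 2 * B₁ v :=
    Finset.sum_nonneg fun v _ => mul_nonneg zero_le_two (hB₁0 v)
  have hS2 : 0 ≤ ∑ v ∈ wordsEq d K, 4 * B₂ v :=
    Finset.sum_nonneg fun v _ => mul_nonneg (by norm_num) (hB₂0 v)
  have hC₄0 : 0 ≤ C₄ := mul_nonneg (by linarith) (add_nonneg hS1 hS2)
  have hC₅0 : 0 ≤ ∑ v ∈ wordsEq d K, B₃ v := Finset.sum_nonneg fun v _ => hB₃0 v
  have hηc : Continuous η := Complex.continuous_re.comp (𝓕⁻ ζ).continuous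
  refine ⟨η, C₁ + C₂ + C₃ + C₄ + ∑ v ∈ wordsEq d K, B₃ v, by positivity, hηc,
    (𝓕⁻ ζ).integrable.re, hζ, fun z => ?_, fun z => ?_, ?_, fun a N haN => ?_⟩
  · have := hC₁ z
    rw [pow_zero, one_mul] at this
    exact this.trans (by linarith)
  · exact (hC₂ z).trans (by linarith)
  · refine (lintegral_mono fun z => mul_le_mul_right (enorm_re_le _) _).trans
      (hC₃.trans (ENNReal.ofReal_le_ofReal (by linarith)))
  set Ψ := dyadicPotential K ψ a N with hΨdef
  have hΨ : ContDiff ℝ (⊤ : ℕ∞) Ψ := contDiff_dyadicPotential hψ K a N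
  have hS : MeasurableSet {z : EuclideanSpace ℝ (Fin d) | 1 / 2 ≤ ‖z‖} :=
    measurableSet_le measurable_const measurable_norm
  have hm : ∀ v, Measurable (wordDeriv v Ψ) := fun v => (hΨ.wordDeriv v).continuous.measurable
  set M₁ : EuclideanSpace ℝ (Fin d) → ℝ := fun z => ∑ v ∈ wordsLT d K, |wordDeriv v Ψ z| with hM₁
  set M₂ : EuclideanSpace ℝ (Fin d) → ℝ := fun z => ∑ v ∈ wordsEq d K,
    |{z : EuclideanSpace ℝ (Fin d) | 1 / 2 ≤ ‖z‖}.indicator (wordDeriv v Ψ) z| with hM₂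
  have hM₁0 : ∀ z, 0 ≤ M₁ z := fun z => Finset.sum_nonneg fun _ _ => abs_nonneg _
  have hM₂0 : ∀ z, 0 ≤ M₂ z := fun z => Finset.sum_nonneg fun _ _ => abs_nonneg _
  have hm₁ : Measurable M₁ := Finset.measurable_fun_sum _ fun v _ => (hm v).norm
  have hm₂ : Measurable M₂ := Finset.measurable_fun_sum _ fun v _ => ((hm v).indicator hS).norm
  have hχ01 : ∀ z, 0 ≤ χ z ∧ χ z ≤ 1 := fun z => ⟨χ.nonneg, χ.le_one⟩
  refine ⟨fun z => χ z * Ψ z, fun z => D * (M₁ z + M₂ z), fun v => wordDeriv v Ψ,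
    hχ.mul hΨ, ?_, (hm₁.add hm₂).const_mul D, ?_, ?_, fun v hv => ?_, fun v hv z => ?_,
    fun v hv z => ?_, fun z => ?_⟩
  · exact (tsupport_mul_subset_left).trans χ.tsupport_eq.subset
  · have hb : ∀ v, ∃ B, ∀ z, |wordDeriv v Ψ z| ≤ B := by
      intro v
      obtain ⟨B, -, hB⟩ := habs (𝓕⁻ (wordSymbolMul v F)) 0
      refine exists_abs_dyadicPotential_wordDeriv_le hψ K a N v (C := B) fun z => ?_
      rw [hψw]
      simpa using hB z
    choose B hB using hb
    refine ⟨D * (∑ v ∈ wordsLT d K, B v + ∑ v ∈ wordsEq d K, B v), fun z => ?_⟩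
    rw [abs_of_nonneg (mul_nonneg (by linarith) (add_nonneg (hM₁0 z) (hM₂0 z)))]
    refine mul_le_mul_of_nonneg_left (add_le_add ?_ ?_) (by linarith)
    · exact Finset.sum_le_sum fun v _ => hB v z
    · refine Finset.sum_le_sum fun v _ => le_trans ?_ (hB v z)
      exact norm_indicator_le_norm_self (wordDeriv v Ψ) z
  · have e : ∀ z, ‖D * (M₁ z + M₂ z)‖ₑ = ENNReal.ofReal D *
        (∑ v ∈ wordsLT d K, ‖wordDeriv v Ψ z‖ₑ + ∑ v ∈ wordsEq d K,
          {z : EuclideanSpace ℝ (Fin d) | 1 / 2 ≤ ‖z‖}.indicator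
            (fun z => ‖wordDeriv v Ψ z‖ₑ) z) := by
      intro z
      rw [enorm_mul, Real.enorm_of_nonneg (by linarith), Real.enorm_of_nonneg
        (add_nonneg (hM₁0 z) (hM₂0 z)), ENNReal.ofReal_add (hM₁0 z) (hM₂0 z), hM₁, hM₂]
      simp only
      rw [ENNReal.ofReal_sum_of_nonneg fun _ _ => abs_nonneg _,
        ENNReal.ofReal_sum_of_nonneg fun _ _ => abs_nonneg _]
      congr 2
      · exact Finset.sum_congr rfl fun v _ => by rw [← Real.enorm_eq_ofReal_abs]
      · refine Finset.sum_congr rfl fun v _ => ?_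
        rw [← Real.enorm_eq_ofReal_abs, enorm_indicator_eq_indicator_enorm]
    simp only [e]
    rw [lintegral_const_mul' _ _ ENNReal.ofReal_ne_top, lintegral_add_left
      (Finset.measurable_fun_sum _ fun v _ => (hm v).enorm), lintegral_finsetSum _
      (fun v _ => (hm v).enorm), lintegral_finsetSum _ (fun v _ => (hm v).enorm.indicator hS)]
    calc _ ≤ ENNReal.ofReal D * (∑ v ∈ wordsLT d K, ENNReal.ofReal (2 * B₁ v * (2 ^ a)⁻¹) +
          ∑ v ∈ wordsEq d K, ENNReal.ofReal (4 * B₂ v * (2 ^ a)⁻¹)) := by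
          refine mul_le_mul_right (add_le_add (Finset.sum_le_sum fun v hv => ?_)
            (Finset.sum_le_sum fun v hv => ?_)) _
          · exact lintegral_wordDeriv_dyadicPotential_le hψ a N (mem_wordsLT.1 hv) (hB₁0 v) (hB₁ v)
          · rw [lintegral_indicator hS, hΨdef,
              wordDeriv_dyadicPotential_eq hψ a N (mem_wordsEq.1 hv)]
            exact setLIntegral_dyadicKernel_le (hψ.wordDeriv v).continuous (hB₂0 v) (hB₂ v) a N
      _ = ENNReal.ofReal (C₄ * (2 ^ a)⁻¹) := by
          have h1 : ∀ v, 0 ≤ 2 * B₁ v * ((2 : ℝ) ^ a)⁻¹ := fun v => by have := hB₁0 v; positivity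
          have h2 : ∀ v, 0 ≤ 4 * B₂ v * ((2 : ℝ) ^ a)⁻¹ := fun v => by have := hB₂0 v; positivity
          rw [← ENNReal.ofReal_sum_of_nonneg fun v _ => h1 v,
            ← ENNReal.ofReal_sum_of_nonneg fun v _ => h2 v,
            ← ENNReal.ofReal_add (Finset.sum_nonneg fun v _ => h1 v)
              (Finset.sum_nonneg fun v _ => h2 v), ← ENNReal.ofReal_mul (by linarith),
            ← Finset.sum_mul, ← Finset.sum_mul, ← add_mul, ← mul_assoc]
      _ ≤ _ := by
          refine ENNReal.ofReal_le_ofReal (mul_le_mul_of_nonneg_right (by linarith) (by positivity))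
  · show IsSingularKernel _ (wordDeriv v Ψ)
    rw [hΨdef, wordDeriv_dyadicPotential_eq hψ a N hv]
    refine (hB₃ v a N).mono ?_
    have := Finset.single_le_sum (f := B₃) (fun v _ => hB₃0 v) (mem_wordsEq.2 hv)
    linarith
  · have h1 := hB₄ v Ψ hΨ z
    rw [hv] at h1
    have h2 : |χ z * wordDeriv v Ψ z - wordDeriv v Ψ z| ≤ M₂ z := by
      refine le_trans ?_ (Finset.single_le_sum (f := fun v =>
        |{z : EuclideanSpace ℝ (Fin d) | 1 / 2 ≤ ‖z‖}.indicator (wordDeriv v Ψ) z|)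
        (fun v _ => abs_nonneg _) (mem_wordsEq.2 hv))
      by_cases hz : 1 / 2 ≤ ‖z‖
      · rw [Set.indicator_of_mem (show z ∈ {z | 1 / 2 ≤ ‖z‖} from hz), ← sub_one_mul, abs_mul]
        refine mul_le_of_le_one_left (abs_nonneg _) ?_
        rw [abs_le]
        constructor <;> linarith [(hχ01 z).1, (hχ01 z).2]
      · have : χ z = 1 := χ.one_of_mem_closedBall (by
          rw [mem_closedBall_zero_iff]; exact (not_le.1 hz).le)
        rw [this, one_mul, sub_self, abs_zero]
        exact abs_nonneg _
    have h3 := hBD v hv.le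
    calc _ ≤ |wordDeriv v (fun z => χ z * Ψ z) z - χ z * wordDeriv v Ψ z| +
          |χ z * wordDeriv v Ψ z - wordDeriv v Ψ z| := abs_sub_le _ _ _
      _ ≤ B₄ v * M₁ z + M₂ z := add_le_add h1 h2
      _ ≤ _ := by nlinarith [hM₁0 z, hM₂0 z]
  · have h1 := hB₄ v Ψ hΨ z
    have h2 : ∑ u ∈ wordsLT d v.length, |wordDeriv u Ψ z| ≤ M₁ z :=
      Finset.sum_le_sum_of_subset_of_nonneg
        (fun u hu => mem_wordsLT.2 ((mem_wordsLT.1 hu).trans hv)) fun _ _ _ => abs_nonneg _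
    have h3 : |χ z * wordDeriv v Ψ z| ≤ M₁ z := by
      refine le_trans ?_ (Finset.single_le_sum (f := fun v => |wordDeriv v Ψ z|)
        (fun v _ => abs_nonneg _) (mem_wordsLT.2 hv))
      rw [abs_mul, abs_of_nonneg (hχ01 z).1]
      exact mul_le_of_le_one_left (abs_nonneg _) (hχ01 z).2
    have h4 := hBD v hv.le
    have h5 := abs_sub_abs_le_abs_sub (wordDeriv v (fun z => χ z * Ψ z) z) (χ z * wordDeriv v Ψ z)
    have h6 : B₄ v * ∑ u ∈ wordsLT d v.length, |wordDeriv u Ψ z| ≤ B₄ v * M₁ z :=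
      mul_le_mul_of_nonneg_left h2 (hB₄0 v)
    nlinarith [hM₁0 z, hM₂0 z]
  · have hk : ∀ s, wordDeriv (w s) Ψ z = ∑ i ∈ Finset.Ico a N,
        dilation (2 ^ i) (wordDeriv (w s) ψ) z := fun s => by
      rw [hΨdef, wordDeriv_dyadicPotential_eq hψ a N (hw s), dyadicKernel]
    simp only [hk, Finset.mul_sum]
    rw [Finset.sum_comm, ← Finset.sum_Ico_sub (fun i => dilation (2 ^ i) η z) haN]
    refine Finset.sum_congr rfl fun i _ => ?_
    have := hpar ((2 : ℝ) ^ i • z)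
    simp only [dilation]
    calc _ = (2 ^ i) ^ d * ∑ s, c s * wordDeriv (w s) ψ ((2 : ℝ) ^ i • z) := by
          rw [Finset.mul_sum]
          exact Finset.sum_congr rfl fun s _ => by ring
      _ = _ := by
          rw [this, smul_smul, ← pow_succ', mul_sub, ← mul_assoc, ← mul_pow, ← pow_succ]

end Potential

section Mollifier

variable {d : ℕ}

/-- A Lipschitz cut-off equal to `1` on the ball of radius `1 / 2` and supported in the unit
ball. -/
noncomputable def tent (x : EuclideanSpace ℝ (Fin d)) : ℝ := max 0 (min 1 (2 - 2 * ‖x‖))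

theorem continuous_tent : Continuous (tent : EuclideanSpace ℝ (Fin d) → ℝ) := by
  unfold tent; fun_prop

theorem tent_nonneg (x : EuclideanSpace ℝ (Fin d)) : 0 ≤ tent x := le_max_left _ _

theorem tent_le_one (x : EuclideanSpace ℝ (Fin d)) : tent x ≤ 1 :=
  max_le zero_le_one (min_le_left _ _)

theorem tent_eq_one {x : EuclideanSpace ℝ (Fin d)} (hx : x ∈ closedBall 0 (1 / 2)) :
    tent x = 1 := by
  rw [mem_closedBall_zero_iff] at hx
  rw [tent, min_eq_left (by linarith), max_eq_right zero_le_one]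

theorem tent_eq_zero {x : EuclideanSpace ℝ (Fin d)} (hx : x ∉ ball 0 1) : tent x = 0 := by
  rw [mem_ball_zero_iff, not_lt] at hx
  exact max_eq_left ((min_le_right _ _).trans (by linarith))

theorem abs_tent_sub_le (x y : EuclideanSpace ℝ (Fin d)) : |tent x - tent y| ≤ 2 * ‖x - y‖ := by
  have h := abs_le.1 (abs_norm_sub_norm_le x y)
  have h0 := norm_nonneg (x - y)
  unfold tent
  generalize ‖x - y‖ = r at *
  generalize ‖x‖ = p at *
  generalize ‖y‖ = q at *
  rw [abs_le]
  constructor <;>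
  · rcases max_cases 0 (min 1 (2 - 2 * p)) with h1 | h1 <;>
    rcases max_cases 0 (min 1 (2 - 2 * q)) with h2 | h2 <;>
    rcases min_cases 1 (2 - 2 * p) with h3 | h3 <;>
    rcases min_cases 1 (2 - 2 * q) with h4 | h4 <;> linarith

theorem integral_dilation {c : ℝ} (hc : 0 < c) (η : EuclideanSpace ℝ (Fin d) → ℝ) :
    ∫ z, dilation c η z = ∫ z, η z := by
  unfold dilation
  rw [integral_const_mul, Measure.integral_comp_smul, finrank_euclideanSpace, Fintype.card_fin,
    abs_of_pos (by positivity), smul_eq_mul, mul_inv_cancel_left₀ (by positivity)]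

theorem integrable_dilation {c : ℝ} (hc : 0 < c) {η : EuclideanSpace ℝ (Fin d) → ℝ}
    (hη : Integrable η) : Integrable (dilation c η) :=
  (hη.comp_smul hc.ne').const_mul _

theorem lintegral_norm_mul_dilation {c : ℝ} (hc : 0 < c) {η : EuclideanSpace ℝ (Fin d) → ℝ}
    {C : ℝ} (hη : ∫⁻ z, ENNReal.ofReal ‖z‖ * ‖η z‖ₑ ≤ ENNReal.ofReal C) :
    ∫⁻ z, ENNReal.ofReal ‖z‖ * ‖dilation c η z‖ₑ ≤ ENNReal.ofReal (C * c⁻¹) := by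
  have e : ∀ z, ENNReal.ofReal ‖z‖ * ‖dilation c η z‖ₑ = ENNReal.ofReal (c ^ d) *
      (fun w => ENNReal.ofReal c⁻¹ * (ENNReal.ofReal ‖w‖ * ‖η w‖ₑ)) (c • z) := by
    intro z
    have h : ENNReal.ofReal ‖z‖ = ENNReal.ofReal c⁻¹ * ENNReal.ofReal ‖c • z‖ := by
      rw [← ENNReal.ofReal_mul (by positivity), norm_smul, Real.norm_of_nonneg hc.le,
        inv_mul_cancel_left₀ hc.ne']
    rw [enorm_dilation hc, h]
    ring
  rw [(lintegral_congr e).trans (lintegral_scaled_comp_smul hc fun w =>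
    ENNReal.ofReal c⁻¹ * (ENNReal.ofReal ‖w‖ * ‖η w‖ₑ)),
    lintegral_const_mul' _ _ ENNReal.ofReal_ne_top,
    mul_comm C, ENNReal.ofReal_mul (by positivity)]
  exact mul_le_mul_right hη _

/-- A mollified measure has most of its mass where the measure has. -/
theorem measure_closedBall_le_lintegral_dilation {η : EuclideanSpace ℝ (Fin d) → ℝ} {C : ℝ}
    (hC : 0 ≤ C) (hc : Continuous η) (hi : Integrable η) (h1 : ∫ z, η z = 1)
    (hb : ∀ z, |η z| ≤ C) (hm : ∫⁻ z, ENNReal.ofReal ‖z‖ * ‖η z‖ₑ ≤ ENNReal.ofReal C)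
    (ν : Measure (EuclideanSpace ℝ (Fin d))) [IsFiniteMeasure ν] {c : ℝ} (hc0 : 0 < c) :
    ν (closedBall 0 (1 / 2)) ≤ (∫⁻ x in ball 0 1, ‖∫ y, dilation c η (y - x) ∂ν‖ₑ) +
      ENNReal.ofReal (2 * C * c⁻¹) * ν Set.univ := by
  have hct := continuous_dilation hc c
  have hdi := integrable_dilation hc0 hi
  have htr : ∀ y, Integrable fun x => dilation c η (y - x) := fun y => hdi.comp_sub_left y
  have hgi : ∀ y, Integrable fun x => tent x * dilation c η (y - x) := fun y =>
    (htr y).bdd_mul (c := 1) continuous_tent.aestronglyMeasurable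
      (Filter.Eventually.of_forall fun x => by
        rw [Real.norm_of_nonneg (tent_nonneg x)]; exact tent_le_one x)
  have hy : ∀ y, tent y ≤ (∫ x in ball 0 1, tent x * dilation c η (y - x)) + 2 * C * c⁻¹ := by
    intro y
    rw [setIntegral_eq_integral_of_forall_compl_eq_zero fun x hx => by
      rw [tent_eq_zero hx, zero_mul]]
    have e1 : ∫ x, dilation c η (y - x) = 1 := by
      rw [integral_sub_left_eq_self (fun z => dilation c η z), integral_dilation hc0, h1]
    have e2 : tent y - ∫ x, tent x * dilation c η (y - x) =
        ∫ x, (tent y - tent x) * dilation c η (y - x) := by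
      simp only [sub_mul]
      rw [integral_sub ((htr y).const_mul _) (hgi y), integral_const_mul, e1, mul_one]
    have e3 : ‖∫ x, (tent y - tent x) * dilation c η (y - x)‖ₑ ≤
        ENNReal.ofReal (2 * C * c⁻¹) := by
      refine (enorm_integral_le_lintegral_enorm _).trans ?_
      calc ∫⁻ x, ‖(tent y - tent x) * dilation c η (y - x)‖ₑ
          ≤ ∫⁻ x, ENNReal.ofReal 2 * (ENNReal.ofReal ‖y - x‖ * ‖dilation c η (y - x)‖ₑ) := by
            refine lintegral_mono fun x => ?_
            rw [enorm_mul, ← mul_assoc, ← ENNReal.ofReal_mul zero_le_two]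
            gcongr
            rw [Real.enorm_eq_ofReal_abs]
            exact ENNReal.ofReal_le_ofReal (abs_tent_sub_le y x)
        _ ≤ _ := by
            rw [lintegral_const_mul' _ _ ENNReal.ofReal_ne_top,
              lintegral_sub_left_eq_self (fun z => ENNReal.ofReal ‖z‖ * ‖dilation c η z‖ₑ),
              mul_assoc, ENNReal.ofReal_mul zero_le_two]
            exact mul_le_mul_right (lintegral_norm_mul_dilation hc0 hm) _
    rw [← e2, Real.enorm_eq_ofReal_abs, ENNReal.ofReal_le_ofReal_iff (by positivity)] at e3
    linarith [le_abs_self (tent y - ∫ x, tent x * dilation c η (y - x))]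
  have hbd : ∀ z, |dilation c η z| ≤ c ^ d * C := fun z => by
    rw [dilation, abs_mul, abs_of_nonneg (by positivity : (0:ℝ) ≤ c ^ d)]
    exact mul_le_mul_of_nonneg_left (hb _) (by positivity)
  have : IsFiniteMeasure ((volume : Measure (EuclideanSpace ℝ (Fin d))).restrict (ball 0 1)) :=
    ⟨by rw [Measure.restrict_apply_univ]; exact measure_ball_lt_top⟩
  have hprod : Integrable (fun p : EuclideanSpace ℝ (Fin d) × EuclideanSpace ℝ (Fin d) =>
      tent p.2 * dilation c η (p.1 - p.2)) (ν.prod (volume.restrict (ball 0 1))) := by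
    refine Integrable.of_bound (C := 1 * (c ^ d * C)) ?_ (Filter.Eventually.of_forall fun p => ?_)
    · have := continuous_tent (d := d)
      exact Continuous.aestronglyMeasurable (by fun_prop)
    · rw [norm_mul]
      refine mul_le_mul ?_ (hbd _) (norm_nonneg _) zero_le_one
      rw [Real.norm_of_nonneg (tent_nonneg _)]
      exact tent_le_one _
  have hti : Integrable tent ν :=
    Integrable.of_bound (C := 1) continuous_tent.aestronglyMeasurable
      (Filter.Eventually.of_forall fun x => by
        rw [Real.norm_of_nonneg (tent_nonneg x)]; exact tent_le_one x)
  have hI : ∫ y, tent y ∂ν ≤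
      (∫ x in ball 0 1, tent x * ∫ y, dilation c η (y - x) ∂ν) + 2 * C * c⁻¹ * ν.real Set.univ := by
    calc ∫ y, tent y ∂ν
        ≤ ∫ y, ((∫ x in ball 0 1, tent x * dilation c η (y - x)) + 2 * C * c⁻¹) ∂ν :=
          integral_mono hti (hprod.integral_prod_left.add (integrable_const _)) hy
      _ = _ := by
          rw [integral_add hprod.integral_prod_left (integrable_const _),
            integral_integral_swap hprod]
          simp only [integral_const_mul, integral_const, smul_eq_mul]
          ring
  calc ν (closedBall 0 (1 / 2)) = ∫⁻ y in closedBall 0 (1 / 2), 1 ∂ν := by simp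
    _ ≤ ∫⁻ y in closedBall 0 (1 / 2), ENNReal.ofReal (tent y) ∂ν :=
        setLIntegral_mono' measurableSet_closedBall fun y hy => by simp [tent_eq_one hy]
    _ ≤ ∫⁻ y, ENNReal.ofReal (tent y) ∂ν := setLIntegral_le_lintegral _ _
    _ = ENNReal.ofReal (∫ y, tent y ∂ν) :=
        (ofReal_integral_eq_lintegral_ofReal hti (Filter.Eventually.of_forall tent_nonneg)).symm
    _ ≤ ENNReal.ofReal (∫ x in ball 0 1, tent x * ∫ y, dilation c η (y - x) ∂ν) +
          ENNReal.ofReal (2 * C * c⁻¹ * ν.real Set.univ) :=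
        (ENNReal.ofReal_le_ofReal hI).trans ENNReal.ofReal_add_le
    _ ≤ _ := by
        rw [ENNReal.ofReal_mul (by positivity), ofReal_measureReal]
        refine add_le_add ?_ le_rfl
        refine (ENNReal.ofReal_le_ofReal (le_abs_self _)).trans ?_
        rw [← Real.enorm_eq_ofReal_abs]
        refine (enorm_integral_le_lintegral_enorm _).trans (lintegral_mono fun x => ?_)
        rw [enorm_mul]
        refine mul_le_of_le_one_left zero_le ?_
        rw [Real.enorm_eq_ofReal_abs, abs_of_nonneg (tent_nonneg x), ENNReal.ofReal_le_one]
        exact tent_le_one x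

/-- Far from the support of a measure, its mollification at scale `c⁻¹` is small. -/
theorem enorm_integral_dilation_le_of_notMem_cthickening {η : EuclideanSpace ℝ (Fin d) → ℝ} {C : ℝ}
    (hb : ∀ z, ‖z‖ ^ (d + 1) * |η z| ≤ C)
    (ν : Measure (EuclideanSpace ℝ (Fin d))) {S : Set (EuclideanSpace ℝ (Fin d))}
    {c s : ℝ} (hc : 0 < c) (hs : 0 < s) {x : EuclideanSpace ℝ (Fin d)}
    (hx : x ∉ cthickening s S) (hS : MeasurableSet S) :
    ‖∫ y in S, dilation c η (y - x) ∂ν‖ₑ ≤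
      ENNReal.ofReal (C * (s ^ (d + 1))⁻¹ * c⁻¹) * ν Set.univ := by
  have hz : ∀ y ∈ S, ‖dilation c η (y - x)‖ₑ ≤ ENNReal.ofReal (C * (s ^ (d + 1))⁻¹ * c⁻¹) := by
    intro y hy
    have hsy : s ≤ ‖y - x‖ := by
      by_contra h
      refine hx (mem_cthickening_of_dist_le x y s S hy ?_)
      rw [dist_comm, dist_eq_norm]
      exact (not_le.1 h).le
    rw [Real.enorm_eq_ofReal_abs]
    refine ENNReal.ofReal_le_ofReal ?_
    rw [dilation, abs_mul, abs_of_nonneg (by positivity : (0:ℝ) ≤ c ^ d), mul_assoc, ← mul_inv,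
      ← div_eq_mul_inv, le_div_iff₀ (by positivity)]
    have h := hb (c • (y - x))
    rw [norm_smul, Real.norm_of_nonneg hc.le, mul_pow] at h
    calc c ^ d * |η (c • (y - x))| * (s ^ (d + 1) * c)
        = c ^ (d + 1) * s ^ (d + 1) * |η (c • (y - x))| := by ring
      _ ≤ c ^ (d + 1) * ‖y - x‖ ^ (d + 1) * |η (c • (y - x))| := by gcongr
      _ ≤ C := h
  calc _ ≤ ∫⁻ y in S, ‖dilation c η (y - x)‖ₑ ∂ν := enorm_integral_le_lintegral_enorm _
    _ ≤ ∫⁻ y in S, ENNReal.ofReal (C * (s ^ (d + 1))⁻¹ * c⁻¹) ∂ν := setLIntegral_mono' hS hz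
    _ ≤ ∫⁻ y, ENNReal.ofReal (C * (s ^ (d + 1))⁻¹ * c⁻¹) ∂ν := setLIntegral_le_lintegral _ _
    _ = _ := lintegral_const _

theorem enorm_integral_dilation_le {η : EuclideanSpace ℝ (Fin d) → ℝ} {C : ℝ}
    (hb : ∀ z, |η z| ≤ C) (ν : Measure (EuclideanSpace ℝ (Fin d))) {c : ℝ} (hc : 0 < c)
    (x : EuclideanSpace ℝ (Fin d)) :
    ‖∫ y, dilation c η (y - x) ∂ν‖ₑ ≤ ENNReal.ofReal (C * c ^ d) * ν Set.univ := by
  refine (enorm_integral_le_lintegral_enorm _).trans ?_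
  rw [← lintegral_const]
  refine lintegral_mono fun y => ?_
  rw [Real.enorm_eq_ofReal_abs, dilation, abs_mul, abs_of_nonneg (by positivity : (0:ℝ) ≤ c ^ d),
    mul_comm C]
  exact ENNReal.ofReal_le_ofReal (mul_le_mul_of_nonneg_left (hb _) (by positivity))

end Mollifier

section Perturbation

variable {d m : ℕ}

theorem lintegral_lintegral_enorm_sub {M : EuclideanSpace ℝ (Fin d) → ℝ} (hM : Measurable M)
    (ρ : Measure (EuclideanSpace ℝ (Fin d))) [IsFiniteMeasure ρ] :
    ∫⁻ x, (∫⁻ y, ‖M (y - x)‖ₑ ∂ρ) = (∫⁻ z, ‖M z‖ₑ) * ρ Set.univ := by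
  rw [lintegral_lintegral_swap]
  · simp only [lintegral_sub_left_eq_self (fun z => ‖M z‖ₑ)]
    rw [lintegral_const]
  · exact (hM.comp (measurable_snd.sub measurable_fst)).enorm.aemeasurable

theorem EuclideanSpace.enorm_apply_le (v : EuclideanSpace ℝ (Fin m)) (j : Fin m) :
    ‖v j‖ₑ ≤ ‖v‖ₑ := by
  rw [← ofReal_norm, ← ofReal_norm]
  exact ENNReal.ofReal_le_ofReal (PiLp.norm_apply_le v j)

/-- The weak estimate for vector-valued densities of small mass. -/
theorem IsSingularKernel.setLIntegral_ball_le (hd : d ≠ 0) {C : ℝ} (hC : 0 ≤ C)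
    {K : EuclideanSpace ℝ (Fin d) → ℝ} (hK : IsSingularKernel C K)
    (ρ : Measure (EuclideanSpace ℝ (Fin d))) {r ε : ℝ} (hr : 0 < r)
    (hε : 0 ≤ ε) {e : EuclideanSpace ℝ (Fin d) → EuclideanSpace ℝ (Fin m)} (he : Measurable e)
    (hm : ∫⁻ y, ‖e y‖ₑ ∂ρ ≤ ENNReal.ofReal (ε * r)) (j : Fin m) :
    ∫⁻ x in ball 0 1 ∩ (maximalSet (ρ.withDensity fun y => ‖e y‖ₑ) r)ᶜ,
        ‖∫ y, K (y - x) * e y j ∂ρ‖ₑ ≤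
      ENNReal.ofReal ((C * √(8 ^ d * ε) + (C + 1) * ε) * r) := by
  set θ := ρ.withDensity fun y => ‖e y‖ₑ with hθ
  have hθu : θ Set.univ ≤ ENNReal.ofReal (ε * r) := by
    rw [hθ, withDensity_apply _ MeasurableSet.univ, Measure.restrict_univ]
    exact hm
  have : IsFiniteMeasure θ := ⟨hθu.trans_lt ENNReal.ofReal_lt_top⟩
  have hej : Measurable fun y => e y j := by fun_prop
  have hh : Measurable fun y => e y j / ‖e y‖ := hej.div he.norm
  have hh1 : ∀ y, |e y j / ‖e y‖| ≤ 1 := fun y => by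
    rw [abs_div, abs_norm]
    exact div_le_one_of_le₀ (PiLp.norm_apply_le (e y) j) (norm_nonneg _)
  have hI : ∀ x, ∫ y, K (y - x) * e y j ∂ρ = ∫ y, K (y - x) * (e y j / ‖e y‖) ∂θ := by
    intro x
    have := integral_withDensity_eq_integral_smul (μ := ρ) (f := fun y => ‖e y‖₊) he.nnnorm
      (fun y => K (y - x) * (e y j / ‖e y‖))
    rw [hθ]
    refine Eq.trans (integral_congr_ae (Filter.Eventually.of_forall fun y => ?_)) this.symm
    simp only [NNReal.smul_def, coe_nnnorm, smul_eq_mul]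
    rcases eq_or_ne (e y) 0 with h | h
    · simp [h]
    · have := norm_ne_zero_iff.2 h
      field_simp
  simp only [hI]
  refine (hK.setLIntegral_le hd hC θ hr hh hh1 (ball 0 1)).trans ?_
  have hc := unitBallVolume_pos (d := d)
  obtain ⟨C', hC'⟩ : ∃ C', C' = C + 1 := ⟨_, rfl⟩
  have hC0 : 0 ≤ C' := by linarith
  rw [← hC', volume_ball_eq hd 0 zero_le_one, one_pow, mul_one, add_mul,
    ENNReal.ofReal_add (by positivity) (by positivity), mul_assoc C',
    ENNReal.ofReal_mul hC0, mul_assoc C, ENNReal.ofReal_mul hC,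
    mul_assoc (ENNReal.ofReal C)]
  refine add_le_add (mul_le_mul_right ?_ _) (mul_le_mul_right hθu _)
  calc _ ≤ (ENNReal.ofReal (8 ^ d / unitBallVolume d * r) * ENNReal.ofReal (ε * r)) ^ (1 / 2 : ℝ) *
        ENNReal.ofReal (unitBallVolume d) ^ (1 / 2 : ℝ) := by gcongr
    _ = ENNReal.ofReal (√(8 ^ d * ε) * r) := by
      rw [← ENNReal.mul_rpow_of_nonneg _ _ (by norm_num), ← ENNReal.ofReal_mul (by positivity),
        ← ENNReal.ofReal_mul (by positivity), ENNReal.ofReal_rpow_of_nonneg (by positivity)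
        (by norm_num), ← Real.sqrt_eq_rpow]
      congr 1
      rw [← Real.sqrt_sq hr.le, ← Real.sqrt_mul (by positivity), Real.sqrt_sq hr.le]
      congr 1
      field_simp
    _ ≤ _ := le_rfl

/-- The error made in an equation when the density is replaced by a constant on a set and the
coefficients are perturbed. -/
theorem enorm_setIntegral_le_of_sum_integral_eq_zero {X ι ι' : Type*} [MeasurableSpace X]
    [Fintype ι] [Fintype ι']
    (ρ : Measure X) [IsFiniteMeasure ρ] {f : X → EuclideanSpace ℝ (Fin m)} (hf : Measurable f)
    (hf1 : ∀ᵐ x ∂ρ, ‖f x‖ = 1) {S : Set X} (hS : MeasurableSet S) (P : EuclideanSpace ℝ (Fin m))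
    (a : ι → ℝ) (j : ι → Fin m) (b : ι' → ℝ) (j' : ι' → Fin m)
    {u D : ι → X → ℝ} {D' : ι' → X → ℝ} {g₁ g₂ M : X → ℝ}
    (hu : ∀ s, Measurable (u s)) (hub : ∀ s, ∃ B, ∀ x, |u s x| ≤ B)
    (hD : ∀ s, Measurable (D s)) (hDb : ∀ s, ∃ B, ∀ x, |D s x| ≤ B)
    (hg₁ : IntegrableOn g₁ S ρ) (hg₂ : IntegrableOn g₂ S ρ)
    (hDu : ∀ s x, |D s x - u s x| ≤ M x) (hD' : ∀ s x, |D' s x| ≤ M x)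
    (hug : ∀ x, ∑ s, a s * P (j s) * u s x = g₂ x - g₁ x)
    (h : ∑ s, a s * ∫ x, D s x * f x (j s) ∂ρ + ∑ s, b s * ∫ x, D' s x * f x (j' s) ∂ρ = 0) :
    ‖∫ x in S, g₁ x ∂ρ‖ₑ ≤ ‖∫ x in S, g₂ x ∂ρ‖ₑ +
      (∑ s, ‖a s‖ₑ * ‖∫ x, u s x * (f x - S.indicator (fun _ => P) x) (j s) ∂ρ‖ₑ) +
      (∑ s, ‖a s‖ₑ + ∑ s, ‖b s‖ₑ) * ∫⁻ x, ‖M x‖ₑ ∂ρ := by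
  have hfj : ∀ j, Measurable fun x => f x j := fun j => by fun_prop
  have hfi : ∀ j, Integrable (fun x => f x j) ρ := fun j =>
    Integrable.of_bound (C := 1) (hfj j).aestronglyMeasurable (hf1.mono fun x hx =>
      (PiLp.norm_apply_le _ j).trans hx.le)
  have hbd : ∀ {g v : X → ℝ}, Measurable g → (∃ B, ∀ x, |g x| ≤ B) → Integrable v ρ →
      Integrable (fun x => g x * v x) ρ := by
    rintro g v hg ⟨B, hB⟩ hv
    exact hv.bdd_mul (c := B) hg.aestronglyMeasurable (Filter.Eventually.of_forall hB)
  have hSi : ∀ j, Integrable (fun x => S.indicator (fun _ => P j) x) ρ := fun j =>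
    (integrable_const _).indicator hS
  have hind : ∀ j x, (S.indicator (fun _ => P) x) j = S.indicator (fun _ => P j) x := by
    intro j x
    by_cases hx : x ∈ S <;> simp [hx]
  have hui : ∀ s, Integrable (u s) ρ := fun s => by
    simpa using hbd (hu s) (hub s) (integrable_const (1 : ℝ))
  have e1 : ∫ x in S, g₂ x ∂ρ - ∫ x in S, g₁ x ∂ρ =
      ∑ s, a s * ∫ x, u s x * S.indicator (fun _ => P (j s)) x ∂ρ := by
    rw [← integral_sub hg₂ hg₁]
    simp only [← hug]
    rw [integral_finsetSum _ fun s _ => ((hui s).integrableOn.const_mul _)]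
    refine Finset.sum_congr rfl fun s _ => ?_
    rw [integral_const_mul, mul_assoc, ← integral_const_mul, ← integral_indicator hS]
    congr 2
    funext x
    by_cases hx : x ∈ S <;> simp [hx, mul_comm]
  have e2 : ∀ s, ∫ x, u s x * (f x - S.indicator (fun _ => P) x) (j s) ∂ρ =
      ∫ x, u s x * f x (j s) ∂ρ - ∫ x, u s x * S.indicator (fun _ => P (j s)) x ∂ρ := by
    intro s
    rw [← integral_sub (hbd (hu s) (hub s) (hfi _)) (hbd (hu s) (hub s) (hSi _))]
    refine integral_congr_ae (Filter.Eventually.of_forall fun x => ?_)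
    simp only [PiLp.sub_apply, hind, mul_sub]
  have e3 : ∀ s, ∫ x, (D s x - u s x) * f x (j s) ∂ρ =
      ∫ x, D s x * f x (j s) ∂ρ - ∫ x, u s x * f x (j s) ∂ρ := by
    intro s
    rw [← integral_sub (hbd (hD s) (hDb s) (hfi _)) (hbd (hu s) (hub s) (hfi _))]
    simp only [sub_mul]
  have e4 : ∫ x in S, g₁ x ∂ρ = ∫ x in S, g₂ x ∂ρ +
      ∑ s, a s * ∫ x, u s x * (f x - S.indicator (fun _ => P) x) (j s) ∂ρ +
      (∑ s, a s * ∫ x, (D s x - u s x) * f x (j s) ∂ρ +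
        ∑ s, b s * ∫ x, D' s x * f x (j' s) ∂ρ) := by
    simp only [e2, e3, mul_sub, Finset.sum_sub_distrib]
    linarith
  have hM : ∀ {v : X → ℝ} (j), (∀ x, |v x| ≤ M x) →
      ‖∫ x, v x * f x j ∂ρ‖ₑ ≤ ∫⁻ x, ‖M x‖ₑ ∂ρ := by
    intro v j hv
    refine (enorm_integral_le_lintegral_enorm _).trans (lintegral_mono_ae (hf1.mono fun x hx => ?_))
    rw [enorm_mul]
    refine (mul_le_of_le_one_right' ?_).trans ?_
    · refine (EuclideanSpace.enorm_apply_le _ _).trans ?_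
      rw [← ofReal_norm, hx, ENNReal.ofReal_one]
    · rw [Real.enorm_eq_ofReal_abs, Real.enorm_eq_ofReal_abs]
      exact ENNReal.ofReal_le_ofReal ((hv x).trans (le_abs_self _))
  rw [e4]
  refine (enorm_add_le _ _).trans (add_le_add ((enorm_add_le _ _).trans (add_le_add le_rfl ?_)) ?_)
  · refine (enorm_sum_le _ _).trans_eq ?_
    simp only [enorm_mul]
  · rw [add_mul, Finset.sum_mul, Finset.sum_mul]
    refine (enorm_add_le _ _).trans (add_le_add ?_ ?_) <;>
    · refine (enorm_sum_le _ _).trans (Finset.sum_le_sum fun s _ => ?_)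
      rw [enorm_mul]
      exact mul_le_mul_right (hM _ (by first | exact hDu s | exact hD' s)) _

end Perturbation

section Concentration

variable {d m : ℕ}

theorem sum_enorm_eq_ofReal {ι : Type*} [Fintype ι] (a : ι → ℝ) :
    ∑ i, ‖a i‖ₑ = ENNReal.ofReal (∑ i, |a i|) := by
  rw [ENNReal.ofReal_sum_of_nonneg fun _ _ => abs_nonneg _]
  exact Finset.sum_congr rfl fun i _ => Real.enorm_eq_ofReal_abs _

/-- An upper bound for the mollification of a measure that satisfies, up to small errors, an
elliptic equation. -/
theorem setLIntegral_mollification_le {ι ι' : Type*} [Fintype ι] [Fintype ι'] (hd : d ≠ 0)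
    (ρ : Measure (EuclideanSpace ℝ (Fin d))) [IsFiniteMeasure ρ] {r ε C δ s c₁ c₂ b₀ : ℝ}
    (hr : 0 < r) (hε : 0 ≤ ε) (hC : 0 ≤ C) (hδ : 0 ≤ δ) (hs : 0 < s) (hc₁ : 0 < c₁) (hc₂ : 0 < c₂)
    (hρ : ρ Set.univ = ENNReal.ofReal r)
    {f : EuclideanSpace ℝ (Fin d) → EuclideanSpace ℝ (Fin m)} (hf : Measurable f)
    (hf1 : ∀ᵐ x ∂ρ, ‖f x‖ = 1) {S : Set (EuclideanSpace ℝ (Fin d))} (hS : MeasurableSet S)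
    (hSv : volume (cthickening s S) ≤ ENNReal.ofReal ε) (P : EuclideanSpace ℝ (Fin m))
    (a : ι → ℝ) (j : ι → Fin m) (b : ι' → ℝ) (j' : ι' → Fin m)
    (hb : ∑ i, |b i| ≤ b₀)
    {η M : EuclideanSpace ℝ (Fin d) → ℝ} {κ D : ι → EuclideanSpace ℝ (Fin d) → ℝ}
    {D' : ι' → EuclideanSpace ℝ (Fin d) → ℝ}
    (hη : Continuous η) (hηb : ∀ z, |η z| ≤ C) (hηd : ∀ z, ‖z‖ ^ (d + 1) * |η z| ≤ C)
    (hM : Measurable M) (hMi : ∫⁻ z, ‖M z‖ₑ ≤ ENNReal.ofReal δ)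
    (hκ : ∀ i, IsSingularKernel C (κ i))
    (hD : ∀ i, Measurable (D i)) (hDb : ∀ i, ∃ B, ∀ x, |D i x| ≤ B)
    (hDκ : ∀ i x, |D i x - κ i x| ≤ M x) (hD' : ∀ i x, |D' i x| ≤ M x)
    (hug : ∀ x, ∑ i, a i * P (j i) * κ i x = dilation c₂ η x - dilation c₁ η x)
    (h : ∀ x ∈ ball 0 1, ∑ i, a i * ∫ y, D i (y - x) * f y (j i) ∂ρ +
      ∑ i, b i * ∫ y, D' i (y - x) * f y (j' i) ∂ρ = 0)
    (he : ∫⁻ y, ‖f y - S.indicator (fun _ => P) y‖ₑ ∂ρ ≤ ENNReal.ofReal (ε * r)) :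
    ∫⁻ x in ball 0 1, ‖∫ y in S, dilation c₁ η (y - x) ∂ρ‖ₑ ≤
      ENNReal.ofReal ((C * c₁ ^ d * (unitBallVolume d * 5 ^ d + 1) * ε +
        C * (s ^ (d + 1))⁻¹ * c₂⁻¹ * unitBallVolume d +
        (∑ i, |a i|) * (C * √(8 ^ d * ε) + (C + 1) * ε) + (∑ i, |a i| + b₀) * δ) * r) := by
  have hb0 : 0 ≤ b₀ := (Finset.sum_nonneg fun _ _ => abs_nonneg _).trans hb
  have ha0 : 0 ≤ ∑ i, |a i| := Finset.sum_nonneg fun _ _ => abs_nonneg _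
  have hv := unitBallVolume_pos (d := d)
  set e : EuclideanSpace ℝ (Fin d) → EuclideanSpace ℝ (Fin m) :=
    fun y => f y - S.indicator (fun _ => P) y with hedef
  have hem : Measurable e := hf.sub (measurable_const.indicator hS)
  set θ := ρ.withDensity fun y => ‖e y‖ₑ with hθ
  have hθu : θ Set.univ ≤ ENNReal.ofReal (ε * r) := by
    rw [hθ, withDensity_apply _ MeasurableSet.univ, Measure.restrict_univ]
    exact he
  have : IsFiniteMeasure θ := ⟨hθu.trans_lt ENNReal.ofReal_lt_top⟩
  set Z := maximalSet θ r ∪ cthickening s S with hZ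
  have hZm : MeasurableSet Z :=
    (isOpen_maximalSet θ r).measurableSet.union isClosed_cthickening.measurableSet
  have hZv : volume Z ≤ ENNReal.ofReal ((unitBallVolume d * 5 ^ d + 1) * ε) := by
    refine (measure_union_le _ _).trans ((add_le_add (volume_maximalSet_le hd θ hr) hSv).trans ?_)
    rw [add_mul, one_mul, ENNReal.ofReal_add (by positivity) hε]
    refine add_le_add ((mul_le_mul_right hθu _).trans_eq ?_) le_rfl
    rw [← ENNReal.ofReal_mul (by positivity)]
    congr 1
    field_simp
  have hd₁ : ∀ (c : ℝ), 0 < c → ∀ x, IntegrableOn (fun y => dilation c η (y - x)) S ρ := by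
    intro c hc x
    refine Integrable.integrableOn (Integrable.of_bound (C := c ^ d * C) ?_
      (Filter.Eventually.of_forall fun y => ?_))
    · have := continuous_dilation hη c
      exact Continuous.aestronglyMeasurable (by fun_prop)
    · rw [Real.norm_eq_abs, dilation, abs_mul, abs_of_nonneg (by positivity : (0 : ℝ) ≤ c ^ d)]
      exact mul_le_mul_of_nonneg_left (hηb _) (by positivity)
  have hin : ∫⁻ x in ball 0 1 ∩ Z, ‖∫ y in S, dilation c₁ η (y - x) ∂ρ‖ₑ ≤
      ENNReal.ofReal (C * c₁ ^ d * (unitBallVolume d * 5 ^ d + 1) * ε * r) := by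
    calc _ ≤ ∫⁻ x in Z, ENNReal.ofReal (C * c₁ ^ d) * ρ Set.univ := by
          refine (lintegral_mono_set Set.inter_subset_right).trans (lintegral_mono fun x => ?_)
          refine (enorm_integral_dilation_le hηb _ hc₁ x).trans (mul_le_mul_right ?_ _)
          rw [Measure.restrict_apply_univ]
          exact measure_mono (Set.subset_univ _)
      _ ≤ ENNReal.ofReal (C * c₁ ^ d) * ENNReal.ofReal r *
          ENNReal.ofReal ((unitBallVolume d * 5 ^ d + 1) * ε) := by
          rw [setLIntegral_const, hρ]
          exact mul_le_mul_right hZv _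
      _ = _ := by
          rw [← ENNReal.ofReal_mul (by positivity), ← ENNReal.ofReal_mul (by positivity)]
          congr 1
          ring
  have hmT : ∀ i, Measurable fun x => ‖∫ y, κ i (y - x) * e y (j i) ∂ρ‖ₑ := by
    intro i
    refine StronglyMeasurable.enorm ?_
    refine StronglyMeasurable.integral_prod_right'
      (f := fun p : EuclideanSpace ℝ (Fin d) × EuclideanSpace ℝ (Fin d) =>
        κ i (p.2 - p.1) * e p.2 (j i)) ?_
    have h1 : Measurable fun y => e y (j i) := by fun_prop
    exact (((hκ i).continuous.measurable.comp (measurable_snd.sub measurable_fst)).mul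
      (h1.comp measurable_snd)).stronglyMeasurable
  have hmM : Measurable fun x => ∫⁻ y, ‖M (y - x)‖ₑ ∂ρ :=
    Measurable.lintegral_prod_right'
      (f := fun p : EuclideanSpace ℝ (Fin d) × EuclideanSpace ℝ (Fin d) => ‖M (p.2 - p.1)‖ₑ)
      (hM.comp (measurable_snd.sub measurable_fst)).enorm
  have hpt : ∀ x ∈ ball 0 1 \ Z, ‖∫ y in S, dilation c₁ η (y - x) ∂ρ‖ₑ ≤
      ENNReal.ofReal (C * (s ^ (d + 1))⁻¹ * c₂⁻¹ * r) +
      ∑ i, ‖a i‖ₑ * ‖∫ y, κ i (y - x) * e y (j i) ∂ρ‖ₑ +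
      ENNReal.ofReal (∑ i, |a i| + b₀) * ∫⁻ y, ‖M (y - x)‖ₑ ∂ρ := by
    rintro x ⟨hx, hxZ⟩
    rw [hZ, Set.mem_union, not_or] at hxZ
    have h1 := enorm_setIntegral_le_of_sum_integral_eq_zero ρ hf hf1 hS P a j b j'
      (u := fun i y => κ i (y - x)) (D := fun i y => D i (y - x)) (D' := fun i y => D' i (y - x))
      (g₁ := fun y => dilation c₁ η (y - x)) (g₂ := fun y => dilation c₂ η (y - x))
      (M := fun y => M (y - x))
      (fun i => (hκ i).continuous.measurable.comp (measurable_id.sub_const x))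
      (fun i => (hκ i).bounded.imp fun B hB y => hB _)
      (fun i => (hD i).comp (measurable_id.sub_const x))
      (fun i => (hDb i).imp fun B hB y => hB _) (hd₁ c₁ hc₁ x) (hd₁ c₂ hc₂ x)
      (fun i y => hDκ i _) (fun i y => hD' i _) (fun y => hug _) (h x hx)
    refine h1.trans (add_le_add (add_le_add ?_ le_rfl) (mul_le_mul_left ?_ _))
    · refine (enorm_integral_dilation_le_of_notMem_cthickening hηd ρ hc₂ hs hxZ.2 hS).trans ?_
      rw [hρ, ← ENNReal.ofReal_mul (by positivity)]
    · rw [sum_enorm_eq_ofReal, sum_enorm_eq_ofReal,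
          ← ENNReal.ofReal_add ha0 (Finset.sum_nonneg fun _ _ => abs_nonneg _)]
      exact ENNReal.ofReal_le_ofReal (by linarith)
  have hout : ∫⁻ x in ball 0 1 \ Z, ‖∫ y in S, dilation c₁ η (y - x) ∂ρ‖ₑ ≤
      ENNReal.ofReal (C * (s ^ (d + 1))⁻¹ * c₂⁻¹ * unitBallVolume d * r) +
      ENNReal.ofReal ((∑ i, |a i|) * ((C * √(8 ^ d * ε) + (C + 1) * ε) * r)) +
      ENNReal.ofReal ((∑ i, |a i| + b₀) * (δ * r)) := by
    refine (setLIntegral_mono' (measurableSet_ball.diff hZm) hpt).trans ?_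
    rw [lintegral_add_right _ (hmM.const_mul _), lintegral_add_left measurable_const,
      lintegral_finsetSum _ fun i _ => (hmT i).const_mul _]
    refine add_le_add (add_le_add ?_ ?_) ?_
    · rw [setLIntegral_const]
      refine (mul_le_mul_right (measure_mono Set.sdiff_subset) _).trans_eq ?_
      rw [volume_ball_eq hd 0 zero_le_one, one_pow, mul_one, ← ENNReal.ofReal_mul (by positivity)]
      congr 1
      ring
    · rw [ENNReal.ofReal_mul ha0, ← sum_enorm_eq_ofReal, Finset.sum_mul]
      refine Finset.sum_le_sum fun i _ => ?_
      rw [lintegral_const_mul _ (hmT i)]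
      refine mul_le_mul_right ?_ _
      refine (lintegral_mono_set ?_).trans ((hκ i).setLIntegral_ball_le hd hC ρ hr hε hem he (j i))
      exact fun x hx => ⟨hx.1, fun h' => hx.2 (Or.inl h')⟩
    · rw [lintegral_const_mul _ hmM, ENNReal.ofReal_mul (by positivity)]
      refine mul_le_mul_right ((setLIntegral_le_lintegral _ _).trans ?_) _
      rw [lintegral_lintegral_enorm_sub hM, hρ, ENNReal.ofReal_mul hδ]
      exact mul_le_mul_left hMi _
  rw [← lintegral_inter_add_sdiff _ _ hZm]
  refine (add_le_add hin hout).trans_eq ?_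
  rw [← ENNReal.ofReal_add (by positivity) (by positivity),
    ← ENNReal.ofReal_add (by positivity) (by positivity),
    ← ENNReal.ofReal_add (by positivity) (by positivity)]
  congr 1
  ring

/-- A measure whose density is close to a constant vector on a compact null set, and which satisfies
an equation that is elliptic in the direction of that vector, cannot have a fixed proportion of its
mass in the ball of radius `1 / 2`. -/
theorem exists_pos_forall_measure_univ_eq_zero {ι ι' : Type*} [Fintype ι] [Fintype ι'] (hd : d ≠ 0)
    (K : ℕ) (a : ι → ℝ) (j : ι → Fin m) (w : ι → List (Fin d)) (hw : ∀ i, (w i).length = K)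
    (b₀ : ℝ) (j' : ι' → Fin m) (w' : ι' → List (Fin d)) (hw' : ∀ i, (w' i).length < K)
    (P : EuclideanSpace ℝ (Fin m))
    (hell : ∀ ξ : EuclideanSpace ℝ (Fin d), ξ ≠ 0 → ∑ i, a i * P (j i) * ((w i).map ξ).prod ≠ 0)
    {L : ℝ} (hL : 0 < L) :
    ∃ ε : ℝ, 0 < ε ∧ ∀ (ρ : Measure (EuclideanSpace ℝ (Fin d))) [IsFiniteMeasure ρ]
      (f : EuclideanSpace ℝ (Fin d) → EuclideanSpace ℝ (Fin m)), Measurable f →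
      (∀ᵐ x ∂ρ, ‖f x‖ = 1) → ∀ S : Set (EuclideanSpace ℝ (Fin d)), IsCompact S → volume S = 0 →
      ∀ b : ι' → ℝ, ∑ i, |b i| ≤ b₀ →
      (∀ Θ : EuclideanSpace ℝ (Fin d) → ℝ, ContDiff ℝ (⊤ : ℕ∞) Θ → tsupport Θ ⊆ closedBall 0 1 →
        ∀ x ∈ ball (0 : EuclideanSpace ℝ (Fin d)) 1,
          ∑ i, a i * ∫ y, wordDeriv (w i) Θ (y - x) * f y (j i) ∂ρ +
          ∑ i, b i * ∫ y, wordDeriv (w' i) Θ (y - x) * f y (j' i) ∂ρ = 0) →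
      ∫⁻ y, ‖f y - S.indicator (fun _ => P) y‖ₑ ∂ρ ≤ ENNReal.ofReal ε * ρ Set.univ →
      ρ Set.univ ≤ ENNReal.ofReal L * ρ (closedBall 0 (1 / 2)) → ρ Set.univ = 0 := by
  obtain ⟨η, C, hC, hη, hηi, hη1, hηb, hηd, hηm, hpar⟩ :=
    exists_truncated_parametrix K (fun i => a i * P (j i)) w hw hell
  have hv := unitBallVolume_pos (d := d)
  have ha0 : 0 ≤ ∑ i, |a i| := Finset.sum_nonneg fun _ _ => abs_nonneg _
  obtain ⟨n, hn⟩ : ∃ n : ℕ, ((∑ i, |a i| + |b₀|) * C + 2 * C) * (2 ^ n)⁻¹ < 1 / (4 * L) := by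
    have ht : Filter.Tendsto (fun n : ℕ => ((∑ i, |a i| + |b₀|) * C + 2 * C) * ((2 : ℝ) ^ n)⁻¹)
        Filter.atTop (nhds (((∑ i, |a i| + |b₀|) * C + 2 * C) * 0)) :=
      (tendsto_inv_atTop_zero.comp (tendsto_pow_atTop_atTop_of_one_lt one_lt_two)).const_mul _
    rw [mul_zero] at ht
    exact (ht.eventually_lt_const (by positivity)).exists
  obtain ⟨ε, hε, hε0⟩ : ∃ ε : ℝ, C * (2 ^ n) ^ d * (unitBallVolume d * 5 ^ d + 1) * ε +
      (∑ i, |a i|) * (C * √(8 ^ d * ε) + (C + 1) * ε) + ε < 1 / (4 * L) ∧ 0 < ε := by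
    have hc : Continuous fun ε : ℝ => C * (2 ^ n) ^ d * (unitBallVolume d * 5 ^ d + 1) * ε +
      (∑ i, |a i|) * (C * √(8 ^ d * ε) + (C + 1) * ε) + ε := by fun_prop
    have ht := (hc.tendsto 0).mono_left (nhdsWithin_le_nhds (s := Set.Ioi 0))
    simp only [mul_zero, Real.sqrt_zero, add_zero] at ht
    exact ((ht.eventually_lt_const (by positivity)).and self_mem_nhdsWithin).exists
  refine ⟨ε, hε0, fun ρ _ f hf hf1 S hS hSv b hb heq he hdbl => ?_⟩
  by_contra hρ0
  obtain ⟨r, hr⟩ : ∃ r, r = ρ.real Set.univ := ⟨_, rfl⟩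
  have hρ : ρ Set.univ = ENNReal.ofReal r := by rw [hr, ofReal_measureReal]
  have hr0 : 0 < r := by
    rw [hρ, ENNReal.ofReal_eq_zero, not_le] at hρ0
    exact hρ0
  have hb0 : 0 ≤ b₀ := (Finset.sum_nonneg fun _ _ => abs_nonneg _).trans hb
  rw [abs_of_nonneg hb0] at hn
  obtain ⟨s, hsv, hs⟩ : ∃ s : ℝ, volume (cthickening s S) ≤ ENNReal.ofReal ε ∧ 0 < s := by
    have ht := (tendsto_measure_cthickening_of_isCompact (μ := volume) hS).mono_left
      (nhdsWithin_le_nhds (s := Set.Ioi 0))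
    rw [hSv] at ht
    exact ((ht.eventually_le_const (by simpa using hε0)).and self_mem_nhdsWithin).exists
  obtain ⟨N, hN, hnN⟩ : ∃ N : ℕ, C * (s ^ (d + 1))⁻¹ * (2 ^ N)⁻¹ * unitBallVolume d < 1 / (4 * L) ∧
      n ≤ N := by
    have ht : Filter.Tendsto (fun N : ℕ => C * (s ^ (d + 1))⁻¹ * ((2 : ℝ) ^ N)⁻¹ * unitBallVolume d)
        Filter.atTop (nhds (C * (s ^ (d + 1))⁻¹ * 0 * unitBallVolume d)) :=
      ((tendsto_inv_atTop_zero.comp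
        (tendsto_pow_atTop_atTop_of_one_lt one_lt_two)).const_mul _).mul_const _
    rw [mul_zero, zero_mul] at ht
    exact ((ht.eventually_lt_const (by positivity)).and (Filter.eventually_ge_atTop n)).exists
  obtain ⟨Θ, M, κ, hΘ, hΘs, hM, -, hMi, hκ, hΘκ, hΘM, hsum⟩ := hpar n N hnN
  have hΘb : ∀ v, ∃ B, ∀ z, |wordDeriv v Θ z| ≤ B := fun v => by
    have hcs : HasCompactSupport (wordDeriv v Θ) :=
      (isCompact_closedBall _ _).of_isClosed_subset (isClosed_tsupport _)
        ((tsupport_wordDeriv_subset v Θ).trans hΘs)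
    exact hcs.exists_bound_of_continuous (hΘ.wordDeriv v).continuous
  have hup := setLIntegral_mollification_le (D := fun i => wordDeriv (w i) Θ)
    (D' := fun i => wordDeriv (w' i) Θ) (κ := fun i => κ (w i)) hd ρ hr0 hε0.le hC
    (by positivity : (0 : ℝ) ≤ C * (2 ^ n)⁻¹) hs (by positivity) (by positivity) hρ hf hf1
    hS.measurableSet hsv P a j b j' hb hη hηb hηd hM hMi (fun i => hκ _ (hw i))
    (fun i => (hΘ.wordDeriv _).continuous.measurable) (fun i => hΘb _)
    (fun i => hΘκ _ (hw i)) (fun i => hΘM _ (hw' i)) hsum (heq Θ hΘ hΘs)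
    (he.trans_eq (by rw [hρ, ENNReal.ofReal_mul hε0.le]))
  have hlow := measure_closedBall_le_lintegral_dilation hC hη hηi hη1 hηb hηm (ρ.restrict S)
    (c := 2 ^ n) (by positivity)
  have hSc : ρ Sᶜ ≤ ENNReal.ofReal (ε * r) := by
    rw [ENNReal.ofReal_mul hε0.le, ← hρ]
    refine le_trans ?_ he
    rw [← setLIntegral_one]
    refine (setLIntegral_mono_ae' hS.measurableSet.compl (hf1.mono fun y hy hyS => ?_)).trans
      (setLIntegral_le_lintegral _ _)
    rw [Set.indicator_of_notMem hyS, sub_zero, ← ofReal_norm, hy, ENNReal.ofReal_one]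
  have hball : ρ (closedBall 0 (1 / 2)) ≤ (ρ.restrict S) (closedBall 0 (1 / 2)) + ρ Sᶜ := by
    rw [Measure.restrict_apply measurableSet_closedBall, ← measure_inter_add_sdiff
      (closedBall 0 (1 / 2)) hS.measurableSet]
    exact add_le_add le_rfl (measure_mono fun x hx => hx.2)
  have hSu : (ρ.restrict S) Set.univ ≤ ENNReal.ofReal r := by
    rw [Measure.restrict_apply_univ, ← hρ]
    exact measure_mono (Set.subset_univ _)
  have hfin := hdbl.trans (mul_le_mul_right (hball.trans (add_le_add (hlow.trans
    (add_le_add hup (mul_le_mul_right hSu _))) hSc)) _)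
  rw [hρ, ← ENNReal.ofReal_mul (by positivity), ← ENNReal.ofReal_add (by positivity)
    (by positivity), ← ENNReal.ofReal_add (by positivity) (by positivity),
    ← ENNReal.ofReal_mul hL.le, ENNReal.ofReal_le_ofReal_iff (by positivity)] at hfin
  have h2 : 1 ≤ L * ((C * (2 ^ n) ^ d * (unitBallVolume d * 5 ^ d + 1) * ε +
      (∑ i, |a i|) * (C * √(8 ^ d * ε) + (C + 1) * ε) + ε) +
      C * (s ^ (d + 1))⁻¹ * (2 ^ N)⁻¹ * unitBallVolume d +
      ((∑ i, |a i| + b₀) * C + 2 * C) * (2 ^ n)⁻¹) := by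
    refine le_of_mul_le_mul_right ?_ hr0
    rw [one_mul]
    refine hfin.trans_eq ?_
    ring
  have h3 : L * (1 / (4 * L)) = 1 / 4 := by field_simp
  nlinarith [mul_lt_mul_of_pos_left hn hL, mul_lt_mul_of_pos_left hε hL,
    mul_lt_mul_of_pos_left hN hL]

end Concentration

section Symbol

variable {d m n k : ℕ}

theorem sum_multiIdxLe {β : Type*} [AddCommMonoid β] (g : (Fin d → ℕ) → β) :
    ∑ α ∈ multiIdxLe d k, g α = ∑ α ∈ multiIdxEq d k, g α +
      ∑ α ∈ (multiIdxLe d k).filter fun α => ∑ i, α i < k, g α := by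
  rw [← Finset.sum_filter_add_sum_filter_not (multiIdxLe d k) fun α => ∑ i, α i = k]
  congr 1
  · refine Finset.sum_congr ?_ fun _ _ => rfl
    ext α
    simp only [multiIdxLe, multiIdxEq, Finset.mem_filter]
    constructor
    · rintro ⟨⟨h1, -⟩, h2⟩; exact ⟨h1, h2⟩
    · rintro ⟨h1, h2⟩; exact ⟨⟨h1, h2.le⟩, h2⟩
  · refine Finset.sum_congr ?_ fun _ _ => rfl
    ext α
    simp only [multiIdxLe, Finset.mem_filter]
    constructor
    · rintro ⟨h1, h2⟩; exact ⟨h1, lt_of_le_of_ne h1.2 h2⟩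
    · rintro ⟨h1, h2⟩; exact ⟨h1, h2.ne⟩

theorem sum_eq_of_mem_multiIdxEq {α : Fin d → ℕ} (h : α ∈ multiIdxEq d k) : ∑ i, α i = k :=
  (Finset.mem_filter.1 h).2

/-- The coefficient of `ξ ^ β` in the `i`-th row of the principal symbol applied to `P`. -/
def symbolCoeff (A : (Fin d → ℕ) → Matrix (Fin n) (Fin m) ℝ) (P : EuclideanSpace ℝ (Fin m))
    (i : Fin n) (β : Fin d → ℕ) : ℝ := ∑ j, A β i j * P j

theorem sum_symbolCoeff_sq_ne_zero {A : (Fin d → ℕ) → Matrix (Fin n) (Fin m) ℝ}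
    {P : EuclideanSpace ℝ (Fin m)} (hP : (fun j => P j) ∉ waveCone k A)
    {ξ : EuclideanSpace ℝ (Fin d)} (hξ : ξ ≠ 0) :
    ∑ i, (∑ α ∈ multiIdxEq d k, (∏ l, ξ l ^ α l) * symbolCoeff A P i α) ^ 2 ≠ 0 := by
  intro h
  refine hP ⟨fun l => ξ l, fun h0 => hξ ?_, fun i => ?_⟩
  · ext l
    exact congrFun h0 l
  · have := (Finset.sum_eq_zero_iff_of_nonneg fun i _ => sq_nonneg _).1 h i (Finset.mem_univ i)
    exact pow_eq_zero_iff two_ne_zero |>.1 this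

theorem sum_symbolCoeff_mul_eq_zero (A : (Fin d → ℕ) → Matrix (Fin n) (Fin m) ℝ)
    (P : EuclideanSpace ℝ (Fin m)) (r : ℝ) (T : (Fin d → ℕ) → (Fin d → ℕ) → Fin m → ℝ)
    (h : ∀ i, ∀ β ∈ multiIdxEq d k, ∑ α ∈ multiIdxLe d k, (-1 : ℝ) ^ (∑ l, α l) *
      ∑ j, A α i j * (r ^ (k - ∑ l, α l) * T β α j) = 0) :
    (∑ s : Fin n × multiIdxEq d k × multiIdxEq d k × Fin m,
      symbolCoeff A P s.1 s.2.1 * ((-1) ^ k * A s.2.2.1 s.1 s.2.2.2) *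
        T s.2.1 s.2.2.1 s.2.2.2) +
    ∑ s : Fin n × multiIdxEq d k × ((multiIdxLe d k).filter fun α => ∑ i, α i < k) × Fin m,
      symbolCoeff A P s.1 s.2.1 * ((-1) ^ (∑ l, s.2.2.1.1 l) *
        (A s.2.2.1 s.1 s.2.2.2 * r ^ (k - ∑ l, s.2.2.1.1 l))) * T s.2.1 s.2.2.1 s.2.2.2 = 0 := by
  simp only [Fintype.sum_prod_type, ← Finset.sum_add_distrib]
  refine Finset.sum_eq_zero fun i _ => Finset.sum_eq_zero fun β _ => ?_
  have key := congrArg (symbolCoeff A P i β.1 * ·) (h i β.1 β.2)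
  simp only [mul_zero] at key
  rw [← key, sum_multiIdxLe, mul_add, Finset.mul_sum, Finset.mul_sum]
  refine congrArg₂ (· + ·) ?_ ?_
  · rw [← Finset.sum_coe_sort (multiIdxEq d k)]
    refine Finset.sum_congr rfl fun α _ => ?_
    rw [sum_eq_of_mem_multiIdxEq α.2, Nat.sub_self, pow_zero, Finset.mul_sum, Finset.mul_sum]
    refine Finset.sum_congr rfl fun j _ => ?_
    ring
  · rw [← Finset.sum_coe_sort ((multiIdxLe d k).filter fun α => ∑ i, α i < k)]
    refine Finset.sum_congr rfl fun α _ => ?_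
    rw [Finset.mul_sum, Finset.mul_sum]
    refine Finset.sum_congr rfl fun j _ => ?_
    ring

/-- A measure which solves, near the ball of radius `2`, a perturbation by lower-order terms of a
constant-coefficient equation, and whose density is close to a constant vector outside the wave
cone on a compact null set, cannot have a fixed proportion of its mass in the ball of
radius `1 / 2`. -/
theorem exists_pos_forall_measure_univ_eq_zero_of_notMem_waveCone (hd : d ≠ 0)
    (A : (Fin d → ℕ) → Matrix (Fin n) (Fin m) ℝ) {P : EuclideanSpace ℝ (Fin m)}
    (hP : (fun j => P j) ∉ waveCone k A) {L : ℝ} (hL : 0 < L) :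
    ∃ ε : ℝ, 0 < ε ∧ ∀ (ρ : Measure (EuclideanSpace ℝ (Fin d))) [IsFiniteMeasure ρ]
      (f : EuclideanSpace ℝ (Fin d) → EuclideanSpace ℝ (Fin m)), Measurable f →
      (∀ᵐ x ∂ρ, ‖f x‖ = 1) → ∀ S : Set (EuclideanSpace ℝ (Fin d)), IsCompact S → volume S = 0 →
      ∀ r : ℝ, 0 ≤ r → r ≤ 1 →
      (∀ φ : EuclideanSpace ℝ (Fin d) → ℝ, ContDiff ℝ (⊤ : ℕ∞) φ → HasCompactSupport φ →
        tsupport φ ⊆ ball 0 2 → ∀ i, ∑ α ∈ multiIdxLe d k, (-1 : ℝ) ^ (∑ l, α l) *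
          ∑ j, A α i j * (r ^ (k - ∑ l, α l) * ∫ x, pderivMulti α φ x * f x j ∂ρ) = 0) →
      ∫⁻ y, ‖f y - S.indicator (fun _ => P) y‖ₑ ∂ρ ≤ ENNReal.ofReal ε * ρ Set.univ →
      ρ Set.univ ≤ ENNReal.ofReal L * ρ (closedBall 0 (1 / 2)) → ρ Set.univ = 0 := by
  obtain ⟨ε, hε, h⟩ := exists_pos_forall_measure_univ_eq_zero hd (k + k)
    (ι := Fin n × multiIdxEq d k × multiIdxEq d k × Fin m)
    (ι' := Fin n × multiIdxEq d k × ((multiIdxLe d k).filter fun α => ∑ i, α i < k) × Fin m)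
    (fun s => symbolCoeff A P s.1 s.2.1 * ((-1) ^ k * A s.2.2.1 s.1 s.2.2.2)) (fun s => s.2.2.2)
    (fun s => multiIdxWord s.2.1.1 ++ multiIdxWord s.2.2.1.1)
    (fun s => by
      rw [List.length_append, length_multiIdxWord, length_multiIdxWord,
        sum_eq_of_mem_multiIdxEq s.2.1.2, sum_eq_of_mem_multiIdxEq s.2.2.1.2])
    (∑ s : Fin n × multiIdxEq d k × ((multiIdxLe d k).filter fun α => ∑ i, α i < k) × Fin m,
      |symbolCoeff A P s.1 s.2.1 * A s.2.2.1 s.1 s.2.2.2|) (fun s => s.2.2.2)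
    (fun s => multiIdxWord s.2.1.1 ++ multiIdxWord s.2.2.1.1)
    (fun s => by
      rw [List.length_append, length_multiIdxWord, length_multiIdxWord,
        sum_eq_of_mem_multiIdxEq s.2.1.2]
      have := (Finset.mem_filter.1 s.2.2.1.2).2
      omega) P (fun ξ hξ => by
      have h0 := mul_ne_zero (pow_ne_zero k (neg_ne_zero.2 (one_ne_zero (α := ℝ))))
        (sum_symbolCoeff_sq_ne_zero hP hξ)
      refine fun hs => h0 (Eq.trans ?_ hs)
      simp only [Fintype.sum_prod_type, List.map_append, List.prod_append,
        prod_map_multiIdxWord, Finset.mul_sum]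
      refine Finset.sum_congr rfl fun i _ => ?_
      rw [sq, Finset.sum_mul_sum, Finset.mul_sum, ← Finset.sum_coe_sort]
      refine Finset.sum_congr rfl fun β _ => ?_
      rw [Finset.mul_sum, ← Finset.sum_coe_sort]
      refine Finset.sum_congr rfl fun α _ => ?_
      rw [show symbolCoeff A P i α = ∑ j, A α i j * P j from rfl, Finset.mul_sum, Finset.mul_sum,
        Finset.mul_sum]
      refine Finset.sum_congr rfl fun j _ => ?_
      ring) hL
  refine ⟨ε, hε, fun ρ _ f hf hf1 S hS hSv r hr0 hr1 heq he hdbl => ?_⟩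
  refine h ρ f hf hf1 S hS hSv (fun s => symbolCoeff A P s.1 s.2.1 *
    ((-1) ^ (∑ l, s.2.2.1.1 l) * (A s.2.2.1 s.1 s.2.2.2 * r ^ (k - ∑ l, s.2.2.1.1 l)))) ?_ ?_
    he hdbl
  · refine Finset.sum_le_sum fun s _ => ?_
    simp only [abs_mul, abs_pow, abs_neg, abs_one, one_pow, one_mul]
    refine mul_le_mul_of_nonneg_left (mul_le_of_le_one_right (abs_nonneg _) ?_) (abs_nonneg _)
    rw [abs_of_nonneg hr0]
    exact pow_le_one₀ hr0 hr1
  · intro Θ hΘ hΘs x hx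
    have htr : ∀ v, wordDeriv v (fun y => Θ (y - x)) = fun y => wordDeriv v Θ (y - x) := fun v => by
      simpa using wordDeriv_comp_affine hΘ 1 x v
    have hsm : ContDiff ℝ (⊤ : ℕ∞) fun y => Θ (y - x) := hΘ.comp (contDiff_id.sub contDiff_const)
    have hsupp : ∀ v, tsupport (wordDeriv v fun y => Θ (y - x)) ⊆ closedBall x 1 := by
      intro v
      refine (tsupport_wordDeriv_subset _ _).trans (closure_minimal (fun y hy => ?_)
        isClosed_closedBall)
      have := hΘs (subset_tsupport Θ (show y - x ∈ Function.support Θ from hy))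
      rwa [mem_closedBall_zero_iff, ← dist_eq_norm] at this
    have hsub : closedBall x 1 ⊆ ball (0 : EuclideanSpace ℝ (Fin d)) 2 := by
      intro y hy
      have h1 := dist_triangle y x 0
      rw [mem_closedBall] at hy
      rw [mem_ball] at hx ⊢
      linarith
    have hword : ∀ u v, wordDeriv v (wordDeriv u fun y => Θ (y - x)) =
        fun y => wordDeriv (u ++ v) Θ (y - x) := fun u v => by
      rw [← htr, wordDeriv_append]
    refine sum_symbolCoeff_mul_eq_zero A P r (fun β α j =>
      ∫ y, wordDeriv (multiIdxWord β ++ multiIdxWord α) Θ (y - x) * f y j ∂ρ) fun i β _ => ?_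
    have := heq (wordDeriv (multiIdxWord β) fun y => Θ (y - x)) (hsm.wordDeriv _)
      ((isCompact_closedBall x 1).of_isClosed_subset (isClosed_tsupport _) (hsupp _))
      ((hsupp _).trans hsub) i
    simpa only [pderivMulti_eq_wordDeriv, hword] using this

end Symbol

section BlowUp

variable {d m n k : ℕ}

open Filter Topology

/-- A measure with positive lower density at `x` is doubling at `x` along a sequence of radii. -/
theorem exists_radius_measure_closedBall_le (hd : d ≠ 0) (ρ : Measure (EuclideanSpace ℝ (Fin d)))
    [IsFiniteMeasure ρ] {x : EuclideanSpace ℝ (Fin d)} {C : NNReal}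
    (hvol : ∀ᶠ r in 𝓝[>] (0 : ℝ), volume (closedBall x r) ≤ C * ρ (closedBall x r))
    {s : ℝ} (hs : 0 < s) :
    ∃ r, 0 < r ∧ r < s ∧
      ρ (closedBall x (2 * r)) ≤ ENNReal.ofReal (4 ^ (d + 1)) * ρ (closedBall x (r / 2)) := by
  obtain ⟨t, ht, hvt⟩ := mem_nhdsGT_iff_exists_Ioo_subset.1 hvol
  replace ht : 0 < t := ht
  by_contra! hcon
  set u := min s t / 2 with hu
  have hu0 : 0 < u := by positivity
  have hut : u < t := (half_lt_self (by positivity)).trans_le (min_le_right _ _)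
  have hus : u < s := (half_lt_self (by positivity)).trans_le (min_le_left _ _)
  have hpow : ∀ N : ℕ, u * (1 / 4) ^ N ≤ u := fun N =>
    mul_le_of_le_one_right hu0.le (pow_le_one₀ (by norm_num) (by norm_num))
  have hpos : ∀ N : ℕ, 0 < u * (1 / 4 : ℝ) ^ N := fun N => by positivity
  have hdecay : ∀ N : ℕ, (4 ^ (d + 1)) ^ N * ρ.real (closedBall x (u * (1 / 4) ^ N)) ≤
      ρ.real (closedBall x u) := by
    intro N
    induction N with
    | zero => simp
    | succ N ih =>
      refine le_trans ?_ ih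
      have h := hcon (u * (1 / 4) ^ N / 2) (half_pos (hpos N))
        ((half_lt_self (hpos N)).trans_le (hpow N) |>.trans hus)
      rw [mul_div_cancel₀ _ two_ne_zero, div_div,
        show u * (1 / 4 : ℝ) ^ N / (2 * 2) = u * (1 / 4) ^ (N + 1) by ring] at h
      have h' := ENNReal.toReal_mono (measure_ne_top _ _) h.le
      rw [ENNReal.toReal_mul, ENNReal.toReal_ofReal (by positivity)] at h'
      rw [pow_succ, mul_assoc]
      exact mul_le_mul_of_nonneg_left h' (by positivity)
  have hbound : ∀ N : ℕ, unitBallVolume d * u ^ d * 4 ^ N ≤ C * ρ.real (closedBall x u) := by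
    intro N
    have h := hvt ⟨hpos N, (hpow N).trans_lt hut⟩
    rw [Set.mem_ofPred_eq, volume_closedBall_eq hd _ (hpos N).le] at h
    have h' := ENNReal.toReal_mono (ENNReal.mul_ne_top ENNReal.coe_ne_top (measure_ne_top _ _)) h
    rw [ENNReal.toReal_mul, ENNReal.toReal_ofReal (mul_nonneg unitBallVolume_pos.le
      (pow_nonneg (hpos N).le _)), ENNReal.coe_toReal] at h'
    calc unitBallVolume d * u ^ d * 4 ^ N
        = (4 ^ (d + 1)) ^ N * (unitBallVolume d * (u * (1 / 4) ^ N) ^ d) := by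
          have : (4 : ℝ) ^ (N * d) * (1 / 4) ^ (N * d) = 1 := by rw [← mul_pow]; norm_num
          rw [mul_pow, ← pow_mul, ← pow_mul, add_mul, one_mul, pow_add, mul_comm d N]
          linear_combination (-(unitBallVolume d * u ^ d * 4 ^ N)) * this
      _ ≤ (4 ^ (d + 1)) ^ N * (C * ρ.real (closedBall x (u * (1 / 4) ^ N))) :=
          mul_le_mul_of_nonneg_left h' (by positivity)
      _ = C * ((4 ^ (d + 1)) ^ N * ρ.real (closedBall x (u * (1 / 4) ^ N))) := by ring
      _ ≤ _ := mul_le_mul_of_nonneg_left (hdecay N) C.2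
  have hω : 0 < unitBallVolume d * u ^ d := mul_pos unitBallVolume_pos (pow_pos hu0 d)
  obtain ⟨N, hN⟩ := pow_unbounded_of_one_lt (C * ρ.real (closedBall x u) /
    (unitBallVolume d * u ^ d)) (by norm_num : (1 : ℝ) < 4)
  rw [div_lt_iff₀ hω, mul_comm (4 ^ N)] at hN
  exact absurd (hbound N) (not_le.2 hN)

/-- The polar of an `𝒜`-free measure lies in the wave cone at every Lebesgue point of the polar
restricted to a compact null set at which the measure has positive lower density. -/
theorem polar_mem_waveCone_of_tendsto (hd : d ≠ 0) (A : (Fin d → ℕ) → Matrix (Fin n) (Fin m) ℝ)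
    {Ω : Set (EuclideanSpace ℝ (Fin d))} (hΩ : IsOpen Ω)
    (ρ : Measure (EuclideanSpace ℝ (Fin d))) [IsFiniteMeasure ρ]
    {f : EuclideanSpace ℝ (Fin d) → EuclideanSpace ℝ (Fin m)} (hf : Measurable f)
    (hpolar : ∀ᵐ x ∂ρ, ‖f x‖ = 1)
    (hfree : ∀ φ : EuclideanSpace ℝ (Fin d) → ℝ,
      ContDiff ℝ (⊤ : ℕ∞) φ → HasCompactSupport φ → tsupport φ ⊆ Ω →
      ∀ i : Fin n, ∑ α ∈ multiIdxLe d k, (-1 : ℝ) ^ (∑ l, α l) *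
        ∑ j, A α i j * ∫ x, pderivMulti α φ x * f x j ∂ρ = 0)
    {K : Set (EuclideanSpace ℝ (Fin d))} (hK : IsCompact K) (hKv : volume K = 0)
    {x₀ : EuclideanSpace ℝ (Fin d)} (hxK : x₀ ∈ K) (hxΩ : x₀ ∈ Ω) (hx1 : ‖f x₀‖ = 1) {C : NNReal}
    (hvol : ∀ᶠ r in 𝓝[>] (0 : ℝ), volume (closedBall x₀ r) ≤ C * ρ (closedBall x₀ r))
    (hleb : Tendsto (fun r => (∫⁻ y in closedBall x₀ r,
      ‖K.indicator f y - K.indicator f x₀‖ₑ ∂ρ) / ρ (closedBall x₀ r)) (𝓝[>] 0) (𝓝 0)) :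
    (fun j => f x₀ j) ∈ waveCone k A := by
  by_contra hP
  obtain ⟨ε, hε, h⟩ := exists_pos_forall_measure_univ_eq_zero_of_notMem_waveCone hd A hP
    (L := 4 ^ (d + 1)) (by positivity)
  have hleb' := hleb.eventually (gt_mem_nhds (ENNReal.ofReal_pos.2 hε))
  obtain ⟨t, ht, htΩ⟩ := Metric.isOpen_iff.1 hΩ x₀ hxΩ
  obtain ⟨s, hs, hss⟩ := mem_nhdsGT_iff_exists_Ioo_subset.1 (hvol.and hleb')
  replace hs : 0 < s := hs
  obtain ⟨r, hr0, hrs, hdbl⟩ := exists_radius_measure_closedBall_le hd ρ hvol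
    (s := min (min 1 (t / 2)) (s / 2)) (by positivity)
  have hr1 : r ≤ 1 := hrs.le.trans ((min_le_left _ _).trans (min_le_left _ _))
  have hrt : 2 * r < t := by
    have := hrs.trans_le ((min_le_left _ _).trans (min_le_right _ _)); linarith
  have hrs' : 2 * r < s := by
    have := hrs.trans_le (min_le_right _ _); linarith
  obtain ⟨hv, hl⟩ := hss ⟨by positivity, hrs'⟩
  have hball_pos : ρ (closedBall x₀ (2 * r)) ≠ 0 := by
    intro h0
    rw [h0, mul_zero] at hv
    exact (measure_closedBall_pos volume x₀ (by positivity : (0 : ℝ) < 2 * r)).not_ge hv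
  replace hl : ∫⁻ y in closedBall x₀ (2 * r), ‖K.indicator f y - K.indicator f x₀‖ₑ ∂ρ ≤
      ENNReal.ofReal ε * ρ (closedBall x₀ (2 * r)) :=
    (ENNReal.div_le_iff_le_mul (Or.inl hball_pos) (Or.inl (measure_ne_top _ _))).1 hl.le
  set T : EuclideanSpace ℝ (Fin d) ≃ₜ EuclideanSpace ℝ (Fin d) :=
    (Homeomorph.subRight x₀).trans (Homeomorph.smulOfNeZero r⁻¹ (inv_ne_zero hr0.ne')) with hT
  have hTy : ∀ y, T y = r⁻¹ • (y - x₀) := fun _ => rfl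
  have hTT : ∀ y, x₀ + r • T y = y := fun y => by
    rw [hTy, smul_inv_smul₀ hr0.ne', add_sub_cancel]
  have hTn : ∀ y, ‖T y‖ = dist y x₀ / r := fun y => by
    rw [hTy, norm_smul, norm_inv, Real.norm_of_nonneg hr0.le, dist_eq_norm, inv_mul_eq_div]
  have hTe := T.measurableEmbedding
  have hTK : T ⁻¹' (T '' K) = K := T.injective.preimage_image K
  have hind : ∀ y, (T '' K).indicator (fun _ => f x₀) (T y) = K.indicator (fun _ => f x₀) y :=
    fun y => by
      rw [← Set.indicator_comp_right (f := T) (g := fun _ => f x₀), hTK]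
      rfl
  have hmap : (Measure.map T (ρ.restrict (closedBall x₀ (2 * r)))) Set.univ =
      ρ (closedBall x₀ (2 * r)) := by
    rw [Measure.map_apply hTe.measurable .univ, Set.preimage_univ, Measure.restrict_apply_univ]
  have := h (Measure.map T (ρ.restrict (closedBall x₀ (2 * r)))) (fun z => f (x₀ + r • z))
    (hf.comp (by fun_prop)) (by
      rw [hTe.ae_map_iff]
      simp only [hTT]
      exact ae_restrict_of_ae hpolar) (T '' K) (hK.image T.continuous) (by
      rw [show (T : EuclideanSpace ℝ (Fin d) → EuclideanSpace ℝ (Fin d)) =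
        (fun z => r⁻¹ • z) ∘ (fun y => y + -x₀) by ext1 y; simp [hTy, sub_eq_add_neg],
        Set.image_comp]
      rw [Set.image_smul, Measure.addHaar_smul, Set.image_add_right, measure_preimage_add_right,
        hKv, mul_zero]) r hr0.le hr1 ?_ ?_ ?_
  · exact hball_pos (hmap ▸ this)
  · intro φ hφ hφc hφs i
    have hsupp : tsupport (fun y => φ (r⁻¹ • (y - x₀))) ⊆ T ⁻¹' tsupport φ :=
      closure_minimal (fun y hy => subset_tsupport φ hy)
        ((isClosed_tsupport φ).preimage T.continuous)
    have hsupp' : T ⁻¹' tsupport φ ⊆ closedBall x₀ (2 * r) := by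
      intro y hy
      have := hφs hy
      rw [mem_ball_zero_iff, hTn, div_lt_iff₀ hr0] at this
      exact this.le
    have hsm : ContDiff ℝ (⊤ : ℕ∞) fun y => φ (r⁻¹ • (y - x₀)) :=
      hφ.comp ((contDiff_id.sub contDiff_const).const_smul r⁻¹)
    have key := hfree (fun y => φ (r⁻¹ • (y - x₀))) hsm
      ((isCompact_closedBall x₀ (2 * r)).of_isClosed_subset (isClosed_tsupport _)
        (hsupp.trans hsupp'))
      ((hsupp.trans hsupp').trans ((closedBall_subset_ball hrt).trans htΩ)) i
    have hint : ∀ α j, ∫ z, pderivMulti α φ z * f (x₀ + r • z) j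
        ∂(Measure.map T (ρ.restrict (closedBall x₀ (2 * r)))) = r ^ (∑ l, α l) *
        ∫ y, pderivMulti α (fun y => φ (r⁻¹ • (y - x₀))) y * f y j ∂ρ := by
      intro α j
      rw [hTe.integral_map]
      simp only [hTT, pderivMulti_eq_wordDeriv, wordDeriv_comp_affine hφ, length_multiIdxWord]
      rw [setIntegral_eq_integral_of_forall_compl_eq_zero, ← integral_const_mul]
      · refine integral_congr_ae (Eventually.of_forall fun y => ?_)
        simp only [← hTy]
        rw [← mul_assoc, ← mul_assoc, ← mul_pow, mul_inv_cancel₀ hr0.ne', one_pow, one_mul]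
      · intro y hy
        have : T y ∉ tsupport (wordDeriv (multiIdxWord α) φ) := fun hm =>
          hy (hsupp' (tsupport_wordDeriv_subset _ _ hm))
        rw [image_eq_zero_of_notMem_tsupport this, zero_mul]
    rw [← mul_zero (r ^ k), ← key, Finset.mul_sum]
    refine Finset.sum_congr rfl fun α hα => ?_
    have hαk : ∑ l, α l ≤ k := (Finset.mem_filter.1 hα).2
    rw [mul_left_comm, Finset.mul_sum _ _ (r ^ k)]
    refine congrArg _ (Finset.sum_congr rfl fun j _ => ?_)
    rw [hint, ← mul_assoc (r ^ (k - _)), ← pow_add, Nat.sub_add_cancel hαk]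
    ring
  · rw [hTe.lintegral_map, hmap]
    refine le_trans (lintegral_mono_ae ?_) hl
    filter_upwards [ae_restrict_of_ae hpolar] with y hy
    rw [hTT, hind]
    by_cases hyK : y ∈ K
    · simp [hyK, hxK]
    · simp only [hyK, hxK, not_false_eq_true, Set.indicator_of_notMem, Set.indicator_of_mem,
        sub_zero, zero_sub, enorm_neg]
      rw [← ofReal_norm, ← ofReal_norm, hy, hx1]
  · rw [hmap, Measure.map_apply hTe.measurable measurableSet_closedBall]
    refine hdbl.trans (mul_le_mul_right (le_trans (measure_mono fun y hy => ?_)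
      (Measure.le_restrict_apply _ _)) _)
    rw [mem_closedBall] at hy
    refine ⟨?_, ?_⟩
    · rw [Set.mem_preimage, mem_closedBall_zero_iff, hTn, div_le_iff₀ hr0]
      linarith
    · rw [mem_closedBall]
      linarith

/-- The polar of an `𝒜`-free measure lies in the wave cone at almost every point of a compact
null set. -/
theorem ae_mem_imp_polar_mem_waveCone (hd : d ≠ 0) (A : (Fin d → ℕ) → Matrix (Fin n) (Fin m) ℝ)
    {Ω : Set (EuclideanSpace ℝ (Fin d))} (hΩ : IsOpen Ω)
    (ρ : Measure (EuclideanSpace ℝ (Fin d))) [IsFiniteMeasure ρ] (hρΩ : ρ Ωᶜ = 0)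
    {f : EuclideanSpace ℝ (Fin d) → EuclideanSpace ℝ (Fin m)} (hf : Measurable f)
    (hpolar : ∀ᵐ x ∂ρ, ‖f x‖ = 1)
    (hfree : ∀ φ : EuclideanSpace ℝ (Fin d) → ℝ,
      ContDiff ℝ (⊤ : ℕ∞) φ → HasCompactSupport φ → tsupport φ ⊆ Ω →
      ∀ i : Fin n, ∑ α ∈ multiIdxLe d k, (-1 : ℝ) ^ (∑ l, α l) *
        ∑ j, A α i j * ∫ x, pderivMulti α φ x * f x j ∂ρ = 0)
    {K : Set (EuclideanSpace ℝ (Fin d))} (hK : IsCompact K) (hKv : volume K = 0) :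
    ∀ᵐ x ∂ρ, x ∈ K → (fun j => f x j) ∈ waveCone k A := by
  have hint : Integrable f ρ :=
    Integrable.of_bound hf.aestronglyMeasurable 1 (hpolar.mono fun x hx => hx.le)
  filter_upwards [hpolar, compl_mem_ae_iff.2 hρΩ, Measure.rnDeriv_lt_top volume ρ,
    Besicovitch.ae_tendsto_rnDeriv volume ρ,
    (Besicovitch.vitaliFamily ρ).ae_tendsto_lintegral_enorm_sub_div
      (hint.indicator hK.measurableSet).locallyIntegrable] with x hx1 hxΩ hlt hrn hleb hxK
  rw [compl_compl] at hxΩ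
  obtain ⟨C, hC, -⟩ := ENNReal.lt_iff_exists_nnreal_btwn.1 hlt
  refine polar_mem_waveCone_of_tendsto hd A hΩ ρ hf hpolar hfree hK hKv hxK hxΩ hx1 (C := C) ?_
    (hleb.comp (Besicovitch.tendsto_filterAt ρ x))
  filter_upwards [hrn.eventually (gt_mem_nhds hC)] with r hr
  exact (ENNReal.div_le_iff_le_mul (Or.inr ENNReal.coe_ne_top)
    (Or.inl (measure_ne_top _ _))).1 hr.le

end BlowUp

/-- **Structure theorem for 𝒜-free measures** (De Philippis–Rindler).
The measure `μ` is represented as `μ = f · ρ` with `ρ = |μ|` its (finite, positive)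
total variation measure, concentrated on the open set `Ω`, and `f = dμ/d|μ|` its polar,
of norm one `ρ`-a.e.  If `𝒜 μ = 0` in `𝒟'(Ω; ℝ^n)`, then the polar lies in the wave
cone `Λ_𝒜` at `|μ|^s`-a.e. point. -/
theorem statement0 {d m n k : ℕ}
    (A : (Fin d → ℕ) → Matrix (Fin n) (Fin m) ℝ)
    (Ω : Set (EuclideanSpace ℝ (Fin d))) (hΩ : IsOpen Ω)
    (ρ : Measure (EuclideanSpace ℝ (Fin d))) [IsFiniteMeasure ρ]
    (hρΩ : ρ Ωᶜ = 0)
    (f : EuclideanSpace ℝ (Fin d) → EuclideanSpace ℝ (Fin m))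
    (hf : AEStronglyMeasurable f ρ)
    (hpolar : ∀ᵐ x ∂ρ, ‖f x‖ = 1)
    (hfree : ∀ φ : EuclideanSpace ℝ (Fin d) → ℝ,
      ContDiff ℝ (⊤ : ℕ∞) φ → HasCompactSupport φ → tsupport φ ⊆ Ω →
      ∀ i : Fin n,
        ∑ α ∈ multiIdxLe d k, (-1 : ℝ) ^ (∑ l, α l) *
          ∑ j, A α i j * ∫ x, pderivMulti α φ x * f x j ∂ρ = 0) :
    ∀ᵐ x ∂(ρ.singularPart volume), (fun j => f x j) ∈ waveCone k A := by
  obtain ⟨s, hs, hs0, hsv⟩ := Measure.mutuallySingular_singularPart ρ volume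
  rcases eq_or_ne d 0 with rfl | hd
  · have hempty : sᶜ = ∅ := by
      by_contra hne
      obtain ⟨x, hx⟩ := Set.nonempty_iff_ne_empty.2 hne
      have : sᶜ = Set.univ := Set.eq_univ_of_forall fun y => Subsingleton.elim x y ▸ hx
      rw [this] at hsv
      exact (isOpen_univ.measure_pos volume ⟨x, trivial⟩).ne' hsv
    rw [Set.compl_empty_iff] at hempty
    rw [hempty, Measure.measure_univ_eq_zero] at hs0
    rw [hs0]
    exact ae_zero ▸ Filter.eventually_bot
  · have hmk := hf.ae_eq_mk
    have hmem : ∀ K : Set (EuclideanSpace ℝ (Fin d)), IsCompact K → volume K = 0 →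
        ∀ᵐ x ∂ρ, x ∈ K → (fun j => f x j) ∈ waveCone k A := by
      intro K hK hKv
      have := ae_mem_imp_polar_mem_waveCone hd A hΩ ρ hρΩ hf.stronglyMeasurable_mk.measurable
        (by filter_upwards [hmk, hpolar] with x h1 h2; rwa [← h1])
        (fun φ h1 h2 h3 i => by
          rw [← hfree φ h1 h2 h3 i]
          refine Finset.sum_congr rfl fun α _ => congrArg _ <| Finset.sum_congr rfl fun j _ =>
            congrArg _ <| integral_congr_ae ?_
          filter_upwards [hmk] with x hx
          rw [hx]) hK hKv
      filter_upwards [this, hmk] with x hx h1 hxK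
      rw [h1]
      exact hx hxK
    rw [ae_iff]
    refine le_antisymm (le_of_forall_pos_le_add fun ε hε => ?_) (zero_le)
    rw [zero_add]
    obtain ⟨K, hKs, hK, hKε⟩ := hs.compl.exists_isCompact_sdiff_lt (measure_ne_top ρ _) hε.ne'
    refine (measure_mono (t := s ∪ (sᶜ \ K ∪ {x | ¬ (x ∈ K → (fun j => f x j) ∈ waveCone k A)}))
      fun x hx => ?_).trans ((measure_union_le _ _).trans ?_)
    · by_cases hxs : x ∈ s
      · exact Or.inl hxs
      · by_cases hxK : x ∈ K
        · exact Or.inr (Or.inr fun h => hx (h hxK))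
        · exact Or.inr (Or.inl ⟨hxs, hxK⟩)
    · rw [hs0, zero_add]
      refine (Measure.singularPart_le ρ volume _).trans ((measure_union_le _ _).trans ?_)
      rw [ae_iff.1 (hmem K hK (measure_mono_null hKs hsv)), add_zero]
      exact hKε.le
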